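/- arXiv:1411.6283 — 2 statements merged into one kernel-verified Lean document; each statement's English description precedes it below -/
import Mathlib

section
/- Let n ≥ 5, let 4 ≤ K ≤ n−2, let p ≥ 2, and let c₁,…,c_{2p+1} be pairwise distinct vertices of V forming an odd cycle C of length 2p+1, with edge set E(C) = {c_i c_{i+1} : 1 ≤ i ≤ 2p+1} and 2-chord set E(C̄) = {c_i c_{i+2} : 1 ≤ i ≤ 2p+1} (indices taken modulo 2p+1). Set U = V ∖ {c₁,…,c_{2p+1}}. If |U ∩ {1,2,3}| ≥ 2 and p ≤ n − K − |U ∩ {1,2,3}|, then the 2-chorded cycle inequality Σ_{e ∈ E(C)} x_e − Σ_{e ∈ E(C̄)} x_e ≤ p is facet-defining for P_{n,K}. -/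
/-- A `K`-partition of `V = {1,…,n}`: a family of `K` nonempty pairwise disjoint
subsets of `V` (clusters) whose union is `V`. -/
structure KPartition (n K : ℕ) where
  parts : Finset (Finset ℕ)
  card_parts : parts.card = K
  parts_nonempty : ∀ C ∈ parts, C.Nonempty
  parts_disjoint : ∀ C ∈ parts, ∀ D ∈ parts, C ≠ D → Disjoint C D
  parts_cover : parts.sup id = Finset.Icc 1 n

/-- The ambient space: one (symmetric) edge coordinate for each pair of vertices and one
representative coordinate for each vertex (only the coordinates of edges `uv ∈ E` and of
vertices `v ∈ {4,…,n}` are actually used; the remaining ones are affinely determined, so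
affine dimensions agree with those in `ℝ^{|E|+n-3}`). -/
abbrev GPoint : Type := (ℕ × ℕ → ℝ) × (ℕ → ℝ)

open Classical in
/-- The characteristic vector of a `K`-partition: edge component `x_{u,v} = 1` iff `u` and `v`
lie in the same cluster; representative component `x_v = 1` (for `v ∈ {4,…,n}`) iff `v` is the
smallest element of its cluster. -/
noncomputable def charVec (n K : ℕ) (π : KPartition n K) : GPoint :=
  ⟨fun p => if ∃ C ∈ π.parts, p.1 ∈ C ∧ p.2 ∈ C then 1 else 0,
   fun v => if 4 ≤ v ∧ ∃ C ∈ π.parts, v ∈ C ∧ ∀ w ∈ C, v ≤ w then 1 else 0⟩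

/-- `P_{n,K}`: the convex hull of the characteristic vectors of all `K`-partitions. -/
noncomputable def PolyP (n K : ℕ) : Set GPoint :=
  convexHull ℝ {x | ∃ π : KPartition n K, x = charVec n K π}

/-- Affine dimension of a set: the rank of the direction of its affine span. -/
noncomputable def adim (s : Set GPoint) : ℕ :=
  Module.finrank ℝ (affineSpan ℝ s).direction

/-- `f x ≤ b` is a valid inequality for `P_{n,K}` which is facet-defining. -/
def IsFacetLe (n K : ℕ) (f : GPoint → ℝ) (b : ℝ) : Prop :=
  (∀ x ∈ PolyP n K, f x ≤ b) ∧
  adim {x | x ∈ PolyP n K ∧ f x = b} + 1 = adim (PolyP n K)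

/-- `f x ≥ b` is a valid inequality for `P_{n,K}` which is facet-defining. -/
def IsFacetGe (n K : ℕ) (f : GPoint → ℝ) (b : ℝ) : Prop :=
  (∀ x ∈ PolyP n K, b ≤ f x) ∧
  adim {x | x ∈ PolyP n K ∧ f x = b} + 1 = adim (PolyP n K)

/-- Sum of the edge components of `x` over the edges with both endpoints in `A`. -/
noncomputable def edgeSum (A : Finset ℕ) (x : GPoint) : ℝ :=
  ∑ e ∈ A.offDiag.filter (fun e => e.1 < e.2), x.1 e

/-- Between a coarse and a fine labelling there are labellings with any intermediate number of
labels. -/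
theorem exists_intermediate_labelling (W : Finset ℕ) (f₁ : ℕ → ℕ) (K : ℕ)
    (hK : K ≤ (W.image f₁).card) (f₀ : ℕ → ℕ)
    (h : ∀ u ∈ W, ∀ v ∈ W, f₁ u = f₁ v → f₀ u = f₀ v) (h₀ : (W.image f₀).card ≤ K) :
    ∃ f : ℕ → ℕ, (W.image f).card = K ∧
      (∀ u ∈ W, ∀ v ∈ W, f₁ u = f₁ v → f u = f v) ∧
      ∀ u ∈ W, ∀ v ∈ W, f u = f v → f₀ u = f₀ v := by
  obtain ⟨m, hm⟩ := Nat.exists_eq_add_of_le h₀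
  induction m generalizing f₀ with
  | zero => exact ⟨f₀, by omega, h, fun _ _ _ _ h => h⟩
  | succ m ih =>
    have hsplit : ∃ u ∈ W, ∃ v ∈ W, f₀ u = f₀ v ∧ f₁ u ≠ f₁ v := by
      by_contra! hcon
      have hle : (W.image f₁).card ≤ (W.image f₀).card := by
        choose! g hg using fun l (hl : l ∈ W.image f₁) => Finset.mem_image.mp hl
        refine Finset.card_le_card_of_injOn (fun l => f₀ (g l))
          (fun l hl => Finset.mem_image_of_mem _ (hg l hl).1) fun l hl l' hl' hll => ?_
        rw [← (hg l hl).2, ← (hg l' hl').2]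
        exact hcon _ (hg l hl).1 _ (hg l' hl').1 hll
      omega
    obtain ⟨u, hu, v, hv, huv, huv'⟩ := hsplit
    obtain ⟨L, hL⟩ := Infinite.exists_notMem_finset (W.image f₀)
    have hL' : ∀ w ∈ W, f₀ w ≠ L := fun w hw e => hL (e ▸ Finset.mem_image_of_mem _ hw)
    let f₀' : ℕ → ℕ := fun w => if f₁ w = f₁ v then L else f₀ w
    have himg : W.image f₀' = insert L (W.image f₀) := by
      ext l
      simp only [Finset.mem_image, Finset.mem_insert, f₀']
      constructor
      · rintro ⟨w, hw, rfl⟩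
        split_ifs
        · exact Or.inl rfl
        · exact Or.inr ⟨w, hw, rfl⟩
      · rintro (rfl | ⟨w, hw, rfl⟩)
        · exact ⟨v, hv, if_pos rfl⟩
        · by_cases hwv : f₁ w = f₁ v
          · exact ⟨u, hu, by rw [if_neg huv', huv, h w hw v hv hwv]⟩
          · exact ⟨w, hw, if_neg hwv⟩
    have hcard : (W.image f₀').card = (W.image f₀).card + 1 := by
      rw [himg, Finset.card_insert_of_notMem hL]
    obtain ⟨f, hf, hf₁, hf₀⟩ := ih f₀' (fun w hw w' hw' hww => by
      simp only [f₀', hww, h w hw w' hw' hww]) (by omega) (by omega)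
    refine ⟨f, hf, hf₁, fun w hw w' hw' hww => ?_⟩
    have := hf₀ w hw w' hw' hww
    simp only [f₀'] at this
    split_ifs at this with h₁ h₂ h₂
    · exact h w hw w' hw' (h₁.trans h₂.symm)
    · exact absurd this.symm (hL' w' hw')
    · exact absurd this (hL' w hw)
    · exact this

/-- The vertices `d 0, d 1, …` run around a cycle of length `2p+1` in `{1,…,n}`. -/
structure IsOddCycle (n p : ℕ) (d : ℕ → ℕ) : Prop where
  mem : ∀ k, d k ∈ Finset.Icc 1 n
  eq_iff : ∀ j k, d j = d k ↔ j ≡ k [MOD 2 * p + 1]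

namespace IsOddCycle

variable {n p : ℕ} {d : ℕ → ℕ}

theorem shift (hd : IsOddCycle n p d) (i : ℕ) : IsOddCycle n p fun k => d (i + k) where
  mem k := hd.mem _
  eq_iff j k := by
    rw [hd.eq_iff]
    exact ⟨Nat.ModEq.add_left_cancel' i, Nat.ModEq.add_left i⟩

theorem inj (hd : IsOddCycle n p d) {j k : ℕ} (hj : j < 2 * p + 1) (hk : k < 2 * p + 1)
    (h : d j = d k) : j = k :=
  Nat.ModEq.eq_of_lt_of_lt ((hd.eq_iff j k).1 h) hj hk

theorem add_period (hd : IsOddCycle n p d) (k : ℕ) : d (k + (2 * p + 1)) = d k :=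
  (hd.eq_iff _ _).2 (by simp [Nat.ModEq])

/-- A colouring of the pairs `{d (2t+1), d (2t+2)}` and of the remaining vertices. -/
theorem exists_colouring (hd : IsOddCycle n p d) (col free : ℕ → ℕ) :
    ∃ κ : ℕ → ℕ, (∀ k < 2 * p, κ (d (k + 1)) = col (k / 2)) ∧
      ∀ v, (∀ k < 2 * p, v ≠ d (k + 1)) → κ v = free v := by
  classical
  refine ⟨fun v => if h : ∃ k < 2 * p, v = d (k + 1) then col (h.choose / 2) else free v,
    fun k hk => ?_, fun v hv => ?_⟩
  · have h : ∃ j < 2 * p, d (k + 1) = d (j + 1) := ⟨k, hk, rfl⟩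
    have := hd.inj (by omega) (by have := h.choose_spec.1; omega) h.choose_spec.2
    simp only [dif_pos h]
    congr 2
    omega
  · exact dif_neg fun ⟨k, hk, e⟩ => hv k hk e

/-- A colouring constant on the pairs `{d (2t+1), d (2t+2)}` can be refined to a labelling of `W`
with exactly `K` labels that is constant on the pairs. -/
theorem exists_labelling (hd : IsOddCycle n p d) (κ : ℕ → ℕ)
    (hκ : ∀ t < p, κ (d (2 * t + 1)) = κ (d (2 * t + 2))) (W : Finset ℕ) (e₁ e₂ K : ℕ)
    (hW : ∀ v ∈ Finset.Icc 1 n, v ≠ e₁ → v ≠ e₂ → (∀ t < p, v ≠ d (2 * t + 1)) → v ∈ W)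
    (hc : (W.image κ).card ≤ K) (hK : K + p + 2 ≤ n) :
    ∃ f : ℕ → ℕ, (W.image f).card = K ∧
      (∀ t < p, d (2 * t + 1) ∈ W → d (2 * t + 2) ∈ W → f (d (2 * t + 1)) = f (d (2 * t + 2))) ∧
      ∀ u ∈ W, ∀ v ∈ W, κ u ≠ κ v → f u ≠ f v := by
  classical
  let f₁ : ℕ → ℕ := fun v => if h : ∃ t < p, v = d (2 * t + 1) then d (2 * h.choose + 2) else v
  have hodd : ∀ t < p, f₁ (d (2 * t + 1)) = d (2 * t + 2) := fun t ht => by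
    have h : ∃ s < p, d (2 * t + 1) = d (2 * s + 1) := ⟨t, ht, rfl⟩
    have := hd.inj (by omega) (by have := h.choose_spec.1; omega) h.choose_spec.2
    simp only [f₁, dif_pos h]
    congr 1
    omega
  have hother : ∀ v, (∀ t < p, v ≠ d (2 * t + 1)) → f₁ v = v := fun v hv =>
    dif_neg fun ⟨t, ht, e⟩ => hv t ht e
  have heven : ∀ t < p, f₁ (d (2 * t + 2)) = d (2 * t + 2) := fun t ht =>
    hother _ fun s hs e => by have := hd.inj (by omega) (by omega) e; omega
  have hκf : ∀ v, κ (f₁ v) = κ v := fun v => by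
    by_cases h : ∃ t < p, v = d (2 * t + 1)
    · obtain ⟨t, ht, rfl⟩ := h
      rw [hodd t ht, hκ t ht]
    · rw [hother v fun t ht e => h ⟨t, ht, e⟩]
  let W' := Finset.Icc 1 n \ ({e₁, e₂} ∪ (Finset.range p).image fun t => d (2 * t + 1))
  have hW'sub : W' ⊆ W.image f₁ := fun v hv => by
    simp only [W', Finset.mem_sdiff, Finset.mem_union, Finset.mem_insert, Finset.mem_singleton,
      Finset.mem_image, Finset.mem_range, not_or, not_exists, not_and] at hv
    have hv' : ∀ t < p, v ≠ d (2 * t + 1) := fun t ht e => hv.2.2 t ht e.symm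
    exact Finset.mem_image.2 ⟨v, hW v hv.1 hv.2.1.1 hv.2.1.2 hv', hother v hv'⟩
  have hW'card : n ≤ W'.card + (2 + p) := by
    have h₁ := Finset.le_card_sdiff ({e₁, e₂} ∪ (Finset.range p).image fun t => d (2 * t + 1))
      (Finset.Icc 1 n)
    have h₂ := Finset.card_union_le {e₁, e₂} ((Finset.range p).image fun t => d (2 * t + 1))
    have h₃ := Finset.card_image_le (s := Finset.range p) (f := fun t => d (2 * t + 1))
    have h₄ := Finset.card_le_two (a := e₁) (b := e₂)
    simp only [Nat.card_Icc, Finset.card_range] at h₁ h₃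
    simp only [W']
    omega
  obtain ⟨f, hf, hf₁, hf₀⟩ := exists_intermediate_labelling W f₁ K
    (by have := Finset.card_le_card hW'sub; omega) κ
    (fun u _ v _ e => by rw [← hκf u, ← hκf v, e]) hc
  exact ⟨f, hf, fun t ht h₁ h₂ => hf₁ _ h₁ _ h₂ (by rw [hodd t ht, heven t ht]),
    fun u hu v hv hne e => hne (hf₀ u hu v hv e)⟩

end IsOddCycle

/-- The labelling is constant on the pairs `{d (2t+1), d (2t+2)}` and separates cyclically
consecutive pairs. -/
structure IsTight (p : ℕ) (d : ℕ → ℕ) (f : ℕ → ℕ) : Prop where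
  pair : ∀ t < p, f (d (2 * t + 1)) = f (d (2 * t + 2))
  adj : ∀ t, t + 1 < p → f (d (2 * t + 2)) ≠ f (d (2 * t + 4))
  wrap : f (d 2) ≠ f (d (2 * p))

/-- Colours of the pairs: pair `t₀` gets colour `0`, the others alternate between `B` and `B+1`. -/
def pairColour (p t₀ B t : ℕ) : ℕ :=
  if t = t₀ then 0 else if t < t₀ then B + t % 2 else B + (t + p) % 2

theorem pairColour_self (p t₀ B : ℕ) : pairColour p t₀ B t₀ = 0 := if_pos rfl

theorem pairColour_mem (p B : ℕ) {t₀ t : ℕ} (h : t ≠ t₀) :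
    B ≤ pairColour p t₀ B t ∧ pairColour p t₀ B t ≤ B + 1 := by
  unfold pairColour; split_ifs <;> omega

theorem pairColour_adj (p B : ℕ) (hB : 0 < B) (t₀ t : ℕ) :
    pairColour p t₀ B t ≠ pairColour p t₀ B (t + 1) := by
  unfold pairColour; split_ifs <;> omega

theorem pairColour_wrap (p B : ℕ) (hB : 0 < B) (hp : 2 ≤ p) (t₀ : ℕ) (ht₀ : t₀ < p) :
    pairColour p t₀ B 0 ≠ pairColour p t₀ B (p - 1) := by
  unfold pairColour; split_ifs <;> omega

namespace IsOddCycle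

variable {n p : ℕ} {d : ℕ → ℕ}

/-- Labellings with two movable vertices outside the pairs. -/
theorem exists_movable_vertices (hd : IsOddCycle n p d) (hp : 2 ≤ p) {K : ℕ} (hK : 3 ≤ K)
    (hKn : K + p + 2 ≤ n) {i j x y : ℕ} (hi : ∀ k < 2 * p, i ≠ d (k + 1))
    (hj : ∀ k < 2 * p, j ≠ d (k + 1)) (hx : ∀ k < 2 * p, x ≠ d (k + 1)) (hxy : x ≠ y)
    (hxW : x ∈ Finset.Icc 1 n \ {i, j}) (hyW : y ∈ Finset.Icc 1 n \ {i, j}) :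
    ∃ f : ℕ → ℕ, ((Finset.Icc 1 n \ {i, j}).image f).card = K ∧ f x ≠ f y ∧
      ∀ g : ℕ → ℕ, (∀ v ∈ Finset.Icc 1 n \ {i, j}, g v = f v) → IsTight p d g := by
  obtain ⟨t₀, ht₀, hy⟩ : ∃ t₀ < p, ∀ k < 2 * p, y = d (k + 1) → k / 2 ≠ t₀ := by
    by_cases h : ∃ k < 2 * p, y = d (k + 1) ∧ k / 2 = 0
    · obtain ⟨k, hk, rfl, hk0⟩ := h
      refine ⟨1, by omega, fun k' hk' e => ?_⟩
      have := hd.inj (by omega) (by omega) e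
      omega
    · push Not at h
      exact ⟨0, by omega, h⟩
  obtain ⟨κ, hκ, hκ'⟩ := hd.exists_colouring (pairColour p t₀ 1) fun v => if v = y then 1 else 0
  have hodd : ∀ t < p, κ (d (2 * t + 1)) = pairColour p t₀ 1 t := fun t ht => by
    rw [hκ (2 * t) (by omega)]; congr 1; omega
  have heven : ∀ t < p, κ (d (2 * t + 2)) = pairColour p t₀ 1 t := fun t ht => by
    rw [hκ (2 * t + 1) (by omega)]; congr 1; omega
  have hκle : ∀ v, κ v < 3 := fun v => by
    by_cases h : ∃ k < 2 * p, v = d (k + 1)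
    · obtain ⟨k, hk, rfl⟩ := h
      rw [hκ k hk]
      rcases eq_or_ne (k / 2) t₀ with e | e
      · rw [e, pairColour_self]; omega
      · have := pairColour_mem p 1 e; omega
    · rw [hκ' v fun k hk e => h ⟨k, hk, e⟩]
      split_ifs <;> omega
  obtain ⟨f, hf, hfp, hfs⟩ := hd.exists_labelling κ
    (fun t ht => by rw [hodd t ht, heven t ht]) (Finset.Icc 1 n \ {i, j}) i j K
    (fun v hv h₁ h₂ _ => by simp [h₁, h₂, Finset.mem_Icc.1 hv])
    (by
      refine le_trans (Finset.card_le_card (t := Finset.range 3) fun l hl => ?_) (by simpa)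
      obtain ⟨v, -, rfl⟩ := Finset.mem_image.1 hl
      exact Finset.mem_range.2 (hκle v)) hKn
  have hmem : ∀ k < 2 * p, d (k + 1) ∈ Finset.Icc 1 n \ {i, j} := fun k hk =>
    Finset.mem_sdiff.2 ⟨hd.mem _, by
      simp only [Finset.mem_insert, Finset.mem_singleton, not_or]
      exact ⟨fun e => hi k hk e.symm, fun e => hj k hk e.symm⟩⟩
  refine ⟨f, hf, hfs x hxW y hyW ?_, fun g hg => ⟨fun t ht => ?_, fun t ht => ?_, ?_⟩⟩
  · rw [hκ' x hx, if_neg hxy]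
    by_cases h : ∃ k < 2 * p, y = d (k + 1)
    · obtain ⟨k, hk, e⟩ := h
      have := pairColour_mem p 1 (hy k hk e)
      rw [e, hκ k hk]
      omega
    · rw [hκ' y fun k hk e => h ⟨k, hk, e⟩, if_pos rfl]
      omega
  · have h₁ := hmem (2 * t) (by omega)
    have h₂ := hmem (2 * t + 1) (by omega)
    rw [hg _ h₁, hg _ h₂]
    exact hfp t ht h₁ h₂
  · have h₁ := hmem (2 * t + 1) (by omega)
    have h₂ := hmem (2 * t + 3) (by omega)
    rw [hg _ h₁, hg _ h₂]
    refine hfs _ h₁ _ h₂ ?_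
    rw [heven t (by omega), show 2 * t + 3 + 1 = 2 * (t + 1) + 2 by ring, heven (t + 1) ht]
    exact pairColour_adj p 1 one_pos t₀ t
  · have h₁ := hmem 1 (by omega)
    have h₂ := hmem (2 * p - 1) (by omega)
    rw [show 2 * p - 1 + 1 = 2 * p by omega] at h₂
    rw [hg _ h₁, hg _ h₂]
    refine hfs _ h₁ _ h₂ ?_
    rw [heven 0 (by omega), show 2 * p = 2 * (p - 1) + 2 by omega, heven (p - 1) (by omega)]
    exact pairColour_wrap p 1 one_pos hp t₀ ht₀

end IsOddCycle

namespace IsOddCycle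

variable {n p : ℕ} {d : ℕ → ℕ}

/-- Labellings in which a set `T` of pairwise non-adjacent pairs can be moved. -/
theorem exists_movable_pairs (hd : IsOddCycle n p d) (hp : 2 ≤ p) {K : ℕ} (hK : 4 ≤ K)
    (hKn : K + p + 2 ≤ n) {W : Finset ℕ} {T : Finset ℕ} {t₀ x y e₁ e₂ : ℕ} (ht₀ : t₀ ∈ T)
    (ht₀p : t₀ < p) (hT : ∀ t ∈ T, t + 1 ∉ T) (hT' : 0 ∈ T → p - 1 ∉ T)
    (hWpair : ∀ k < 2 * p, k / 2 ∉ T → d (k + 1) ∈ W)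
    (hW : ∀ v ∈ Finset.Icc 1 n, v ≠ e₁ → v ≠ e₂ → (∀ t < p, v ≠ d (2 * t + 1)) → v ∈ W)
    (hx : ∀ k < 2 * p, x ≠ d (k + 1)) (hy : ∀ k < 2 * p, y ≠ d (k + 1)) (hxy : x ≠ y)
    (hxW : x ∈ W) (hyW : y ∈ W) :
    ∃ f : ℕ → ℕ, (W.image f).card = K ∧ f x ≠ f y ∧
      ∀ g : ℕ → ℕ, (∀ v ∈ W, g v = f v) →
        (∀ t ∈ T, t < p → g (d (2 * t + 1)) = g (d (2 * t + 2)) ∧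
          (g (d (2 * t + 2)) = f x ∨ g (d (2 * t + 2)) = f y)) → IsTight p d g := by
  obtain ⟨κ, hκ, hκ'⟩ := hd.exists_colouring (pairColour p t₀ 2) fun v => if v = y then 1 else 0
  have hodd : ∀ t < p, κ (d (2 * t + 1)) = pairColour p t₀ 2 t := fun t ht => by
    rw [hκ (2 * t) (by omega)]; congr 1; omega
  have heven : ∀ t < p, κ (d (2 * t + 2)) = pairColour p t₀ 2 t := fun t ht => by
    rw [hκ (2 * t + 1) (by omega)]; congr 1; omega
  have hκx : κ x = 0 := by rw [hκ' x hx, if_neg hxy]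
  have hκy : κ y = 1 := by rw [hκ' y hy, if_pos rfl]
  have hκle : ∀ v, κ v < 4 := fun v => by
    by_cases h : ∃ k < 2 * p, v = d (k + 1)
    · obtain ⟨k, hk, rfl⟩ := h
      rw [hκ k hk]
      rcases eq_or_ne (k / 2) t₀ with e | e
      · rw [e, pairColour_self]; omega
      · have := pairColour_mem p 2 e; omega
    · rw [hκ' v fun k hk e => h ⟨k, hk, e⟩]
      split_ifs <;> omega
  obtain ⟨f, hf, hfp, hfs⟩ := hd.exists_labelling κ
    (fun t ht => by rw [hodd t ht, heven t ht]) W e₁ e₂ K hW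
    (by
      refine le_trans (Finset.card_le_card (t := Finset.range 4) fun l hl => ?_) (by simpa)
      obtain ⟨v, -, rfl⟩ := Finset.mem_image.1 hl
      exact Finset.mem_range.2 (hκle v)) hKn
  have hoddW : ∀ t < p, t ∉ T → d (2 * t + 1) ∈ W := fun t ht htT =>
    hWpair (2 * t) (by omega) (by rwa [show 2 * t / 2 = t by omega])
  have hevenW : ∀ t < p, t ∉ T → d (2 * t + 2) ∈ W := fun t ht htT =>
    hWpair (2 * t + 1) (by omega) (by rwa [show (2 * t + 1) / 2 = t by omega])
  have hanchor : ∀ t < p, t ∉ T → f (d (2 * t + 2)) ≠ f x ∧ f (d (2 * t + 2)) ≠ f y := by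
    intro t ht htT
    have h := pairColour_mem p 2 (t₀ := t₀) (t := t) (fun e => htT (e ▸ ht₀))
    have := heven t ht
    exact ⟨hfs _ (hevenW t ht htT) _ hxW (by omega), hfs _ (hevenW t ht htT) _ hyW (by omega)⟩
  refine ⟨f, hf, hfs x hxW y hyW (by omega), fun g hg hgT => ?_⟩
  have hsep : ∀ s < p, ∀ t < p, ¬ (s ∈ T ∧ t ∈ T) →
      pairColour p t₀ 2 s ≠ pairColour p t₀ 2 t → g (d (2 * s + 2)) ≠ g (d (2 * t + 2)) := by
    intro s hs t ht hst hne
    by_cases hsT : s ∈ T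
    · have htT : t ∉ T := fun h => hst ⟨hsT, h⟩
      rw [hg _ (hevenW t ht htT)]
      rcases (hgT s hsT hs).2 with e | e <;> rw [e]
      · exact (hanchor t ht htT).1.symm
      · exact (hanchor t ht htT).2.symm
    · rw [hg _ (hevenW s hs hsT)]
      by_cases htT : t ∈ T
      · rcases (hgT t htT ht).2 with e | e <;> rw [e]
        · exact (hanchor s hs hsT).1
        · exact (hanchor s hs hsT).2
      · rw [hg _ (hevenW t ht htT)]
        exact hfs _ (hevenW s hs hsT) _ (hevenW t ht htT) (by rwa [heven s hs, heven t ht])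
  refine ⟨fun t ht => ?_, fun t ht => ?_, ?_⟩
  · by_cases htT : t ∈ T
    · exact (hgT t htT ht).1
    · rw [hg _ (hoddW t ht htT), hg _ (hevenW t ht htT)]
      exact hfp t ht (hoddW t ht htT) (hevenW t ht htT)
  · exact hsep t (by omega) (t + 1) ht (fun h => hT t h.1 h.2) (pairColour_adj p 2 two_pos t₀ t)
  · have := hsep 0 (by omega) (p - 1) (by omega) (fun h => hT' h.1 h.2)
      (pairColour_wrap p 2 two_pos hp t₀ ht₀p)
    rwa [show 2 * (p - 1) + 2 = 2 * p by omega] at this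

end IsOddCycle

/-- `v ≥ 4` is the smallest vertex of its cluster. -/
def IsRep (n : ℕ) (f : ℕ → ℕ) (v : ℕ) : Prop :=
  4 ≤ v ∧ ∀ w ∈ Finset.Icc 1 n, f w = f v → v ≤ w

open Classical in
/-- The value at the partition given by the labelling `f` of the linear functional with edge
coefficients `a` and representative coefficients `r`. -/
noncomputable def weight (n : ℕ) (a : ℕ → ℕ → ℝ) (r : ℕ → ℝ) (f : ℕ → ℕ) : ℝ :=
  (∑ u ∈ Finset.Icc 1 n, ∑ v ∈ Finset.Icc 1 n, a u v * if f u = f v then 1 else 0) +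
    ∑ v ∈ Finset.Icc 1 n, r v * if IsRep n f v then 1 else 0

/-- The labelling `f` with `X` moved to the label `l` and `Y` moved to the label `m`. -/
def relabel (f : ℕ → ℕ) (X Y : Finset ℕ) (l m : ℕ) (v : ℕ) : ℕ :=
  if v ∈ X then l else if v ∈ Y then m else f v

theorem isRep_relabel_iff {n : ℕ} {f : ℕ → ℕ} {X Y : Finset ℕ} {x y l m : ℕ}
    (hx : x ∈ Finset.Icc 1 n) (hy : y ∈ Finset.Icc 1 n) (hx3 : x < 4) (hy3 : y < 4)
    (hxX : x ∉ X) (hxY : x ∉ Y) (hyX : y ∉ X) (hyY : y ∉ Y) (hl : l = f x ∨ l = f y)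
    (hm : m = f x ∨ m = f y) (v : ℕ) :
    IsRep n (relabel f X Y l m) v ↔
      4 ≤ v ∧ v ∉ X ∧ v ∉ Y ∧ f v ≠ f x ∧ f v ≠ f y ∧
        ∀ w ∈ Finset.Icc 1 n, w ∉ X → w ∉ Y → f w = f v → v ≤ w := by
  have hgx : relabel f X Y l m x = f x := by simp [relabel, hxX, hxY]
  have hgy : relabel f X Y l m y = f y := by simp [relabel, hyX, hyY]
  constructor
  · rintro ⟨h4, h⟩
    have h₁ : relabel f X Y l m v ≠ f x := fun e => by
      have := h x hx (by rw [hgx, e]); omega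
    have h₂ : relabel f X Y l m v ≠ f y := fun e => by
      have := h y hy (by rw [hgy, e]); omega
    have hvX : v ∉ X := fun e => by simp only [relabel, e, if_true] at h₁ h₂; tauto
    have hvY : v ∉ Y := fun e => by simp only [relabel, e, hvX, if_true, if_false] at h₁ h₂; tauto
    have hgv : relabel f X Y l m v = f v := by simp [relabel, hvX, hvY]
    rw [hgv] at h₁ h₂
    exact ⟨h4, hvX, hvY, h₁, h₂, fun w hw hwX hwY e => h w hw (by
      rw [hgv, ← e]; simp [relabel, hwX, hwY])⟩
  · rintro ⟨h4, hvX, hvY, h₁, h₂, h⟩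
    refine ⟨h4, fun w hw e => ?_⟩
    have hgv : relabel f X Y l m v = f v := by simp [relabel, hvX, hvY]
    rw [hgv] at e
    by_cases hwX : w ∈ X
    · simp only [relabel, hwX, if_true] at e
      rcases hl with rfl | rfl <;> simp_all
    · by_cases hwY : w ∈ Y
      · simp only [relabel, hwX, hwY, if_true, if_false] at e
        rcases hm with rfl | rfl <;> simp_all
      · exact h w hw hwX hwY (by simpa [relabel, hwX, hwY] using e)

/-- The mixed second difference of the weight when two disjoint sets are moved independently
between two clusters containing vertices of `{1,2,3}`. -/
theorem sum_eq_zero_of_weight_eq {n : ℕ} {a : ℕ → ℕ → ℝ} {r : ℕ → ℝ} {b : ℝ} {f : ℕ → ℕ}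
    {X Y : Finset ℕ} {x y : ℕ} (hX : X ⊆ Finset.Icc 1 n) (hY : Y ⊆ Finset.Icc 1 n)
    (hXY : Disjoint X Y)
    (hx : x ∈ Finset.Icc 1 n) (hy : y ∈ Finset.Icc 1 n) (hx3 : x < 4) (hy3 : y < 4)
    (hxX : x ∉ X) (hxY : x ∉ Y) (hyX : y ∉ X) (hyY : y ∉ Y) (hne : f x ≠ f y)
    (h : ∀ l m, (l = f x ∨ l = f y) → (m = f x ∨ m = f y) →
      weight n a r (relabel f X Y l m) = b) :
    ∑ u ∈ X, ∑ v ∈ Y, (a u v + a v u) = 0 := by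
  classical
  have hrep : ∀ l m, (l = f x ∨ l = f y) → (m = f x ∨ m = f y) →
      ∑ v ∈ Finset.Icc 1 n, r v * (if IsRep n (relabel f X Y l m) v then (1 : ℝ) else 0) =
      ∑ v ∈ Finset.Icc 1 n, r v * (if IsRep n (relabel f X Y (f x) (f x)) v then 1 else 0) := by
    intro l m hl hm
    refine Finset.sum_congr rfl fun v _ => ?_
    rw [isRep_relabel_iff hx hy hx3 hy3 hxX hxY hyX hyY hl hm,
      isRep_relabel_iff hx hy hx3 hy3 hxX hxY hyX hyY (Or.inl rfl) (Or.inl rfl)]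
  have h₁ := h (f x) (f x) (Or.inl rfl) (Or.inl rfl)
  have h₂ := h (f y) (f y) (Or.inr rfl) (Or.inr rfl)
  have h₃ := h (f x) (f y) (Or.inl rfl) (Or.inr rfl)
  have h₄ := h (f y) (f x) (Or.inr rfl) (Or.inl rfl)
  unfold weight at h₁ h₂ h₃ h₄
  rw [hrep _ _ (Or.inr rfl) (Or.inr rfl)] at h₂
  rw [hrep _ _ (Or.inl rfl) (Or.inr rfl)] at h₃
  rw [hrep _ _ (Or.inr rfl) (Or.inl rfl)] at h₄
  have key : ∑ u ∈ Finset.Icc 1 n, ∑ v ∈ Finset.Icc 1 n,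
      ((if u ∈ X then if v ∈ Y then a u v else 0 else 0) +
        (if v ∈ X then if u ∈ Y then a u v else 0 else 0)) = 0 := by
    have e : ∀ u ∈ Finset.Icc 1 n, ∀ v ∈ Finset.Icc 1 n,
        2 * ((if u ∈ X then if v ∈ Y then a u v else 0 else 0) +
          (if v ∈ X then if u ∈ Y then a u v else 0 else 0)) =
        a u v * (if relabel f X Y (f x) (f x) u = relabel f X Y (f x) (f x) v then 1 else 0) +
        a u v * (if relabel f X Y (f y) (f y) u = relabel f X Y (f y) (f y) v then 1 else 0) -
        a u v * (if relabel f X Y (f x) (f y) u = relabel f X Y (f x) (f y) v then 1 else 0) -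
        a u v * (if relabel f X Y (f y) (f x) u = relabel f X Y (f y) (f x) v then 1 else 0) := by
      intro u _ v _
      have hu : u ∈ X → u ∉ Y := fun h₁ h₂ => Finset.disjoint_left.1 hXY h₁ h₂
      have hv : v ∈ X → v ∉ Y := fun h₁ h₂ => Finset.disjoint_left.1 hXY h₁ h₂
      by_cases huX : u ∈ X <;> by_cases huY : u ∈ Y <;> by_cases hvX : v ∈ X <;>
        by_cases hvY : v ∈ Y <;> simp only [relabel, huX, huY, hvX, hvY, if_true, if_false,
          hne, hne.symm] <;> first | tauto | ring
    have := Finset.sum_congr rfl fun u hu => Finset.sum_congr rfl fun v hv => e u hu v hv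
    simp only [Finset.sum_sub_distrib, Finset.sum_add_distrib, ← Finset.mul_sum] at this
    simp only [Finset.sum_add_distrib]
    linarith
  rw [← key]
  simp only [Finset.sum_add_distrib]
  have hX' := Finset.inter_eq_right.2 hX
  have hY' := Finset.inter_eq_right.2 hY
  congr 1
  · simp only [Finset.sum_ite_irrel, Finset.sum_const_zero, Finset.sum_ite_mem, hX', hY']
  · rw [Finset.sum_comm (s := Finset.Icc 1 n)]
    simp only [Finset.sum_ite_irrel, Finset.sum_const_zero, Finset.sum_ite_mem, hX', hY']

theorem card_image_of_eqOn {V W : Finset ℕ} (hW : W ⊆ V) {f g : ℕ → ℕ}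
    (h : ∀ v ∈ W, g v = f v) (h' : ∀ v ∈ V, v ∉ W → g v ∈ W.image f) :
    (V.image g).card = (W.image f).card := by
  congr 1
  ext l
  constructor
  · intro hl
    obtain ⟨v, hv, rfl⟩ := Finset.mem_image.1 hl
    by_cases hvW : v ∈ W
    · exact h v hvW ▸ Finset.mem_image_of_mem _ hvW
    · exact h' v hv hvW
  · intro hl
    obtain ⟨v, hv, rfl⟩ := Finset.mem_image.1 hl
    exact h v hv ▸ Finset.mem_image_of_mem _ (hW hv)

theorem sum_eq_zero_of_movable {n K p : ℕ} {d : ℕ → ℕ} {a : ℕ → ℕ → ℝ} {r : ℕ → ℝ} {b : ℝ}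
    (H : ∀ f, IsTight p d f → ((Finset.Icc 1 n).image f).card = K → weight n a r f = b)
    {X Y : Finset ℕ} {x y : ℕ} (hX : X ⊆ Finset.Icc 1 n) (hY : Y ⊆ Finset.Icc 1 n)
    (hXY : Disjoint X Y) (hx : x ∈ Finset.Icc 1 n \ (X ∪ Y)) (hy : y ∈ Finset.Icc 1 n \ (X ∪ Y))
    (hx3 : x < 4) (hy3 : y < 4) {f : ℕ → ℕ}
    (hcard : ((Finset.Icc 1 n \ (X ∪ Y)).image f).card = K) (hne : f x ≠ f y)
    (hf : ∀ l m, (l = f x ∨ l = f y) → (m = f x ∨ m = f y) → IsTight p d (relabel f X Y l m)) :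
    ∑ u ∈ X, ∑ v ∈ Y, (a u v + a v u) = 0 := by
  have hx' := hx
  have hy' := hy
  simp only [Finset.mem_sdiff, Finset.mem_union, not_or] at hx' hy'
  refine sum_eq_zero_of_weight_eq (b := b) (r := r) hX hY hXY hx'.1 hy'.1 hx3 hy3 hx'.2.1 hx'.2.2
    hy'.2.1 hy'.2.2 hne fun l m hl hm => H _ (hf l m hl hm) ?_
  rw [← hcard]
  have hmem : ∀ k, (k = f x ∨ k = f y) → k ∈ (Finset.Icc 1 n \ (X ∪ Y)).image f := by
    rintro k (rfl | rfl)
    · exact Finset.mem_image_of_mem _ hx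
    · exact Finset.mem_image_of_mem _ hy
  refine card_image_of_eqOn Finset.sdiff_subset (fun v hv => ?_) fun v hv hv' => ?_
  · simp only [Finset.mem_sdiff, Finset.mem_union, not_or] at hv
    simp [relabel, hv.2.1, hv.2.2]
  · simp only [Finset.mem_sdiff, Finset.mem_union, hv, true_and, not_not] at hv'
    unfold relabel
    split_ifs with h₁ h₂
    · exact hmem l hl
    · exact hmem m hm
    · tauto

namespace IsOddCycle

variable {n K p : ℕ} {d : ℕ → ℕ} {a : ℕ → ℕ → ℝ} {r : ℕ → ℝ} {b : ℝ}

theorem coeff_eq_zero_of_movable_vertices (hd : IsOddCycle n p d) (hp : 2 ≤ p) (hK : 3 ≤ K)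
    (hKn : K + p + 2 ≤ n)
    (H : ∀ f, IsTight p d f → ((Finset.Icc 1 n).image f).card = K → weight n a r f = b)
    {i j x y : ℕ} (hi : ∀ k < 2 * p, i ≠ d (k + 1))
    (hj : ∀ k < 2 * p, j ≠ d (k + 1)) (hx : ∀ k < 2 * p, x ≠ d (k + 1))
    (hiV : i ∈ Finset.Icc 1 n) (hjV : j ∈ Finset.Icc 1 n) (hxV : x ∈ Finset.Icc 1 n)
    (hyV : y ∈ Finset.Icc 1 n) (hij : i ≠ j) (hxy : x ≠ y) (hxi : x ≠ i) (hxj : x ≠ j)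
    (hyi : y ≠ i) (hyj : y ≠ j) (hx3 : x < 4) (hy3 : y < 4) :
    a i j + a j i = 0 := by
  have hxW : x ∈ Finset.Icc 1 n \ {i, j} := Finset.mem_sdiff.2 ⟨hxV, by simp [hxi, hxj]⟩
  have hyW : y ∈ Finset.Icc 1 n \ {i, j} := Finset.mem_sdiff.2 ⟨hyV, by simp [hyi, hyj]⟩
  obtain ⟨f, hf, hne, hg⟩ := hd.exists_movable_vertices hp hK hKn hi hj hx hxy hxW hyW
  have := sum_eq_zero_of_movable (X := {i}) (Y := {j}) H (by simpa using hiV) (by simpa using hjV)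
    (by simpa using hij) hxW hyW hx3 hy3 hf hne fun l m _ _ => hg _ fun v hv => by
      simp only [Finset.mem_sdiff, Finset.mem_insert, Finset.mem_singleton, not_or] at hv
      simp [relabel, hv.2.1, hv.2.2]
  simpa using this

theorem coeff_vertex_pair (hd : IsOddCycle n p d) (hp : 2 ≤ p) (hK : 4 ≤ K)
    (hKn : K + p + 2 ≤ n)
    (H : ∀ f, IsTight p d f → ((Finset.Icc 1 n).image f).card = K → weight n a r f = b)
    {x y : ℕ} (hx : ∀ k, x ≠ d k) (hy : ∀ k, y ≠ d k)
    (hxV : x ∈ Finset.Icc 1 n) (hyV : y ∈ Finset.Icc 1 n) (hxy : x ≠ y)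
    (hx3 : x < 4) (hy3 : y < 4) {t : ℕ} (ht : t < p) :
    (a (d 0) (d (2 * t + 1)) + a (d (2 * t + 1)) (d 0)) +
      (a (d 0) (d (2 * t + 2)) + a (d (2 * t + 2)) (d 0)) = 0 := by
  have hne : ∀ {j k}, j < 2 * p + 1 → k < 2 * p + 1 → j ≠ k → d j ≠ d k :=
    fun hj hk h e => h (hd.inj hj hk e)
  have h12 := hne (j := 2 * t + 1) (k := 2 * t + 2) (by omega) (by omega) (by omega)
  have h01 := hne (j := 0) (k := 2 * t + 1) (by omega) (by omega) (by omega)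
  have h02 := hne (j := 0) (k := 2 * t + 2) (by omega) (by omega) (by omega)
  have hmem : ∀ v, v ∈ Finset.Icc 1 n \ ({d 0} ∪ {d (2 * t + 1), d (2 * t + 2)}) ↔
      v ∈ Finset.Icc 1 n ∧ v ≠ d 0 ∧ v ≠ d (2 * t + 1) ∧ v ≠ d (2 * t + 2) := fun v => by
    simp only [Finset.mem_sdiff, Finset.mem_union, Finset.mem_insert, Finset.mem_singleton]
    tauto
  have hxW := (hmem x).2 ⟨hxV, hx _, hx _, hx _⟩
  have hyW := (hmem y).2 ⟨hyV, hy _, hy _, hy _⟩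
  obtain ⟨f, hf, hfne, hg⟩ := hd.exists_movable_pairs hp hK hKn (T := {t}) (t₀ := t) (e₁ := d 0)
    (e₂ := d (2 * t + 2)) (by simp) ht (by simp) (by simp only [Finset.mem_singleton]; omega)
    (fun k hk hkt => (hmem _).2 ⟨hd.mem _, by
      simp only [Finset.mem_singleton] at hkt
      exact ⟨hne (by omega) (by omega) (by omega), hne (by omega) (by omega) (by omega),
        hne (by omega) (by omega) (by omega)⟩⟩)
    (fun v hv h₁ h₂ h₃ => (hmem v).2 ⟨hv, h₁, h₃ t ht, h₂⟩)
    (fun k _ => hx _) (fun k _ => hy _) hxy hxW hyW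
  have := sum_eq_zero_of_movable (X := {d 0}) (Y := {d (2 * t + 1), d (2 * t + 2)}) H
    (by simpa using hd.mem 0)
    (by
      intro v
      simp only [Finset.mem_insert, Finset.mem_singleton]
      rintro (rfl | rfl) <;> exact hd.mem _)
    (by simp [h01, h02]) hxW hyW hx3 hy3 hf hfne fun l m hl hm => hg _ (fun v hv => by
      obtain ⟨-, h₀, h₁, h₂⟩ := (hmem v).1 hv
      simp [relabel, h₀, h₁, h₂]) (fun s hs _ => by
        obtain rfl := Finset.mem_singleton.1 hs
        simp [relabel, h01.symm, h02.symm, hm])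
  simpa [Finset.sum_pair h12] using this

theorem coeff_pair_pair (hd : IsOddCycle n p d) (hp : 2 ≤ p) (hK : 4 ≤ K)
    (hKn : K + p + 2 ≤ n)
    (H : ∀ f, IsTight p d f → ((Finset.Icc 1 n).image f).card = K → weight n a r f = b)
    {x y : ℕ} (hx : ∀ k, x ≠ d k) (hy : ∀ k, y ≠ d k)
    (hxV : x ∈ Finset.Icc 1 n) (hyV : y ∈ Finset.Icc 1 n) (hxy : x ≠ y)
    (hx3 : x < 4) (hy3 : y < 4) {q : ℕ} (hq : 2 ≤ q) (hqp : q + 2 ≤ p) :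
    ((a (d 1) (d (2 * q + 1)) + a (d (2 * q + 1)) (d 1)) +
      (a (d 1) (d (2 * q + 2)) + a (d (2 * q + 2)) (d 1))) +
    ((a (d 2) (d (2 * q + 1)) + a (d (2 * q + 1)) (d 2)) +
      (a (d 2) (d (2 * q + 2)) + a (d (2 * q + 2)) (d 2))) = 0 := by
  have hne : ∀ {j k}, j < 2 * p + 1 → k < 2 * p + 1 → j ≠ k → d j ≠ d k :=
    fun hj hk h e => h (hd.inj hj hk e)
  have hP := hne (j := 1) (k := 2) (by omega) (by omega) (by omega)
  have hQ := hne (j := 2 * q + 1) (k := 2 * q + 2) (by omega) (by omega) (by omega)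
  have h11 := hne (j := 1) (k := 2 * q + 1) (by omega) (by omega) (by omega)
  have h12 := hne (j := 1) (k := 2 * q + 2) (by omega) (by omega) (by omega)
  have h21 := hne (j := 2) (k := 2 * q + 1) (by omega) (by omega) (by omega)
  have h22 := hne (j := 2) (k := 2 * q + 2) (by omega) (by omega) (by omega)
  have hmem : ∀ v, v ∈ Finset.Icc 1 n \ ({d 1, d 2} ∪ {d (2 * q + 1), d (2 * q + 2)}) ↔
      v ∈ Finset.Icc 1 n ∧ v ≠ d 1 ∧ v ≠ d 2 ∧ v ≠ d (2 * q + 1) ∧ v ≠ d (2 * q + 2) :=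
    fun v => by
      simp only [Finset.mem_sdiff, Finset.mem_union, Finset.mem_insert, Finset.mem_singleton]
      tauto
  have hxW := (hmem x).2 ⟨hxV, hx _, hx _, hx _, hx _⟩
  have hyW := (hmem y).2 ⟨hyV, hy _, hy _, hy _, hy _⟩
  have hsub : ∀ i j, ({d i, d j} : Finset ℕ) ⊆ Finset.Icc 1 n := fun i j v => by
    simp only [Finset.mem_insert, Finset.mem_singleton]
    rintro (rfl | rfl) <;> exact hd.mem _
  obtain ⟨f, hf, hfne, hg⟩ := hd.exists_movable_pairs hp hK hKn (T := {0, q}) (t₀ := 0)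
    (e₁ := d 2) (e₂ := d (2 * q + 2)) (by simp) (by omega)
    (by simp only [Finset.mem_insert, Finset.mem_singleton]; omega)
    (by simp only [Finset.mem_insert, Finset.mem_singleton]; omega)
    (fun k hk hkt => (hmem _).2 ⟨hd.mem _, by
      simp only [Finset.mem_insert, Finset.mem_singleton] at hkt
      exact ⟨hne (by omega) (by omega) (by omega), hne (by omega) (by omega) (by omega),
        hne (by omega) (by omega) (by omega), hne (by omega) (by omega) (by omega)⟩⟩)
    (fun v hv h₁ h₂ h₃ => (hmem v).2 ⟨hv, h₃ 0 (by omega), h₁, h₃ q (by omega), h₂⟩)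
    (fun k _ => hx _) (fun k _ => hy _) hxy hxW hyW
  have := sum_eq_zero_of_movable (X := {d 1, d 2}) (Y := {d (2 * q + 1), d (2 * q + 2)}) H
    (hsub _ _) (hsub _ _)
    (by simp [h11.symm, h12.symm, h21.symm, h22.symm])
    hxW hyW hx3 hy3 hf hfne fun l m hl hm => hg _ (fun v hv => by
      obtain ⟨-, h₁, h₂, h₃, h₄⟩ := (hmem v).1 hv
      simp [relabel, h₁, h₂, h₃, h₄]) (fun s hs _ => by
        simp only [Finset.mem_insert, Finset.mem_singleton] at hs
        rcases hs with rfl | rfl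
        · simp [relabel, hl]
        · simp [relabel, h11.symm, h12.symm, h21.symm, h22.symm, hm])
  simpa only [Finset.sum_pair hQ, Finset.sum_pair hP] using this

/-- The linear relations between the coefficients on the edges spanned by the cycle force them to
vanish as soon as one of the cycle edges has coefficient zero. -/
theorem eq_zero_of_relations (hd : IsOddCycle n p d) (hp : 2 ≤ p) (S : ℕ → ℕ → ℝ)
    (hS : ∀ u v, S u v = S v u)
    (h₁ : ∀ i, ∀ t < p, S (d i) (d (i + (2 * t + 1))) + S (d i) (d (i + (2 * t + 2))) = 0)
    (h₂ : ∀ i q, 2 ≤ q → q + 2 ≤ p →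
      (S (d (i + 1)) (d (i + (2 * q + 1))) + S (d (i + 1)) (d (i + (2 * q + 2)))) +
      (S (d (i + 2)) (d (i + (2 * q + 1))) + S (d (i + 2)) (d (i + (2 * q + 2)))) = 0)
    (h₀ : S (d 0) (d 1) = 0) (i j : ℕ) (hij : d i ≠ d j) : S (d i) (d j) = 0 := by
  have hsymm : ∀ i k, k ≤ 2 * p + 1 →
      S (d i) (d (i + k)) = S (d (i + k)) (d (i + k + (2 * p + 1 - k))) := fun i k hk => by
    rw [hS, show i + k + (2 * p + 1 - k) = i + (2 * p + 1) by omega, hd.add_period]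
  have hstep : ∀ i, S (d i) (d (i + 1)) = S (d (i + 1)) (d (i + 1 + 1)) := fun i => by
    have e₁ := h₁ i 0 (by omega)
    have e₂ := h₁ (i + 2) (p - 1) (by omega)
    rw [show 2 * (p - 1) + 2 = 2 * p + 1 - 1 by omega,
      show 2 * (p - 1) + 1 = 2 * p + 1 - 2 by omega, ← hsymm i 2 (by omega)] at e₂
    have e₃ := hsymm (i + 1) 1 (by omega)
    rw [show i + 1 + 1 = i + 2 by ring] at e₃ ⊢
    simp only [mul_zero, zero_add] at e₁
    linarith
  have hone : ∀ i, S (d i) (d (i + 1)) = 0 := fun i => by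
    induction i with
    | zero => simpa using h₀
    | succ i ih => rw [← hstep, ih]
  have htwo : ∀ i, S (d i) (d (i + 2)) = 0 := fun i => by
    have := h₁ i 0 (by omega)
    simp only [mul_zero, zero_add] at this
    linarith [hone i]
  have halt : ∀ i k, 3 ≤ k → k + 3 ≤ 2 * p →
      S (d (i + 1)) (d (i + 1 + (k + 1))) = -S (d (i + 1)) (d (i + 1 + k)) := fun i k hk hkp => by
    rcases Nat.even_or_odd' k with ⟨q, rfl | rfl⟩
    · have e₁ := h₂ i q (by omega) (by omega)
      have e₂ := h₁ (i + 2) (q - 1) (by omega)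
      rw [show i + 2 + (2 * (q - 1) + 1) = i + (2 * q + 1) by omega,
        show i + 2 + (2 * (q - 1) + 2) = i + (2 * q + 2) by omega] at e₂
      rw [show i + 1 + (2 * q + 1) = i + (2 * q + 2) by ring,
        show i + 1 + 2 * q = i + (2 * q + 1) by ring]
      linarith
    · have e₁ := h₁ (i + 1) q (by omega)
      rw [show 2 * q + 1 + 1 = 2 * q + 2 by ring]
      linarith
  have hpow : ∀ i m, m + 5 ≤ 2 * p →
      S (d (i + 1)) (d (i + 1 + (m + 3))) = (-1) ^ m * S (d (i + 1)) (d (i + 1 + 3)) := by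
    intro i m hm
    induction m with
    | zero => simp
    | succ m ih =>
      rw [show m + 1 + 3 = m + 3 + 1 by ring, halt i (m + 3) (by omega) (by omega),
        ih (by omega), pow_succ]
      ring
  have hthree : 3 ≤ p → ∀ i, S (d (i + 1)) (d (i + 1 + 3)) = 0 := fun hp3 i => by
    have hs : ∀ i, S (d (i + 1 + 3)) (d (i + 1 + 3 + 3)) = -S (d (i + 1)) (d (i + 1 + 3)) :=
      fun i => by
        have e := hpow (i + 3) (2 * p - 5) (by omega)
        rw [Odd.neg_one_pow ⟨p - 3, by omega⟩,
          show 2 * p - 5 + 3 = 2 * p + 1 - 3 by omega,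
          show i + 3 + 1 = i + 1 + 3 by ring, ← hsymm (i + 1) 3 (by omega)] at e
        linarith
    have hm : ∀ m, S (d (i + 1 + 3 * m)) (d (i + 1 + 3 * m + 3)) =
        (-1) ^ m * S (d (i + 1)) (d (i + 1 + 3)) := fun m => by
      induction m with
      | zero => simp
      | succ m ih =>
        have := hs (i + 3 * m)
        rw [show i + 3 * m + 1 = i + 1 + 3 * m by ring, ih] at this
        rw [show i + 1 + 3 * (m + 1) = i + 1 + 3 * m + 3 by ring, this, pow_succ]
        ring
    have e := hm (2 * p + 1)
    have hper : ∀ k, d (k + 3 * (2 * p + 1)) = d k := fun k =>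
      (hd.eq_iff _ _).2 (by simp [Nat.ModEq])
    rw [Odd.neg_one_pow ⟨p, rfl⟩, hper,
      show i + 1 + 3 * (2 * p + 1) + 3 = i + 1 + 3 + 3 * (2 * p + 1) by ring, hper] at e
    linarith
  have hall : ∀ i k, 1 ≤ k → k ≤ 2 * p → S (d i) (d (i + k)) = 0 := by
    intro i k hk hkp
    rcases (by omega : k = 1 ∨ k = 2 ∨ k = 2 * p ∨ k + 1 = 2 * p ∨ (3 ≤ k ∧ k + 2 ≤ 2 * p)) with
      rfl | rfl | rfl | h | ⟨h, h'⟩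
    · exact hone i
    · exact htwo i
    · rw [hsymm i _ (by omega), show 2 * p + 1 - 2 * p = 1 by omega]
      exact hone _
    · rw [hsymm i _ (by omega), show 2 * p + 1 - k = 2 by omega]
      exact htwo _
    · have e := hpow (i + 2 * p) (k - 3) (by omega)
      rw [hthree (by omega), mul_zero, show k - 3 + 3 = k by omega, add_assoc i,
        show i + (2 * p + 1) + k = i + k + (2 * p + 1) by ring, hd.add_period, hd.add_period] at e
      exact e
  have hred : ∀ i, d i = d (i % (2 * p + 1)) := fun i =>
    (hd.eq_iff _ _).2 (Nat.mod_modEq _ _).symm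
  have hi := Nat.mod_lt i (show 0 < 2 * p + 1 by omega)
  have hj := Nat.mod_lt j (show 0 < 2 * p + 1 by omega)
  rw [hred i, hred j] at hij ⊢
  generalize i % (2 * p + 1) = i at hi hij
  generalize j % (2 * p + 1) = j at hj hij
  rcases lt_trichotomy i j with h | rfl | h
  · have := hall i (j - i) (by omega) (by omega)
    rwa [show i + (j - i) = j by omega] at this
  · exact absurd rfl hij
  · have := hall j (i - j) (by omega) (by omega)
    rw [hS]
    rwa [show j + (i - j) = i by omega] at this

end IsOddCycle

theorem sum_rep_eq_add {n : ℕ} (r : ℕ → ℝ) {f : ℕ → ℕ} {β x m : ℕ}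
    (hβV : β ∈ Finset.Icc 1 n) (hβ3 : β < 4) (hxV : x ∈ Finset.Icc 1 n) (hx3 : x < 4)
    (hxβ : x ≠ β) (hmV : m ∈ Finset.Icc 1 n) (hm4 : 4 ≤ m) (hmx : f m ≠ f x)
    (hmin : ∀ v ∈ Finset.Icc 1 n, v ≠ β → f v = f m → m ≤ v) :
    (open Classical in
      ∑ v ∈ Finset.Icc 1 n, r v * (if IsRep n (relabel f {β} ∅ (f x) (f x)) v then 1 else 0)) =
    (open Classical in
      ∑ v ∈ Finset.Icc 1 n, r v * (if IsRep n (relabel f {β} ∅ (f m) (f m)) v then 1 else 0)) +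
      r m := by
  classical
  have hmβ : m ≠ β := by omega
  have hiff := isRep_relabel_iff (f := f) (X := {β}) (Y := ∅) (l := f x) (m := f x) hxV hxV hx3 hx3
    (by simpa using hxβ) (by simp) (by simpa using hxβ) (by simp) (Or.inl rfl) (Or.inl rfl)
  have hm : IsRep n (relabel f {β} ∅ (f x) (f x)) m :=
    (hiff m).2 ⟨hm4, by simpa using hmβ, by simp, hmx, hmx, fun w hw hwβ _ e =>
      hmin w hw (by simpa using hwβ) e⟩
  have hrep : ∀ v ∈ Finset.Icc 1 n, IsRep n (relabel f {β} ∅ (f m) (f m)) v ↔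
      IsRep n (relabel f {β} ∅ (f x) (f x)) v ∧ v ≠ m := by
    intro v hv
    have hg : ∀ l w, w ≠ β → relabel f {β} ∅ l l w = f w := fun l w hw => by simp [relabel, hw]
    have hgβ : ∀ l, relabel f {β} ∅ l l β = l := fun l => by simp [relabel]
    constructor
    · rintro ⟨h4, h⟩
      have hvβ : v ≠ β := by omega
      rw [hg _ _ hvβ] at h
      have hvm : f v ≠ f m := fun e => by have := h β hβV (by rw [hgβ, e]); omega
      have hvx : f v ≠ f x := fun e => by have := h x hxV (by rw [hg _ _ hxβ, e]); omega
      refine ⟨(hiff v).2 ⟨h4, by simpa using hvβ, by simp, hvx, hvx, fun w hw hwβ _ e => ?_⟩,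
        fun e => hvm (by rw [e])⟩
      exact h w hw (by rw [hg _ _ (by simpa using hwβ), e])
    · rintro ⟨h, hvm⟩
      obtain ⟨h4, hvβ, -, hvx, -, h⟩ := (hiff v).1 h
      simp only [Finset.mem_singleton] at hvβ h
      refine ⟨h4, fun w hw e => ?_⟩
      rw [hg _ _ hvβ] at e
      have hfv : f v ≠ f m := fun e' =>
        hvm (le_antisymm (h m hmV hmβ (by simp) e'.symm) (hmin v hv hvβ e'))
      rcases eq_or_ne w β with rfl | hwβ
      · rw [hgβ] at e
        exact absurd e.symm hfv
      · rw [hg _ _ hwβ] at e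
        exact h w hw hwβ (by simp) e
  rw [← sub_eq_iff_eq_add', ← Finset.sum_sub_distrib, Finset.sum_eq_single m]
  · rw [if_pos hm, if_neg (fun h => ((hrep m hmV).1 h).2 rfl)]
    ring
  · intro v hv hvm
    have : IsRep n (relabel f {β} ∅ (f m) (f m)) v ↔ IsRep n (relabel f {β} ∅ (f x) (f x)) v := by
      rw [hrep v hv]; exact and_iff_left hvm
    simp only [this, sub_self]
  · exact fun h => absurd hmV h

/-- The edge part of the weight as a function of the label of a single vertex `β`, when the
coefficients of all but two edges at `β` vanish. -/
theorem exists_edge_sum_eq {n : ℕ} (a : ℕ → ℕ → ℝ) (f : ℕ → ℕ) {β x y : ℕ}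
    (hβV : β ∈ Finset.Icc 1 n) (hxV : x ∈ Finset.Icc 1 n) (hyV : y ∈ Finset.Icc 1 n)
    (hxβ : x ≠ β) (hyβ : y ≠ β) (hxy : x ≠ y)
    (h0 : ∀ v ∈ Finset.Icc 1 n, v ≠ β → v ≠ x → v ≠ y → a β v + a v β = 0) :
    ∃ C : ℝ, ∀ l, ∑ u ∈ Finset.Icc 1 n, ∑ v ∈ Finset.Icc 1 n,
        a u v * (if relabel f {β} ∅ l l u = relabel f {β} ∅ l l v then 1 else 0) =
      C + (if l = f x then a β x + a x β else 0) + if l = f y then a β y + a y β else 0 := by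
  let V := (Finset.Icc 1 n).erase β
  refine ⟨a β β + ∑ u ∈ V, ∑ v ∈ V, a u v * (if f u = f v then 1 else 0), fun l => ?_⟩
  have hV : Finset.Icc 1 n = insert β V := (Finset.insert_erase hβV).symm
  have hβ : β ∉ V := Finset.notMem_erase _ _
  have hg : ∀ w ∈ V, relabel f {β} ∅ l l w = f w := fun w hw => by
    simp [relabel, Finset.ne_of_mem_erase hw]
  have hgβ : relabel f {β} ∅ l l β = l := by simp [relabel]
  rw [hV]
  simp only [Finset.sum_insert hβ, hgβ, if_true]
  have h₁ : ∑ v ∈ V, a β v * (if l = relabel f {β} ∅ l l v then (1 : ℝ) else 0) +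
      ∑ u ∈ V, a u β * (if relabel f {β} ∅ l l u = l then 1 else 0) =
      (if l = f x then a β x + a x β else 0) + if l = f y then a β y + a y β else 0 := by
    rw [← Finset.sum_add_distrib, ← Finset.sum_subset (s₁ := {x, y}), Finset.sum_pair hxy]
    · rw [hg x (Finset.mem_erase.2 ⟨hxβ, hxV⟩), hg y (Finset.mem_erase.2 ⟨hyβ, hyV⟩)]
      simp only [eq_comm (b := l)]
      congr 1 <;> split_ifs <;> ring
    · intro v hv
      simp only [Finset.mem_insert, Finset.mem_singleton] at hv
      rcases hv with rfl | rfl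
      · exact Finset.mem_erase.2 ⟨hxβ, hxV⟩
      · exact Finset.mem_erase.2 ⟨hyβ, hyV⟩
    · intro v hv hv'
      simp only [Finset.mem_insert, Finset.mem_singleton, not_or] at hv'
      have := h0 v (Finset.mem_of_mem_erase hv) (Finset.ne_of_mem_erase hv) hv'.1 hv'.2
      simp only [eq_comm (b := l)]
      rw [← add_mul, this, zero_mul]
  have h₂ : ∑ u ∈ V, ∑ v ∈ V,
      a u v * (if relabel f {β} ∅ l l u = relabel f {β} ∅ l l v then (1 : ℝ) else 0) =
      ∑ u ∈ V, ∑ v ∈ V, a u v * (if f u = f v then 1 else 0) :=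
    Finset.sum_congr rfl fun u hu => Finset.sum_congr rfl fun v hv => by rw [hg u hu, hg v hv]
  rw [Finset.sum_add_distrib, h₂]
  linarith

namespace IsOddCycle

variable {n K p : ℕ} {d : ℕ → ℕ} {a : ℕ → ℕ → ℝ} {r : ℕ → ℝ} {b : ℝ}

/-- After a rotation of the cycle, a given vertex does not lie in one of the pairs. -/
theorem exists_shift_free (hd : IsOddCycle n p d) (u : ℕ) :
    ∃ i, ∀ k < 2 * p, u ≠ d (i + (k + 1)) := by
  by_cases h : ∃ i, u = d i
  · obtain ⟨i, rfl⟩ := h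
    refine ⟨i, fun k hk e => ?_⟩
    have := (hd.shift i).inj (j := 0) (k := k + 1) (by omega) (by omega) e
    omega
  · exact ⟨0, fun k _ e => h ⟨_, e⟩⟩

theorem coeff_eq_zero_of_not_mem (hd : IsOddCycle n p d) (hp : 2 ≤ p) (hK : 4 ≤ K)
    (hKn : K + p + 2 ≤ n)
    (H : ∀ i f, IsTight p (fun k => d (i + k)) f → ((Finset.Icc 1 n).image f).card = K →
      weight n a r f = b)
    {i j x y : ℕ} (hj : ∀ k, j ≠ d k) (hx : ∀ k, x ≠ d k)
    (hiV : i ∈ Finset.Icc 1 n) (hjV : j ∈ Finset.Icc 1 n) (hxV : x ∈ Finset.Icc 1 n)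
    (hyV : y ∈ Finset.Icc 1 n) (hij : i ≠ j) (hxy : x ≠ y) (hxi : x ≠ i) (hxj : x ≠ j)
    (hyi : y ≠ i) (hyj : y ≠ j) (hx3 : x < 4) (hy3 : y < 4) :
    a i j + a j i = 0 := by
  obtain ⟨s, hs⟩ := hd.exists_shift_free i
  exact (hd.shift s).coeff_eq_zero_of_movable_vertices hp (by omega) hKn (H s) hs
    (fun k _ => hj _) (fun k _ => hx _) hiV hjV hxV hyV hij hxy hxi hxj hyi hyj hx3 hy3

theorem coeff_eq_neg_rep (hd : IsOddCycle n p d) (hp : 2 ≤ p) (hK : 4 ≤ K)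
    (hKn : K + p + 2 ≤ n)
    (H : ∀ i f, IsTight p (fun k => d (i + k)) f → ((Finset.Icc 1 n).image f).card = K →
      weight n a r f = b)
    {β x y m : ℕ} (hβ : ∀ k, β ≠ d k) (hx : ∀ k, x ≠ d k)
    (hβV : β ∈ Finset.Icc 1 n) (hxV : x ∈ Finset.Icc 1 n) (hyV : y ∈ Finset.Icc 1 n)
    (hmV : m ∈ Finset.Icc 1 n) (hxβ : x ≠ β) (hyβ : y ≠ β) (hxy : x ≠ y)
    (hβ3 : β < 4) (hx3 : x < 4) (hy3 : y < 4) (hm4 : 4 ≤ m)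
    (h0 : ∀ v ∈ Finset.Icc 1 n, v ≠ β → v ≠ x → v ≠ y → a β v + a v β = 0) :
    a β x + a x β = -r m ∧ a β y + a y β = -r m := by
  classical
  obtain ⟨s, hs⟩ := hd.exists_shift_free m
  have hxm : x ≠ m := by omega
  have hym : y ≠ m := by omega
  have hβm : β ≠ m := by omega
  have hxW : x ∈ Finset.Icc 1 n \ {m, β} := Finset.mem_sdiff.2 ⟨hxV, by simp [hxm, hxβ]⟩
  have hyW : y ∈ Finset.Icc 1 n \ {m, β} := Finset.mem_sdiff.2 ⟨hyV, by simp [hym, hyβ]⟩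
  obtain ⟨f, hf, hne, hg⟩ := (hd.shift s).exists_movable_vertices hp (K := K - 1) (by omega)
    (by omega) hs (fun k _ => hβ _) (fun k _ => hx _) hxy hxW hyW
  obtain ⟨L, hL⟩ := Infinite.exists_notMem_finset ((Finset.Icc 1 n \ {m, β}).image f)
  have hL' : ∀ v ∈ Finset.Icc 1 n \ {m, β}, f v ≠ L := fun v hv e =>
    hL (e ▸ Finset.mem_image_of_mem _ hv)
  set f' := Function.update f m L
  have hf'm : f' m = L := Function.update_self ..
  have hf'v : ∀ v, v ≠ m → f' v = f v := fun v hv => Function.update_of_ne hv ..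
  have hcard : ((Finset.Icc 1 n \ {β}).image f').card = K := by
    have : (Finset.Icc 1 n \ {β}).image f' = insert L ((Finset.Icc 1 n \ {m, β}).image f) := by
      rw [show Finset.Icc 1 n \ {β} = insert m (Finset.Icc 1 n \ {m, β}) by
        ext v
        simp only [Finset.mem_sdiff, Finset.mem_insert, Finset.mem_singleton]
        by_cases hvm : v = m
        · simp [hvm, hβm.symm, hmV]
        · simp [hvm], Finset.image_insert, hf'm]
      congr 1
      refine Finset.image_congr fun v hv => hf'v v fun e => ?_
      simp [e] at hv
    rw [this, Finset.card_insert_of_notMem hL, hf]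
    omega
  have hweight : ∀ w ∈ Finset.Icc 1 n, w ≠ β →
      weight n a r (relabel f' {β} ∅ (f' w) (f' w)) = b := by
    intro w hw hwβ
    refine H s _ (hg _ fun v hv => ?_) ?_
    · simp only [Finset.mem_sdiff, Finset.mem_insert, Finset.mem_singleton, not_or] at hv
      simp [relabel, hv.2.2, hf'v v hv.2.1]
    · rw [← hcard]
      refine card_image_of_eqOn Finset.sdiff_subset (fun v hv => ?_) fun v hv hv' => ?_
      · simp only [Finset.mem_sdiff, Finset.mem_singleton] at hv
        simp [relabel, hv.2]
      · simp only [Finset.mem_sdiff, Finset.mem_singleton, hv, true_and, not_not] at hv'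
        simp only [relabel, hv', Finset.mem_singleton, if_true]
        exact Finset.mem_image_of_mem _ (by simp [hwβ, Finset.mem_Icc.1 hw])
  obtain ⟨C, hC⟩ := exists_edge_sum_eq a f' hβV hxV hyV hxβ hyβ hxy h0
  have hfx : f' x = f x := hf'v x hxm
  have hfy : f' y = f y := hf'v y hym
  have hmin : ∀ v ∈ Finset.Icc 1 n, v ≠ β → f' v = f' m → m ≤ v := fun v hv hvβ e => by
    by_contra hlt
    rw [hf'm, hf'v v (by omega)] at e
    exact hL' v (by simp [hvβ, Finset.mem_Icc.1 hv]; omega) e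
  have hmx : f' m ≠ f' x := by rw [hf'm, hfx]; exact (hL' x hxW).symm
  have hmy : f' m ≠ f' y := by rw [hf'm, hfy]; exact (hL' y hyW).symm
  have hxy' : f' x ≠ f' y := by rwa [hfx, hfy]
  have e₁ := hweight x hxV hxβ
  have e₂ := hweight y hyV hyβ
  have e₃ := hweight m hmV hβm.symm
  unfold weight at e₁ e₂ e₃
  rw [hC, sum_rep_eq_add r hβV hβ3 hxV hx3 hxβ hmV hm4 hmx hmin, if_pos rfl, if_neg hxy'] at e₁
  rw [hC, sum_rep_eq_add r hβV hβ3 hyV hy3 hyβ hmV hm4 hmy hmin, if_pos rfl,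
    if_neg hxy'.symm] at e₂
  rw [hC, if_neg hmx, if_neg hmy] at e₃
  constructor <;> linarith

theorem exists_sum_coeff_eq_neg_rep (hd : IsOddCycle n p d) (hp : 2 ≤ p) (hK : 4 ≤ K)
    (hKn : K + p + 2 ≤ n)
    (H : ∀ i f, IsTight p (fun k => d (i + k)) f → ((Finset.Icc 1 n).image f).card = K →
      weight n a r f = b)
    {β x y : ℕ} (hβ : ∀ k, β ≠ d k) (hx : ∀ k, x ≠ d k)
    (hβV : β ∈ Finset.Icc 1 n) (hxV : x ∈ Finset.Icc 1 n) (hyV : y ∈ Finset.Icc 1 n)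
    (hxβ : x ≠ β) (hyβ : y ≠ β) (hxy : x ≠ y)
    (hβ3 : β < 4) (hx3 : x < 4) (hy3 : y < 4)
    (h0 : ∀ v ∈ Finset.Icc 1 n, v ≠ β → v ≠ x → v ≠ y → a β v + a v β = 0) :
    ∃ m ∈ Finset.Icc 1 n, 4 ≤ m ∧ (a β x + a x β) + (a β y + a y β) = -r m := by
  classical
  obtain ⟨s, hs⟩ := hd.exists_shift_free y
  have h4V : 4 ∈ Finset.Icc 1 n := Finset.mem_Icc.2 ⟨by omega, by omega⟩
  have hxW : x ∈ Finset.Icc 1 n \ {y, β} := Finset.mem_sdiff.2 ⟨hxV, by simp [hxy, hxβ]⟩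
  have h4W : 4 ∈ Finset.Icc 1 n \ {y, β} :=
    Finset.mem_sdiff.2 ⟨h4V, by simp only [Finset.mem_insert, Finset.mem_singleton]; omega⟩
  obtain ⟨f, hf, hne, hg⟩ := (hd.shift s).exists_movable_vertices hp (K := K) (by omega)
    hKn hs (fun k _ => hβ _) (fun k _ => hx _) (show x ≠ 4 by omega) hxW h4W
  set f' := Function.update f y (f x)
  have hf'y : f' y = f x := Function.update_self ..
  have hf'v : ∀ v, v ≠ y → f' v = f v := fun v hv => Function.update_of_ne hv ..
  have hfx : f' x = f x := hf'v x hxy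
  have hweight : ∀ w ∈ Finset.Icc 1 n \ {y, β},
      weight n a r (relabel f' {β} ∅ (f' w) (f' w)) = b := by
    intro w hw
    have hwy : w ≠ y := by rintro rfl; simp at hw
    refine H s _ (hg _ fun v hv => ?_) ?_
    · simp only [Finset.mem_sdiff, Finset.mem_insert, Finset.mem_singleton, not_or] at hv
      simp [relabel, hv.2.2, hf'v v hv.2.1]
    · rw [← hf]
      refine card_image_of_eqOn Finset.sdiff_subset (fun v hv => ?_) fun v hv hv' => ?_
      · simp only [Finset.mem_sdiff, Finset.mem_insert, Finset.mem_singleton, not_or] at hv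
        simp [relabel, hv.2.2, hf'v v hv.2.1]
      · by_cases hvβ : v = β
        · simp only [relabel, hvβ, Finset.mem_singleton, if_true, hf'v w hwy]
          exact Finset.mem_image_of_mem _ hw
        · have hvy : v = y := by
            simp only [Finset.mem_sdiff, Finset.mem_insert, Finset.mem_singleton, hv,
              true_and, not_not] at hv'
            tauto
          subst hvy
          simp only [relabel, hvβ, Finset.mem_singleton, Finset.notMem_empty, if_false, hf'y]
          exact Finset.mem_image_of_mem _ hxW
  have hne4 : f' 4 ≠ f x := by rw [hf'v 4 (by omega)]; exact hne.symm
  obtain ⟨m, hm, hmin⟩ := Finset.exists_min_image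
    ((Finset.Icc 1 n).filter fun v => v ≠ β ∧ f' v = f' 4) id
    ⟨4, Finset.mem_filter.2 ⟨h4V, by omega, rfl⟩⟩
  obtain ⟨hmV, hmβ, hm4⟩ := Finset.mem_filter.1 hm
  have hmx : f' m ≠ f' x := by rw [hm4, hfx]; exact hne4
  have hmy : f' m ≠ f' y := by rw [hm4, hf'y]; exact hne4
  have hmx' : m ≠ x := fun e => hmx (by rw [e])
  have hmy' : m ≠ y := fun e => hmy (by rw [e])
  have hm4' : 4 ≤ m := by
    have := Finset.mem_Icc.1 hmV
    have := Finset.mem_Icc.1 hxV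
    have := Finset.mem_Icc.1 hyV
    have := Finset.mem_Icc.1 hβV
    omega
  refine ⟨m, hmV, hm4', ?_⟩
  have hmin' : ∀ v ∈ Finset.Icc 1 n, v ≠ β → f' v = f' m → m ≤ v := fun v hv hvβ e =>
    hmin v (Finset.mem_filter.2 ⟨hv, hvβ, by rw [e, hm4]⟩)
  obtain ⟨C, hC⟩ := exists_edge_sum_eq a f' hβV hxV hyV hxβ hyβ hxy h0
  have e₁ := hweight x hxW
  have e₂ := hweight m (by simp [hmy', hmβ, Finset.mem_Icc.1 hmV])
  unfold weight at e₁ e₂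
  rw [hC, sum_rep_eq_add r hβV hβ3 hxV hx3 hxβ hmV hm4' hmx hmin', if_pos rfl,
    if_pos (by rw [hfx, hf'y])] at e₁
  rw [hC, if_neg hmx, if_neg hmy] at e₂
  linarith

/-- A linear functional that is constant on the tight partitions and has coefficient zero on one
edge of the cycle is trivial. -/
theorem coeff_eq_zero (hd : IsOddCycle n p d) (hp : 2 ≤ p) (hK : 4 ≤ K)
    (hKn : K + p + 2 ≤ n)
    (H : ∀ i f, IsTight p (fun k => d (i + k)) f → ((Finset.Icc 1 n).image f).card = K →
      weight n a r f = b)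
    {α β γ : ℕ} (hα : ∀ k, α ≠ d k) (hβ : ∀ k, β ≠ d k) (hαV : α ∈ Finset.Icc 1 n)
    (hβV : β ∈ Finset.Icc 1 n) (hγV : γ ∈ Finset.Icc 1 n) (hα3 : α < 4) (hβ3 : β < 4)
    (hγ3 : γ < 4) (hαβ : α ≠ β) (hαγ : α ≠ γ) (hβγ : β ≠ γ)
    (h0 : a (d 0) (d 1) + a (d 1) (d 0) = 0) :
    (∀ u ∈ Finset.Icc 1 n, ∀ v ∈ Finset.Icc 1 n, u ≠ v → a u v + a v u = 0) ∧
      ∀ v ∈ Finset.Icc 1 n, 4 ≤ v → r v = 0 := by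
  have hcycle : ∀ i j, d i ≠ d j → a (d i) (d j) + a (d j) (d i) = 0 := fun i j hij =>
    hd.eq_zero_of_relations hp (fun u v => a u v + a v u) (fun u v => add_comm _ _)
      (fun i t ht => (hd.shift i).coeff_vertex_pair hp hK hKn (H i) (fun k => hα _)
        (fun k => hβ _) hαV hβV hαβ hα3 hβ3 ht)
      (fun i q hq hqp => (hd.shift i).coeff_pair_pair hp hK hKn (H i) (fun k => hα _)
        (fun k => hβ _) hαV hβV hαβ hα3 hβ3 hq hqp) h0 i j hij
  have hout : ∀ i ∈ Finset.Icc 1 n, ∀ j ∈ Finset.Icc 1 n, i ≠ j → i ≠ α → i ≠ β → j ≠ α → j ≠ β →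
      (∀ k, j ≠ d k) → a i j + a j i = 0 := fun i hi j hj hij hiα hiβ hjα hjβ hjd =>
    hd.coeff_eq_zero_of_not_mem hp hK hKn H hjd hα hi hj hαV hβV hij hαβ hiα.symm hjα.symm
      hiβ.symm hjβ.symm hα3 hβ3
  have hα' : ∀ v ∈ Finset.Icc 1 n, v ≠ α → v ≠ β → v ≠ γ → a α v + a v α = 0 :=
    fun v hv h₁ h₂ h₃ => by
      rw [add_comm]
      exact hd.coeff_eq_zero_of_not_mem hp hK hKn H hα hβ hv hαV hβV hγV h₁ hβγ h₂.symm hαβ.symm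
        h₃.symm hαγ.symm hβ3 hγ3
  have hβ' : ∀ v ∈ Finset.Icc 1 n, v ≠ β → v ≠ α → v ≠ γ → a β v + a v β = 0 :=
    fun v hv h₁ h₂ h₃ => by
      rw [add_comm]
      exact hd.coeff_eq_zero_of_not_mem hp hK hKn H hβ hα hv hβV hαV hγV h₁ hαγ h₂.symm hαβ
        h₃.symm hβγ.symm hα3 hγ3
  obtain ⟨m, hmV, hm4, hm⟩ := hd.exists_sum_coeff_eq_neg_rep hp hK hKn H hβ hα hβV hαV hγV hαβ
    hβγ.symm hαγ hβ3 hα3 hγ3 hβ'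
  have hrβ := fun v hv h4 => hd.coeff_eq_neg_rep hp hK hKn H hβ hα hβV hαV hγV (m := v) hv hαβ
    hβγ.symm hαγ hβ3 hα3 hγ3 h4 hβ'
  have hrα := fun v hv h4 => hd.coeff_eq_neg_rep hp hK hKn H hα hβ hαV hβV hγV (m := v) hv hαβ.symm
    hαγ.symm hβγ hα3 hβ3 hγ3 h4 hα'
  have hβm := hrβ m hmV hm4
  have hαm := hrα m hmV hm4
  have hβα : a β α + a α β = 0 := by linarith
  have hβγ0 : a β γ + a γ β = 0 := by linarith
  have hαγ0 : a α γ + a γ α = 0 := by linarith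
  refine ⟨fun u hu v hv huv => ?_, fun v hv h4 => by have := hrβ v hv h4; linarith⟩
  have hα'' : ∀ v ∈ Finset.Icc 1 n, v ≠ α → a α v + a v α = 0 := fun v hv h => by
    rcases eq_or_ne v β with rfl | h₁
    · linarith
    rcases eq_or_ne v γ with rfl | h₂
    · exact hαγ0
    exact hα' v hv h h₁ h₂
  have hβ'' : ∀ v ∈ Finset.Icc 1 n, v ≠ β → a β v + a v β = 0 := fun v hv h => by
    rcases eq_or_ne v α with rfl | h₁
    · exact hβα
    rcases eq_or_ne v γ with rfl | h₂
    · exact hβγ0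
    exact hβ' v hv h h₁ h₂
  rcases eq_or_ne u α with rfl | huα
  · exact hα'' v hv huv.symm
  rcases eq_or_ne v α with rfl | hvα
  · rw [add_comm]; exact hα'' u hu huv
  rcases eq_or_ne u β with rfl | huβ
  · exact hβ'' v hv huv.symm
  rcases eq_or_ne v β with rfl | hvβ
  · rw [add_comm]; exact hβ'' u hu huv
  by_cases hvd : ∃ k, v = d k
  · by_cases hud : ∃ k, u = d k
    · obtain ⟨i, rfl⟩ := hud
      obtain ⟨j, rfl⟩ := hvd
      exact hcycle i j huv
    · rw [add_comm]
      exact hout v hv u hu huv.symm hvα hvβ huα huβ fun k e => hud ⟨k, e⟩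
  · exact hout u hu v hv huv huα huβ hvα hvβ fun k e => hvd ⟨k, e⟩

end IsOddCycle

open Classical in
/-- The characteristic vector of the partition of `{1,…,n}` into the fibres of `f`. -/
noncomputable def labelVec (n : ℕ) (f : ℕ → ℕ) : GPoint :=
  ⟨fun e => if e.1 ∈ Finset.Icc 1 n ∧ e.2 ∈ Finset.Icc 1 n ∧ f e.1 = f e.2 then 1 else 0,
   fun v => if v ∈ Finset.Icc 1 n ∧ IsRep n f v then 1 else 0⟩

theorem charVec_eq_labelVec {n K : ℕ} (π : KPartition n K) {f : ℕ → ℕ}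
    (h : ∀ u v, (∃ C ∈ π.parts, u ∈ C ∧ v ∈ C) ↔
      u ∈ Finset.Icc 1 n ∧ v ∈ Finset.Icc 1 n ∧ f u = f v) :
    charVec n K π = labelVec n f := by
  have hrep (v : ℕ) : (4 ≤ v ∧ ∃ C ∈ π.parts, v ∈ C ∧ ∀ w ∈ C, v ≤ w) ↔
      v ∈ Finset.Icc 1 n ∧ IsRep n f v := by
    constructor
    · rintro ⟨hv, C, hC, hvC, hmin⟩
      refine ⟨((h v v).1 ⟨C, hC, hvC, hvC⟩).1, hv, fun w hw hwv => ?_⟩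
      obtain ⟨D, hD, hwD, hvD⟩ := (h w v).2 ⟨hw, ((h v v).1 ⟨C, hC, hvC, hvC⟩).1, hwv⟩
      have hCD : C = D := by
        by_contra hne
        exact Finset.disjoint_left.1 (π.parts_disjoint C hC D hD hne) hvC hvD
      exact hmin w (hCD ▸ hwD)
    · rintro ⟨hvV, hv, hmin⟩
      obtain ⟨C, hC, hvC, -⟩ := (h v v).2 ⟨hvV, hvV, rfl⟩
      refine ⟨hv, C, hC, hvC, fun w hw => ?_⟩
      obtain ⟨hwV, -, hwv⟩ := (h w v).1 ⟨C, hC, hw, hvC⟩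
      exact hmin w hwV hwv
  classical
  refine Prod.ext (funext fun e => ?_) (funext fun v => ?_)
  · exact if_congr (h e.1 e.2) rfl rfl
  · exact if_congr (hrep v) rfl rfl

theorem exists_labelVec_eq {n K : ℕ} (π : KPartition n K) :
    ∃ f : ℕ → ℕ, ((Finset.Icc 1 n).image f).card = K ∧ charVec n K π = labelVec n f := by
  have hmem (v : ℕ) : v ∈ Finset.Icc 1 n ↔ ∃ C ∈ π.parts, v ∈ C := by
    simp [← π.parts_cover, Finset.mem_sup]
  have heq {C D : Finset ℕ} {v : ℕ} (hC : C ∈ π.parts) (hD : D ∈ π.parts) (hvC : v ∈ C)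
      (hvD : v ∈ D) : C = D := by
    by_contra hne
    exact Finset.disjoint_left.1 (π.parts_disjoint C hC D hD hne) hvC hvD
  choose! P hP hvP using fun v (hv : v ∈ Finset.Icc 1 n) => (hmem v).1 hv
  refine ⟨fun v => Encodable.encode (P v), ?_, charVec_eq_labelVec π fun u v => ?_⟩
  · rw [← π.card_parts, ← Finset.card_image_of_injective π.parts
      (Encodable.encode_injective (α := Finset ℕ))]
    congr 1
    ext l
    simp only [Finset.mem_image]
    constructor
    · rintro ⟨v, hv, rfl⟩
      exact ⟨P v, hP v hv, rfl⟩
    · rintro ⟨C, hC, rfl⟩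
      obtain ⟨v, hv⟩ := π.parts_nonempty C hC
      have hvV := (hmem v).2 ⟨C, hC, hv⟩
      exact ⟨v, hvV, by rw [heq (hP v hvV) hC (hvP v hvV) hv]⟩
  · constructor
    · rintro ⟨C, hC, hu, hv⟩
      have huV := (hmem u).2 ⟨C, hC, hu⟩
      have hvV := (hmem v).2 ⟨C, hC, hv⟩
      exact ⟨huV, hvV, by rw [heq (hP u huV) hC (hvP u huV) hu, heq (hP v hvV) hC (hvP v hvV) hv]⟩
    · rintro ⟨hu, hv, h⟩
      exact ⟨P u, hP u hu, hvP u hu, Encodable.encode_injective h ▸ hvP v hv⟩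

theorem exists_charVec_eq {n K : ℕ} {f : ℕ → ℕ} (hf : ((Finset.Icc 1 n).image f).card = K) :
    ∃ π : KPartition n K, charVec n K π = labelVec n f := by
  set cell : ℕ → Finset ℕ := fun l => (Finset.Icc 1 n).filter (f · = l)
  have hmem (l v : ℕ) : v ∈ cell l ↔ v ∈ Finset.Icc 1 n ∧ f v = l := Finset.mem_filter
  have hinj : Set.InjOn cell ((Finset.Icc 1 n).image f) := by
    intro l hl m _ h
    obtain ⟨v, hv, rfl⟩ := Finset.mem_image.1 (Finset.mem_coe.1 hl)
    exact ((hmem m v).1 (h ▸ (hmem _ v).2 ⟨hv, rfl⟩)).2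
  refine ⟨⟨((Finset.Icc 1 n).image f).image cell, by rw [Finset.card_image_of_injOn hinj, hf],
    ?_, ?_, ?_⟩, charVec_eq_labelVec _ fun u v => ?_⟩
  · simp only [Finset.mem_image]
    rintro _ ⟨_, ⟨v, hv, rfl⟩, rfl⟩
    exact ⟨v, (hmem _ _).2 ⟨hv, rfl⟩⟩
  · simp only [Finset.mem_image]
    rintro _ ⟨l, -, rfl⟩ _ ⟨m, -, rfl⟩ hne
    refine Finset.disjoint_left.2 fun v hl hm => hne ?_
    rw [← ((hmem _ _).1 hl).2, ← ((hmem _ _).1 hm).2]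
  · ext v
    simp only [Finset.mem_sup, Finset.mem_image, id]
    constructor
    · rintro ⟨_, ⟨l, -, rfl⟩, hv⟩
      exact ((hmem _ _).1 hv).1
    · exact fun hv => ⟨_, ⟨_, ⟨v, hv, rfl⟩, rfl⟩, (hmem _ _).2 ⟨hv, rfl⟩⟩
  · simp only [Finset.mem_image]
    constructor
    · rintro ⟨_, ⟨l, -, rfl⟩, hu, hv⟩
      rw [hmem] at hu hv
      exact ⟨hu.1, hv.1, hu.2.trans hv.2.symm⟩
    · rintro ⟨hu, hv, h⟩
      exact ⟨_, ⟨_, ⟨u, hu, rfl⟩, rfl⟩, (hmem _ _).2 ⟨hu, rfl⟩, (hmem _ _).2 ⟨hv, h.symm⟩⟩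

theorem setOf_charVec_eq (n K : ℕ) : {x | ∃ π : KPartition n K, x = charVec n K π} =
    labelVec n '' {f | ((Finset.Icc 1 n).image f).card = K} := by
  ext x
  constructor
  · rintro ⟨π, rfl⟩
    obtain ⟨f, hf, h⟩ := exists_labelVec_eq π
    exact ⟨f, hf, h.symm⟩
  · rintro ⟨f, hf, rfl⟩
    obtain ⟨π, h⟩ := exists_charVec_eq hf
    exact ⟨π, h.symm⟩

theorem labelVec_eq_sum (n : ℕ) (f : ℕ → ℕ) :
    labelVec n f = (∑ u ∈ Finset.Icc 1 n, ∑ v ∈ Finset.Icc 1 n,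
      (if f u = f v then (1 : ℝ) else 0) • ((Pi.single (u, v) 1, 0) : GPoint)) +
      ∑ v ∈ Finset.Icc 1 n, (open Classical in if IsRep n f v then (1 : ℝ) else 0) •
        ((0, Pi.single v 1) : GPoint) := by
  classical
  refine Prod.ext (funext fun ⟨u, v⟩ => ?_) (funext fun v => ?_)
  · simp only [labelVec, Prod.fst_add, Prod.fst_sum, Finset.sum_apply, Pi.add_apply, Prod.smul_mk,
      Pi.smul_apply, Pi.single_apply, Prod.mk.injEq, smul_zero, Pi.zero_apply,
      Finset.sum_const_zero, add_zero, smul_eq_mul, ite_and, mul_ite, mul_one, mul_zero]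
    simp
  · simp only [labelVec, Prod.snd_add, Prod.snd_sum, Finset.sum_apply, Pi.add_apply, Prod.smul_mk,
      Pi.smul_apply, Pi.single_apply, smul_zero, Pi.zero_apply, Finset.sum_const_zero, zero_add,
      smul_eq_mul, ite_and, mul_ite, mul_one, mul_zero]
    simp

theorem map_labelVec (φ : GPoint →ₗ[ℝ] ℝ) (n : ℕ) (f : ℕ → ℕ) :
    φ (labelVec n f) = weight n (fun u v => φ (Pi.single (u, v) 1, 0))
      (fun v => φ (0, Pi.single v 1)) f := by
  rw [labelVec_eq_sum, weight]
  simp only [map_add, map_sum, map_smul, smul_eq_mul, mul_comm]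

theorem weight_eq_sum_diag {n : ℕ} {a : ℕ → ℕ → ℝ} {r : ℕ → ℝ} (f : ℕ → ℕ)
    (ha : ∀ u ∈ Finset.Icc 1 n, ∀ v ∈ Finset.Icc 1 n, u ≠ v → a u v + a v u = 0)
    (hr : ∀ v ∈ Finset.Icc 1 n, 4 ≤ v → r v = 0) :
    weight n a r f = ∑ v ∈ Finset.Icc 1 n, a v v := by
  classical
  have hrep : ∑ v ∈ Finset.Icc 1 n, r v * (if IsRep n f v then 1 else 0) = 0 := by
    refine Finset.sum_eq_zero fun v hv => ?_
    split_ifs with h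
    · rw [hr v hv h.1, zero_mul]
    · rw [mul_zero]
  have hdiag : ∑ v ∈ Finset.Icc 1 n, (a v v + a v v) = ∑ u ∈ Finset.Icc 1 n,
      ∑ v ∈ Finset.Icc 1 n, (a u v + a v u) * (if f u = f v then 1 else 0) := by
    refine Finset.sum_congr rfl fun u hu => ?_
    rw [Finset.sum_eq_single_of_mem u hu fun v hv hvu => ?_]
    · simp
    · rw [ha u hu v hv hvu.symm, zero_mul]
  have hswap : ∑ u ∈ Finset.Icc 1 n, ∑ v ∈ Finset.Icc 1 n, a v u * (if f u = f v then 1 else 0) =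
      ∑ u ∈ Finset.Icc 1 n, ∑ v ∈ Finset.Icc 1 n, a u v * (if f u = f v then 1 else 0) := by
    rw [Finset.sum_comm]
    simp only [eq_comm]
  simp only [add_mul, Finset.sum_add_distrib, hswap] at hdiag
  rw [weight, hrep]
  linarith

/-- A valid inequality whose tight points determine every functional that is constant on them, up
to a multiple of the left-hand side, defines a facet. -/
theorem finrank_face_add_one {E : Type*} [AddCommGroup E] [Module ℝ E] {S : Set E}
    (hS : S.Finite) (f : E →ₗ[ℝ] ℝ) (b : ℝ) {x y : E} (hx : x ∈ S) (hy : y ∈ S) (hxb : f x = b)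
    (hyb : f y ≠ b)
    (h : ∀ φ : E →ₗ[ℝ] ℝ, (∀ u ∈ S, ∀ v ∈ S, f u = b → f v = b → φ u = φ v) →
      ∃ c : ℝ, ∀ u ∈ S, ∀ v ∈ S, φ u - φ v = c * (f u - f v)) :
    Module.finrank ℝ (affineSpan ℝ {z | z ∈ convexHull ℝ S ∧ f z = b}).direction + 1 =
      Module.finrank ℝ (affineSpan ℝ (convexHull ℝ S)).direction := by
  have := finiteDimensional_vectorSpan_of_finite ℝ hS
  rw [affineSpan_convexHull, direction_affineSpan, direction_affineSpan]
  have hface : vectorSpan ℝ {z | z ∈ convexHull ℝ S ∧ f z = b} =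
      vectorSpan ℝ S ⊓ LinearMap.ker f := by
    refine le_antisymm (le_inf ?_ ?_) fun z hz => ?_
    · rw [← direction_affineSpan, ← direction_affineSpan, ← affineSpan_convexHull (s := S)]
      exact AffineSubspace.direction_le (affineSpan_mono ℝ fun z hz => hz.1)
    · rw [vectorSpan, Submodule.span_le]
      rintro _ ⟨u, hu, v, hv, rfl⟩
      simp [hu.2, hv.2]
    · by_contra hzD
      obtain ⟨φ, hφz, hφ⟩ := Submodule.exists_le_ker_of_notMem hzD
      obtain ⟨c, hc⟩ := h φ fun u hu v hv hub hvb => sub_eq_zero.1 <| by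
        rw [← map_sub]
        exact hφ (vsub_mem_vectorSpan ℝ ⟨subset_convexHull ℝ S hu, hub⟩
          ⟨subset_convexHull ℝ S hv, hvb⟩)
      have hker : vectorSpan ℝ S ≤ LinearMap.ker (φ - c • f) := by
        rw [vectorSpan, Submodule.span_le]
        rintro _ ⟨u, hu, v, hv, rfl⟩
        simp only [vsub_eq_sub, SetLike.mem_coe, LinearMap.mem_ker, LinearMap.sub_apply,
          LinearMap.smul_apply, smul_eq_mul, map_sub]
        linarith [hc u hu v hv]
      have hzf : f z = 0 := hz.2
      have := hker hz.1
      simp [hzf] at this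
      exact hφz this
  have hne : f.domRestrict (vectorSpan ℝ S) ≠ 0 := fun h0 => hyb <| by
    have := LinearMap.congr_fun h0 ⟨x -ᵥ y, vsub_mem_vectorSpan ℝ hx hy⟩
    simp at this
    linarith
  have hker : LinearMap.ker (f.domRestrict (vectorSpan ℝ S)) =
      (LinearMap.ker f).comap (vectorSpan ℝ S).subtype := by
    ext; simp
  have hrank := (f.domRestrict (vectorSpan ℝ S)).finrank_range_add_finrank_ker
  rw [LinearMap.range_eq_top.2 (LinearMap.surjective hne), finrank_top, Module.finrank_self,
    hker, ← Submodule.finrank_map_subtype_eq, Submodule.map_comap_subtype] at hrank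
  rw [hface]
  omega

theorem finite_charVec (n K : ℕ) : {x | ∃ π : KPartition n K, x = charVec n K π}.Finite := by
  have : Finite (KPartition n K) := by
    refine Finite.of_injective (β := (Finset.Icc 1 n).powerset.powerset)
      (fun π => ⟨π.parts, ?_⟩) fun π σ h => ?_
    · rw [Finset.mem_powerset]
      intro C hC
      rw [Finset.mem_powerset, ← π.parts_cover]
      exact Finset.le_sup (f := id) hC
    · cases π; cases σ; simpa using h
  refine (Set.finite_range (charVec n K)).subset ?_
  rintro _ ⟨π, rfl⟩
  exact ⟨π, rfl⟩

/-- The left-hand side of the 2-chorded cycle inequality for the cyclic sequence of labels `g`. -/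
def cycleValue (p : ℕ) (g : ℕ → ℕ) : ℤ :=
  ∑ k ∈ Finset.range (2 * p + 1),
    ((if g k = g (k + 1) then 1 else 0) - if g k = g (k + 2) then 1 else 0)

theorem sum_range_add_of_periodic {N : ℕ} {F : ℕ → ℤ} (hF : ∀ k, F (k + N) = F k) (i : ℕ) :
    ∑ k ∈ Finset.range N, F (i + k) = ∑ k ∈ Finset.range N, F k := by
  induction i with
  | zero => simp
  | succ i ih =>
    rw [← ih]
    have h := Finset.sum_range_succ (fun k => F (i + k)) N
    rw [Finset.sum_range_succ', hF, add_zero] at h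
    simpa [add_comm, add_left_comm] using h

theorem cycleValue_shift {p : ℕ} {g : ℕ → ℕ} (hg : ∀ k, g (k + (2 * p + 1)) = g k) (i : ℕ) :
    cycleValue p (fun k => g (i + k)) = cycleValue p g := by
  have h := sum_range_add_of_periodic (N := 2 * p + 1) (F := fun k =>
    ((if g k = g (k + 1) then 1 else 0) - if g k = g (k + 2) then 1 else 0)) (fun k => by
      simp only [add_right_comm k, hg]) i
  simpa only [cycleValue, ← add_assoc] using h

theorem two_mul_cycleValue {p : ℕ} {g : ℕ → ℕ} (hg : ∀ k, g (k + (2 * p + 1)) = g k) :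
    2 * cycleValue p g = ∑ k ∈ Finset.range (2 * p + 1),
      ((if g k = g (k + 1) then 1 else 0) + (if g (k + 1) = g (k + 2) then 1 else 0) -
        2 * if g k = g (k + 2) then 1 else 0) := by
  have h := sum_range_add_of_periodic (N := 2 * p + 1) (F := fun k =>
    (if g k = g (k + 1) then 1 else 0)) (fun k => by simp only [add_right_comm k, hg]) 1
  simp only [add_comm 1, add_assoc, Nat.reduceAdd] at h
  rw [cycleValue, Finset.sum_sub_distrib, Finset.sum_sub_distrib, Finset.sum_add_distrib, h,
    ← Finset.mul_sum]
  ring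

theorem triple_le_one (x y z : ℕ) :
    ((if x = y then 1 else 0) + (if y = z then 1 else 0) - 2 * if x = z then 1 else 0 : ℤ) ≤ 1 := by
  split_ifs <;> omega

theorem cycleValue_le {p : ℕ} {g : ℕ → ℕ} (hg : ∀ k, g (k + (2 * p + 1)) = g k) :
    cycleValue p g ≤ p := by
  have h := Finset.sum_le_card_nsmul (Finset.range (2 * p + 1)) _ 1 fun k _ =>
    triple_le_one (g k) (g (k + 1)) (g (k + 2))
  rw [← two_mul_cycleValue hg, Finset.card_range, nsmul_eq_mul] at h
  push_cast at h
  omega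

theorem cycleValue_lt {p : ℕ} {g : ℕ → ℕ} (hg : ∀ k, g (k + (2 * p + 1)) = g k)
    (h02 : g 0 = g 2) (h01 : g 0 ≠ g 1) : cycleValue p g < p := by
  have h := two_mul_cycleValue hg
  rw [Finset.sum_range_succ', zero_add, zero_add, if_neg h01, if_neg (h02 ▸ h01.symm),
    if_pos h02] at h
  have h' := Finset.sum_le_card_nsmul (Finset.range (2 * p)) _ 1 fun k _ =>
    triple_le_one (g (k + 1)) (g (k + 1 + 1)) (g (k + 1 + 2))
  rw [Finset.card_range, nsmul_eq_mul] at h'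
  push_cast at h'
  omega

theorem cycleValue_of_isTight {p : ℕ} (hp : 2 ≤ p) {n : ℕ} {d f : ℕ → ℕ} (hd : IsOddCycle n p d)
    (hf : IsTight p d f) : cycleValue p (fun k => f (d k)) = p := by
  have hsum (F : ℕ → ℤ) (q : ℕ) : ∑ k ∈ Finset.range (2 * q + 1), F k =
      F 0 + ∑ t ∈ Finset.range q, (F (2 * t + 1) + F (2 * t + 2)) := by
    induction q with
    | zero => simp
    | succ q ih =>
      rw [show 2 * (q + 1) + 1 = 2 * q + 1 + 1 + 1 by ring, Finset.sum_range_succ,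
        Finset.sum_range_succ, ih, Finset.sum_range_succ]
      ring
  rw [cycleValue, hsum]
  have h0 := hf.pair 0 (by omega)
  rw [Finset.sum_congr rfl (g := fun _ => 1)]
  · simp at h0
    simp [h0]
  · intro t ht
    have ht := Finset.mem_range.1 ht
    have hpair := hf.pair t ht
    by_cases htp : t + 1 < p
    · have hadj := hf.adj t htp
      have hpair' := hf.pair (t + 1) htp
      simp only [mul_add, mul_one, add_assoc, Nat.reduceAdd] at hpair' ⊢
      simp [hpair, hpair', hadj]
    · obtain rfl : p = t + 1 := by omega
      have e0 : d (2 * t + 3) = d 0 := by simpa [mul_add, add_assoc] using hd.add_period 0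
      have e1 : d (2 * t + 4) = d 1 := by
        have := hd.add_period 1
        rwa [show 1 + (2 * (t + 1) + 1) = 2 * t + 4 by ring] at this
      have hw := hf.wrap
      simp only [mul_add, mul_one, add_assoc, Nat.reduceAdd] at hw h0 ⊢
      simp only [mul_zero, zero_add] at h0
      simp [hpair, e0, e1, h0, hw.symm]

/-- The left-hand side of the 2-chorded cycle inequality, as a linear functional. -/
noncomputable def cycleForm {p : ℕ} (c : Fin (2 * p + 1) → ℕ) : GPoint →ₗ[ℝ] ℝ where
  toFun x := (∑ i, x.1 (c i, c (i + 1))) - ∑ i, x.1 (c i, c (i + 2))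
  map_add' x y := by
    simp only [Prod.fst_add, Pi.add_apply, Finset.sum_add_distrib]
    ring
  map_smul' t x := by simp [Finset.mul_sum, mul_sub]

theorem isOddCycle_of_injective {n p : ℕ} {c : Fin (2 * p + 1) → ℕ}
    (hcV : ∀ i, c i ∈ Finset.Icc 1 n) (hc : Function.Injective c) :
    IsOddCycle n p fun k => c (Fin.ofNat (2 * p + 1) k) where
  mem _ := hcV _
  eq_iff j k := by
    rw [hc.eq_iff, Fin.ext_iff]
    rfl

theorem ofNat_val_add (m k : ℕ) [NeZero m] (i : Fin m) :
    Fin.ofNat m (i.val + k) = i + Fin.ofNat m k := by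
  ext
  simp [Fin.val_add]

theorem cycleForm_labelVec {n p : ℕ} {c : Fin (2 * p + 1) → ℕ}
    (hcV : ∀ i, c i ∈ Finset.Icc 1 n) (f : ℕ → ℕ) :
    cycleForm c (labelVec n f) = cycleValue p fun k => f (c (Fin.ofNat (2 * p + 1) k)) := by
  have h (i : Fin (2 * p + 1)) (k : ℕ) : c (i + Fin.ofNat (2 * p + 1) k) =
      c (Fin.ofNat (2 * p + 1) (i.val + k)) := by rw [ofNat_val_add]
  have h0 (i : Fin (2 * p + 1)) : c i = c (Fin.ofNat (2 * p + 1) i.val) := by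
    simp
  have h1 (i : Fin (2 * p + 1)) : c (i + 1) = c (Fin.ofNat (2 * p + 1) (i.val + 1)) := h i 1
  have h2 (i : Fin (2 * p + 1)) : c (i + 2) = c (Fin.ofNat (2 * p + 1) (i.val + 2)) := h i 2
  rw [cycleValue, ← Fin.sum_univ_eq_sum_range (fun k => (if f (c (Fin.ofNat (2 * p + 1) k)) =
    f (c (Fin.ofNat (2 * p + 1) (k + 1))) then (1 : ℤ) else 0) -
      if f (c (Fin.ofNat (2 * p + 1) k)) = f (c (Fin.ofNat (2 * p + 1) (k + 2))) then 1 else 0)]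
  push_cast
  rw [Finset.sum_sub_distrib]
  change (∑ i, (labelVec n f).1 _) - (∑ i, (labelVec n f).1 _) = _
  simp only [labelVec, hcV, true_and, ← h1, ← h2, ← h0]

theorem cycleForm_edge {p : ℕ} (hp : 2 ≤ p) {c : Fin (2 * p + 1) → ℕ}
    (hc : Function.Injective c) :
    cycleForm c (Pi.single (c 0, c 1) 1, 0) + cycleForm c (Pi.single (c 1, c 0) 1, 0) = 1 := by
  have v0 : ((0 : Fin (2 * p + 1)) : ℕ) = 0 := rfl
  have v1 : ((1 : Fin (2 * p + 1)) : ℕ) = 1 :=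
    Nat.mod_eq_of_lt (show 1 < 2 * p + 1 by omega)
  have v2 : ((2 : Fin (2 * p + 1)) : ℕ) = 2 :=
    Nat.mod_eq_of_lt (show 2 < 2 * p + 1 by omega)
  have e (i j k : Fin (2 * p + 1)) (x : Fin (2 * p + 1)) :
      (Pi.single (c i, c j) (1 : ℝ) : ℕ × ℕ → ℝ) (c x, c (x + k)) =
        if x = i then if i + k = j then 1 else 0 else 0 := by
    simp only [Pi.single_apply, Prod.mk.injEq, hc.eq_iff, ite_and]
    split_ifs <;> simp_all
  have n1 : (1 : Fin (2 * p + 1)) + 1 ≠ 0 := by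
    rw [Ne, Fin.ext_iff, Fin.val_add, v0, v1, Nat.mod_eq_of_lt (by omega)]
    omega
  have n2 : (2 : Fin (2 * p + 1)) ≠ 1 := by
    rw [Ne, Fin.ext_iff, v1, v2]
    omega
  have n3 : (1 : Fin (2 * p + 1)) + 2 ≠ 0 := by
    rw [Ne, Fin.ext_iff, Fin.val_add, v0, v1, v2, Nat.mod_eq_of_lt (by omega)]
    omega
  change (∑ x, (Pi.single _ _ : ℕ × ℕ → ℝ) _ - ∑ x, (Pi.single _ _ : ℕ × ℕ → ℝ) _) +
    (∑ x, (Pi.single _ _ : ℕ × ℕ → ℝ) _ - ∑ x, (Pi.single _ _ : ℕ × ℕ → ℝ) _) = _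
  simp [e, n1, n2, n3]

namespace IsOddCycle

variable {n p K : ℕ} {d : ℕ → ℕ}

theorem exists_isTight (hd : IsOddCycle n p d) (hp : 2 ≤ p) (hK : 4 ≤ K) (hKn : K + p + 2 ≤ n)
    {α β : ℕ} (hα : ∀ k, α ≠ d k) (hβ : ∀ k, β ≠ d k) (hαV : α ∈ Finset.Icc 1 n)
    (hβV : β ∈ Finset.Icc 1 n) (hαβ : α ≠ β) :
    ∃ f, ((Finset.Icc 1 n).image f).card = K ∧ IsTight p d f ∧ f (d 0) ≠ f (d 1) := by
  have h0 : ∀ k < 2 * p, d 0 ≠ d (k + 1) := fun k hk e => by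
    have := hd.inj (by omega) (by omega) e
    omega
  have h1β := hβ 1
  have h10 := h0 0 (by omega)
  simp only [zero_add] at h10
  have hαW : α ∈ Finset.Icc 1 n \ {d 0, β} := by simp [hα 0, hαβ, Finset.mem_Icc.1 hαV]
  have h1W : d 1 ∈ Finset.Icc 1 n \ {d 0, β} := by
    simp [h10.symm, h1β.symm, Finset.mem_Icc.1 (hd.mem 1)]
  obtain ⟨f, hf, hne, hg⟩ := hd.exists_movable_vertices hp (by omega) hKn h0 (fun k _ => hβ _)
    (fun k _ => hα _) (hα 1) hαW h1W
  set g := relabel f {d 0} {β} (f α) (f α) with hg_def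
  have hgv : ∀ v ∈ Finset.Icc 1 n \ {d 0, β}, g v = f v := fun v hv => by
    simp only [Finset.mem_sdiff, Finset.mem_insert, Finset.mem_singleton, not_or] at hv
    simp [hg_def, relabel, hv.2.1, hv.2.2]
  have hg0 : g (d 0) = f α := by simp [hg_def, relabel]
  have hgβ : g β = f α := by simp [hg_def, relabel]
  refine ⟨g, ?_, hg g hgv, ?_⟩
  · rw [card_image_of_eqOn Finset.sdiff_subset hgv, hf]
    intro v hv hvW
    have : v = d 0 ∨ v = β := by simpa [Finset.mem_Icc.1 hv, or_iff_not_imp_left] using hvW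
    rcases this with rfl | rfl
    · exact hg0 ▸ Finset.mem_image_of_mem f hαW
    · exact hgβ ▸ Finset.mem_image_of_mem f hαW
  · rwa [hg0, hgv _ h1W]

theorem exists_not_isTight (hd : IsOddCycle n p d) (hp : 2 ≤ p) {f : ℕ → ℕ}
    (hf : IsTight p d f) (h : f (d 0) ≠ f (d 1)) :
    ∃ g, ((Finset.Icc 1 n).image g).card = ((Finset.Icc 1 n).image f).card ∧
      cycleValue p (fun k => g (d k)) < p := by
  have h12 := hf.pair 0 (by omega)
  simp only [mul_zero, zero_add] at h12
  have hne : ∀ k < 2, d k ≠ d 2 := fun k hk e => by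
    have := hd.inj (by omega) (by omega) e
    omega
  set g := Function.update f (d 2) (f (d 0))
  have hgv (v : ℕ) (hv : v ≠ d 2) : g v = f v := Function.update_of_ne hv ..
  have hg2 : g (d 2) = f (d 0) := Function.update_self ..
  refine ⟨g, ?_, cycleValue_lt (fun k => by rw [hd.add_period]) ?_ ?_⟩
  · congr 1
    ext l
    simp only [Finset.mem_image]
    constructor
    · rintro ⟨v, hv, rfl⟩
      by_cases hv2 : v = d 2
      · exact ⟨d 0, hd.mem 0, by rw [hv2, hg2]⟩
      · exact ⟨v, hv, (hgv v hv2).symm⟩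
    · rintro ⟨v, hv, rfl⟩
      by_cases hv2 : v = d 2
      · exact ⟨d 1, hd.mem 1, by rw [hv2, hgv _ (hne 1 (by omega)), h12]⟩
      · exact ⟨v, hv, hgv v hv2⟩
  · rw [hg2, hgv _ (hne 0 (by omega))]
  · rw [hgv _ (hne 0 (by omega)), hgv _ (hne 1 (by omega))]
    exact h

end IsOddCycle

theorem exists_fixed_representatives {n : ℕ} {s : Finset ℕ} (hn : 3 ≤ n)
    (h : 2 ≤ ((Finset.Icc 1 n \ s) ∩ {1, 2, 3}).card) :
    ∃ α ∈ Finset.Icc 1 n, ∃ β ∈ Finset.Icc 1 n, ∃ γ ∈ Finset.Icc 1 n, α ∉ s ∧ β ∉ s ∧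
      α < 4 ∧ β < 4 ∧ γ < 4 ∧ α ≠ β ∧ α ≠ γ ∧ β ≠ γ := by
  obtain ⟨α, hα, β, hβ, hαβ⟩ := Finset.one_lt_card.1 h
  simp only [Finset.mem_inter, Finset.mem_sdiff, Finset.mem_insert, Finset.mem_singleton] at hα hβ
  refine ⟨α, hα.1.1, β, hβ.1.1, 6 - α - β, Finset.mem_Icc.2 (by omega), hα.1.2, hβ.1.2, ?_⟩
  omega

/-- For `n ≥ 5`, `4 ≤ K ≤ n-2`, `p ≥ 2` and an odd cycle `C` on pairwise distinct vertices
`c₁,…,c_{2p+1}` of `V`, with `U = V ∖ {c₁,…,c_{2p+1}}`, if `|U ∩ {1,2,3}| ≥ 2` and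
`p ≤ n - K - |U ∩ {1,2,3}|`, then the 2-chorded cycle inequality
`Σ_{e ∈ E(C)} x_e - Σ_{e ∈ E(C̄)} x_e ≤ p` is facet-defining for `P_{n,K}`. -/
theorem two_chorded_cycle_facet (n K p : ℕ) (hn : 5 ≤ n) (hK1 : 4 ≤ K) (hK2 : K ≤ n - 2)
    (hp : 2 ≤ p) (c : Fin (2 * p + 1) → ℕ)
    (hcV : ∀ i, c i ∈ Finset.Icc 1 n) (hcInj : Function.Injective c)
    (hU2 : 2 ≤ ((Finset.Icc 1 n \ Finset.image c Finset.univ) ∩ {1, 2, 3}).card)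
    (hpK : p ≤ n - K - ((Finset.Icc 1 n \ Finset.image c Finset.univ) ∩ {1, 2, 3}).card) :
    IsFacetLe n K
      (fun x => (∑ i : Fin (2 * p + 1), x.1 (c i, c (i + 1))) -
        ∑ i : Fin (2 * p + 1), x.1 (c i, c (i + 2)))
      (p : ℝ) := by
  obtain ⟨α, hαV, β, hβV, γ, hγV, hα, hβ, hα3, hβ3, hγ3, hαβ, hαγ, hβγ⟩ :=
    exists_fixed_representatives (by omega) hU2
  have hKn : K + p + 2 ≤ n := by omega
  set d : ℕ → ℕ := fun k => c (Fin.ofNat (2 * p + 1) k)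
  have hd : IsOddCycle n p d := isOddCycle_of_injective hcV hcInj
  have hαd (k : ℕ) : α ≠ d k := fun e => hα (e ▸ Finset.mem_image_of_mem c (Finset.mem_univ _))
  have hβd (k : ℕ) : β ≠ d k := fun e => hβ (e ▸ Finset.mem_image_of_mem c (Finset.mem_univ _))
  have hper (f : ℕ → ℕ) (k : ℕ) : f (d (k + (2 * p + 1))) = f (d k) := by rw [hd.add_period]
  have hval (f : ℕ → ℕ) : cycleForm c (labelVec n f) = cycleValue p fun k => f (d k) :=
    cycleForm_labelVec hcV f
  have htight (i : ℕ) (f : ℕ → ℕ) (hf : IsTight p (fun k => d (i + k)) f) :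
      cycleForm c (labelVec n f) = p := by
    rw [hval, ← cycleValue_shift (hper f) i]
    exact_mod_cast cycleValue_of_isTight hp (hd.shift i) hf
  change (∀ x ∈ PolyP n K, cycleForm c x ≤ p) ∧
    adim {x | x ∈ PolyP n K ∧ cycleForm c x = p} + 1 = adim (PolyP n K)
  constructor
  · refine fun x hx => convexHull_min (t := {x | cycleForm c x ≤ p}) ?_
      (convex_halfSpace_le (cycleForm c).isLinear _) hx
    rw [setOf_charVec_eq]
    rintro _ ⟨f, -, rfl⟩
    rw [Set.mem_ofPred_eq, hval]
    exact_mod_cast cycleValue_le (hper f)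
  · obtain ⟨f, hfK, hf, hf01⟩ := hd.exists_isTight hp hK1 hKn hαd hβd hαV hβV hαβ
    obtain ⟨g, hgK, hg⟩ := hd.exists_not_isTight hp hf hf01
    refine finrank_face_add_one (finite_charVec n K) (cycleForm c) p (x := labelVec n f)
      (y := labelVec n g) ?_ ?_ (htight 0 f (by simpa using hf)) ?_ fun φ hφ => ?_
    · exact setOf_charVec_eq n K ▸ ⟨f, hfK, rfl⟩
    · exact setOf_charVec_eq n K ▸ ⟨g, hgK.trans hfK, rfl⟩
    · rw [hval]
      exact_mod_cast hg.ne
    · rw [setOf_charVec_eq] at hφ ⊢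
      set t := φ (Pi.single (c 0, c 1) 1, 0) + φ (Pi.single (c 1, c 0) 1, 0)
      set ψ := φ - t • cycleForm c with hψ
      have hψ0 : ψ (Pi.single (d 0, d 1) 1, 0) + ψ (Pi.single (d 1, d 0) 1, 0) = 0 := by
        have h0 : d 0 = c 0 := rfl
        have h1 : d 1 = c 1 := rfl
        rw [h0, h1]
        simp only [hψ, LinearMap.sub_apply, LinearMap.smul_apply, smul_eq_mul]
        linear_combination (-t) * cycleForm_edge hp hcInj
      obtain ⟨ha, hr⟩ := hd.coeff_eq_zero (a := fun u v => ψ (Pi.single (u, v) 1, 0))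
        (r := fun v => ψ (0, Pi.single v 1)) (b := ψ (labelVec n f)) hp hK1 hKn
        (fun i h hh hhK => by
          rw [← map_labelVec]
          simp only [hψ, LinearMap.sub_apply, LinearMap.smul_apply, htight i h hh,
            htight 0 f (by simpa using hf)]
          rw [hφ _ ⟨h, hhK, rfl⟩ _ ⟨f, hfK, rfl⟩ (htight i h hh)
            (htight 0 f (by simpa using hf))])
        hαd hβd hαV hβV hγV hα3 hβ3 hγ3 hαβ hαγ hβγ hψ0
      refine ⟨t, ?_⟩
      rintro _ ⟨h, -, rfl⟩ _ ⟨h', -, rfl⟩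
      have := ((map_labelVec ψ n h).trans (weight_eq_sum_diag h ha hr)).trans
        ((map_labelVec ψ n h').trans (weight_eq_sum_diag h' ha hr)).symm
      simp only [hψ, LinearMap.sub_apply, LinearMap.smul_apply, smul_eq_mul] at this
      linarith
end

section
/- Let n ≥ 5 and 3 ≤ K ≤ n−2, and let Z ⊆ V with |Z| ≥ K+1; write |Z| = qK + r with q ≥ 1 an integer and 0 ≤ r ≤ K−1, and set U = V ∖ Z. The general clique inequality x(E(Z)) ≥ C(q+1,2)·r + C(q,2)·(K−r) (where C(m,2) = m(m−1)/2) is valid for P_{n,K}, and it is facet-defining for P_{n,K} if and only if all of the following hold: (i) U ≠ ∅ and min U ≤ 3; (ii) n ∈ Z; (iii) K+1 ≤ |Z| ≤ 2K−1. -/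
section

open Finset Module

lemma apply_mul_apply_comm_of_finrank_add_one {W : Type*} [AddCommGroup W] [Module ℝ W]
    {D E : Submodule ℝ W} [FiniteDimensional ℝ E] (hDE : D ≤ E)
    (h : finrank ℝ D + 1 = finrank ℝ E) {f g : W →ₗ[ℝ] ℝ} (hf : D ≤ LinearMap.ker f)
    (hg : D ≤ LinearMap.ker g) {x y : W} (hx : x ∈ E) (hy : y ∈ E) :
    f x * g y = f y * g x := by
  by_contra hne
  wlog hfx : f x ≠ 0 generalizing x y
  · have hfx : f x = 0 := not_not.1 hfx
    refine this hy hx (fun h => hne h.symm) fun hfy => hne ?_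
    simp [hfx, hfy]
  set v := f x • y - f y • x with hv
  have hvE : v ∈ E := E.sub_mem (E.smul_mem _ hy) (E.smul_mem _ hx)
  have hfv : f v = 0 := by simp [hv, mul_comm]
  have hgv : g v ≠ 0 := by
    simp only [hv, map_sub, map_smul, smul_eq_mul]
    exact sub_ne_zero.2 hne
  set D' := D ⊔ Submodule.span ℝ {v}
  have hvD' : v ∈ D' := Submodule.mem_sup_right (Submodule.mem_span_singleton_self v)
  have hD'E : D' ≤ E := sup_le hDE (by simpa using hvE)
  have hD'f : D' ≤ LinearMap.ker f := sup_le hf (by simpa using hfv)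
  have : FiniteDimensional ℝ D' := Submodule.finiteDimensional_of_le hD'E
  have h1 : finrank ℝ D < finrank ℝ D' :=
    Submodule.finrank_lt_finrank_of_lt
      (lt_of_le_of_ne le_sup_left fun h => hgv (hg (h.symm ▸ hvD')))
  have h2 : finrank ℝ D' < finrank ℝ E :=
    Submodule.finrank_lt_finrank_of_lt
      (lt_of_le_of_ne hD'E fun h => hfx (hD'f (h.symm ▸ hx)))
  omega

lemma finrank_add_one_of_forall_dual {W : Type*} [AddCommGroup W] [Module ℝ W]
    {D E : Submodule ℝ W} [FiniteDimensional ℝ E] (hDE : D ≤ E) {f : W →ₗ[ℝ] ℝ}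
    (hf : D ≤ LinearMap.ker f) {v : W} (hv : v ∈ E) (hfv : f v ≠ 0)
    (hdual : ∀ φ : W →ₗ[ℝ] ℝ, D ≤ LinearMap.ker φ → ∃ c : ℝ, ∀ x ∈ E, φ x = c * f x) :
    finrank ℝ D + 1 = finrank ℝ E := by
  have : FiniteDimensional ℝ D := Submodule.finiteDimensional_of_le hDE
  have hlt : D < E := lt_of_le_of_ne hDE fun h => hfv (hf (h.symm ▸ hv))
  have h1 := Submodule.finrank_lt_finrank_of_lt hlt
  have hE : E ≤ D ⊔ Submodule.span ℝ {v} := by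
    intro x hx
    by_contra hxn
    obtain ⟨φ, hφx, hφ⟩ := Submodule.exists_le_ker_of_notMem hxn
    obtain ⟨c, hc⟩ := hdual φ (le_sup_left.trans hφ)
    have hφv : φ v = 0 :=
      hφ (Submodule.mem_sup_right (Submodule.mem_span_singleton_self v))
    have hc0 : c = 0 := by
      have := hc v hv
      rw [hφv] at this
      exact (mul_eq_zero.1 this.symm).resolve_right hfv
    exact hφx (by rw [hc x hx, hc0, zero_mul])
  have h2 := Submodule.finrank_mono hE
  have h3 := Submodule.finrank_add_le_finrank_add_finrank D (Submodule.span ℝ {v})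
  have h4 := finrank_span_singleton (K := ℝ) (v := v) (by rintro rfl; simp at hfv)
  omega

lemma vectorSpan_le_ker {W : Type*} [AddCommGroup W] [Module ℝ W] {s : Set W}
    {g : W →ₗ[ℝ] ℝ} {c : ℝ} (h : ∀ x ∈ s, g x = c) : vectorSpan ℝ s ≤ LinearMap.ker g := by
  rw [vectorSpan_def, Submodule.span_le]
  rintro _ ⟨x, hx, y, hy, rfl⟩
  simp [h x hx, h y hy]

namespace KPartition

variable {n K : ℕ}

lemma parts_injective : Function.Injective (KPartition.parts : KPartition n K → _) := by
  rintro ⟨p, _, _, _, _⟩ ⟨q, _, _, _, _⟩ h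
  simpa using h

lemma biUnion_parts (π : KPartition n K) : π.parts.biUnion id = Icc 1 n := by
  rw [← sup_eq_biUnion, π.parts_cover]

lemma subset_Icc (π : KPartition n K) {C : Finset ℕ} (hC : C ∈ π.parts) : C ⊆ Icc 1 n := by
  rw [← π.biUnion_parts]
  exact subset_biUnion_of_mem id hC

lemma exists_mem_parts (π : KPartition n K) {v : ℕ} (hv : v ∈ Icc 1 n) :
    ∃ C ∈ π.parts, v ∈ C := by
  rw [← π.biUnion_parts] at hv
  simpa using hv

lemma eq_of_mem (π : KPartition n K) {C D : Finset ℕ} (hC : C ∈ π.parts) (hD : D ∈ π.parts)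
    {v : ℕ} (hvC : v ∈ C) (hvD : v ∈ D) : C = D := by
  by_contra h
  exact disjoint_left.1 (π.parts_disjoint C hC D hD h) hvC hvD

instance : Finite (KPartition n K) := by
  refine Finite.of_injective
    (fun π : KPartition n K => (⟨π.parts, ?_⟩ : {x // x ∈ (Icc 1 n).powerset.powerset})) ?_
  · simp only [mem_powerset]
    intro C hC
    exact mem_powerset.2 (π.subset_Icc hC)
  · intro π ρ h
    exact parts_injective (by simpa using h)

lemma sum_sum_eq (π : KPartition n K) (g : ℕ → ℝ) :
    ∑ C ∈ π.parts, ∑ v ∈ C, g v = ∑ v ∈ Icc 1 n, g v := by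
  rw [← π.biUnion_parts, sum_biUnion]
  · rfl
  · intro C hC D hD h
    exact π.parts_disjoint C hC D hD h

lemma sum_ite_eq (π : KPartition n K) (P : Finset ℕ → Prop) [DecidablePred P] {v : ℕ}
    (hP : ∀ C ∈ π.parts, P C → v ∈ C) :
    ∑ C ∈ π.parts, (if P C then (1 : ℝ) else 0)
      = open Classical in if ∃ C ∈ π.parts, P C then 1 else 0 := by
  split_ifs with h
  · obtain ⟨C, hC, hPC⟩ := h
    rw [sum_eq_single_of_mem C hC, if_pos hPC]
    intro D hD hne
    exact if_neg fun hPD => hne (π.eq_of_mem hD hC (hP D hD hPD) (hP C hC hPC))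
  · exact sum_eq_zero fun C hC => if_neg fun hPC => h ⟨C, hC, hPC⟩

/-- The `K`-partition given by a `Finpartition` of the vertex set with `K` parts. -/
def ofFinpartition (P : Finpartition (Icc 1 n)) (h : #P.parts = K) : KPartition n K where
  parts := P.parts
  card_parts := h
  parts_nonempty _ hC := P.nonempty_of_mem_parts hC
  parts_disjoint _ hC _ hD hne := P.disjoint hC hD hne
  parts_cover := P.sup_parts

end KPartition

/-- The contribution of a single cluster to a characteristic vector. -/
noncomputable def clusterVec (C : Finset ℕ) : GPoint :=
  ⟨fun p => if p.1 ∈ C ∧ p.2 ∈ C then 1 else 0,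
   fun v => if 4 ≤ v ∧ v ∈ C ∧ ∀ w ∈ C, v ≤ w then 1 else 0⟩

lemma charVec_eq_sum {n K : ℕ} (π : KPartition n K) :
    charVec n K π = ∑ C ∈ π.parts, clusterVec C := by
  refine Prod.ext ?_ ?_
  · funext p
    simp only [charVec, Prod.fst_sum, Finset.sum_apply, clusterVec]
    rw [π.sum_ite_eq (fun C => p.1 ∈ C ∧ p.2 ∈ C) (v := p.1) fun C _ h => h.1]
  · funext v
    simp only [charVec, Prod.snd_sum, Finset.sum_apply, clusterVec]
    rw [π.sum_ite_eq (fun C => 4 ≤ v ∧ v ∈ C ∧ ∀ w ∈ C, v ≤ w) (v := v) fun C _ h => h.2.1]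
    congr 1
    simp only [eq_iff_iff]
    constructor
    · rintro ⟨h, C, hC, h'⟩
      exact ⟨C, hC, h, h'⟩
    · rintro ⟨C, hC, h, h'⟩
      exact ⟨h, C, hC, h'⟩

section Polytope

lemma adim_eq_finrank_vectorSpan (s : Set GPoint) : adim s = finrank ℝ (vectorSpan ℝ s) := by
  rw [adim, direction_affineSpan]

variable {n K : ℕ}

lemma charVec_mem_PolyP (π : KPartition n K) : charVec n K π ∈ PolyP n K :=
  subset_convexHull ℝ _ ⟨π, rfl⟩

lemma le_apply_of_mem_PolyP {g : GPoint →ₗ[ℝ] ℝ} {c : ℝ}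
    (h : ∀ π : KPartition n K, c ≤ g (charVec n K π)) {x : GPoint} (hx : x ∈ PolyP n K) :
    c ≤ g x := by
  refine convexHull_min (t := {w | c ≤ g w}) ?_ (convex_halfSpace_ge g.isLinear c) hx
  rintro _ ⟨π, rfl⟩
  exact h π

lemma vectorSpan_PolyP_le_ker {g : GPoint →ₗ[ℝ] ℝ} {c : ℝ}
    (h : ∀ π : KPartition n K, g (charVec n K π) = c) :
    vectorSpan ℝ (PolyP n K) ≤ LinearMap.ker g := by
  rw [← direction_affineSpan, PolyP, affineSpan_convexHull, direction_affineSpan]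
  refine vectorSpan_le_ker (c := c) ?_
  rintro _ ⟨π, rfl⟩
  exact h π

instance : FiniteDimensional ℝ (vectorSpan ℝ (PolyP n K)) := by
  rw [← direction_affineSpan, PolyP, affineSpan_convexHull]
  refine finiteDimensional_direction_affineSpan_of_finite ℝ ?_
  refine (Set.finite_range (charVec n K)).subset ?_
  rintro _ ⟨π, rfl⟩
  exact ⟨π, rfl⟩

/-- If `0 ≤ g - c ≤ f - b` on the vertices, the face `f = b` lies in `g = c`; if it is a facet
then `f` and `g` are proportional up to constants. -/
lemma mul_sub_eq_mul_sub_of_facet {f g : GPoint →ₗ[ℝ] ℝ} {b c : ℝ}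
    (hfac : IsFacetGe n K f b)
    (h0 : ∀ π : KPartition n K, c ≤ g (charVec n K π))
    (h1 : ∀ π : KPartition n K, g (charVec n K π) - c ≤ f (charVec n K π) - b)
    (π₁ π₂ π₃ π₄ : KPartition n K) :
    (f (charVec n K π₁) - f (charVec n K π₂)) * (g (charVec n K π₃) - g (charVec n K π₄)) =
    (f (charVec n K π₃) - f (charVec n K π₄)) * (g (charVec n K π₁) - g (charVec n K π₂)) := by
  obtain ⟨-, hdim⟩ := hfac
  simp only [adim_eq_finrank_vectorSpan] at hdim
  have hg : ∀ x ∈ {x | x ∈ PolyP n K ∧ f x = b}, g x = c := by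
    rintro x ⟨hx, hfx⟩
    refine le_antisymm ?_ (le_apply_of_mem_PolyP h0 hx)
    have := le_apply_of_mem_PolyP (g := f - g) (c := b - c)
      (fun π => by have := h1 π; simp only [LinearMap.sub_apply]; linarith) hx
    simp only [LinearMap.sub_apply] at this
    linarith
  have key := apply_mul_apply_comm_of_finrank_add_one
    (vectorSpan_mono ℝ (fun x hx => hx.1)) hdim
    (vectorSpan_le_ker fun x hx => hx.2) (vectorSpan_le_ker hg)
    (vsub_mem_vectorSpan ℝ (charVec_mem_PolyP π₁) (charVec_mem_PolyP π₂))
    (vsub_mem_vectorSpan ℝ (charVec_mem_PolyP π₃) (charVec_mem_PolyP π₄))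
  simpa using key

lemma isFacetGe_of_forall_dual {f : GPoint →ₗ[ℝ] ℝ} {b : ℝ}
    (hb : ∀ π : KPartition n K, b ≤ f (charVec n K π))
    {π₁ π₂ : KPartition n K} (hne : f (charVec n K π₁) ≠ f (charVec n K π₂))
    (hdual : ∀ φ : GPoint →ₗ[ℝ] ℝ,
      (∀ π ρ : KPartition n K, f (charVec n K π) = b → f (charVec n K ρ) = b →
        φ (charVec n K π) = φ (charVec n K ρ)) →
      ∃ c d : ℝ, ∀ π : KPartition n K, φ (charVec n K π) = c * f (charVec n K π) + d) :
    IsFacetGe n K f b := by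
  refine ⟨fun x hx => le_apply_of_mem_PolyP hb hx, ?_⟩
  simp only [adim_eq_finrank_vectorSpan]
  refine finrank_add_one_of_forall_dual (vectorSpan_mono ℝ (fun x hx => hx.1))
    (vectorSpan_le_ker fun x hx => hx.2)
    (vsub_mem_vectorSpan ℝ (charVec_mem_PolyP π₁) (charVec_mem_PolyP π₂)) ?_ fun φ hφ => ?_
  · simpa using sub_ne_zero.2 hne
  · obtain ⟨c, d, hcd⟩ := hdual φ fun π ρ hπ hρ => by
      have := hφ (vsub_mem_vectorSpan ℝ (p₁ := charVec n K π) (p₂ := charVec n K ρ)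
        ⟨charVec_mem_PolyP π, hπ⟩ ⟨charVec_mem_PolyP ρ, hρ⟩)
      simpa [sub_eq_zero] using this
    refine ⟨c, fun x hx => ?_⟩
    have := vectorSpan_PolyP_le_ker (g := φ - c • f) (c := d)
      (fun π => by simp [hcd π]) hx
    simpa [sub_eq_zero] using this

end Polytope

/-- The weight of a cluster under edge weights `A` and representative weights `β`. -/
noncomputable def clusterWeight (A : ℕ → ℕ → ℝ) (β : ℕ → ℝ) (C : Finset ℕ) : ℝ :=
  ∑ p ∈ C, ∑ q ∈ C, A p q + β (sInf (C : Set ℕ))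

lemma clusterVec_eq {C : Finset ℕ} (hC : C.Nonempty) :
    clusterVec C = ∑ p ∈ C, ∑ q ∈ C, ((Pi.single (p, q) 1, 0) : GPoint) +
      ((0, if 4 ≤ sInf (C : Set ℕ) then Pi.single (sInf (C : Set ℕ)) 1 else 0) : GPoint) := by
  refine Prod.ext ?_ ?_
  · funext ⟨u, v⟩
    simp only [clusterVec, Prod.fst_add, Prod.fst_sum, Pi.add_apply, Finset.sum_apply,
      Pi.zero_apply, add_zero, Pi.single_apply, Prod.mk.injEq]
    by_cases hu : u ∈ C <;> by_cases hv : v ∈ C <;>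
      simp [hu, hv, ite_and, Finset.sum_ite_eq]
  · funext v
    simp only [clusterVec, Prod.snd_add, Prod.snd_sum, Pi.add_apply,
      Pi.zero_apply, Finset.sum_const_zero, zero_add]
    have hmin : (v ∈ C ∧ ∀ w ∈ C, v ≤ w) ↔ v = sInf (C : Set ℕ) := by
      constructor
      · rintro ⟨hv, hle⟩
        exact le_antisymm (le_csInf ⟨v, hv⟩ hle) (Nat.sInf_le hv)
      · rintro rfl
        exact ⟨mem_coe.1 (Nat.sInf_mem (coe_nonempty.2 hC)), fun w hw => Nat.sInf_le hw⟩
    simp only [hmin]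
    by_cases hv : v = sInf (C : Set ℕ)
    · rw [← hv]
      by_cases h4 : 4 ≤ v <;> simp [h4]
    · by_cases h4 : 4 ≤ sInf (C : Set ℕ) <;> simp [hv, h4]

lemma apply_clusterVec (φ : GPoint →ₗ[ℝ] ℝ) {C : Finset ℕ} (hC : C.Nonempty) :
    φ (clusterVec C) = clusterWeight (fun p q => φ (Pi.single (p, q) 1, 0))
      (fun v => if 4 ≤ v then φ (0, Pi.single v 1) else 0) C := by
  rw [clusterVec_eq hC, clusterWeight, map_add]
  simp only [map_sum]
  congr 1
  split_ifs
  · rfl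
  · exact map_zero φ

lemma card_offDiag_filter_lt (s : Finset ℕ) :
    #(s.offDiag.filter fun e => e.1 < e.2) = (#s).choose 2 := by
  have h1 : #(s.offDiag.filter fun e => ¬ e.1 < e.2) = #(s.offDiag.filter fun e => e.1 < e.2) := by
    refine card_bij' (fun e _ => e.swap) (fun e _ => e.swap) ?_ ?_ ?_ ?_ <;>
      · simp only [mem_filter, mem_offDiag, Prod.fst_swap, Prod.snd_swap, Prod.swap_swap]
        grind
  have h2 := card_filter_add_card_filter_not (s := s.offDiag) (fun e => e.1 < e.2)
  rw [h1, offDiag_card] at h2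
  rw [Nat.choose_two_right, Nat.mul_sub_one]
  omega

/-- `edgeSum` as a linear functional. -/
noncomputable def edgeSumLin (Z : Finset ℕ) : GPoint →ₗ[ℝ] ℝ where
  toFun := edgeSum Z
  map_add' x y := by simp [edgeSum, sum_add_distrib]
  map_smul' c x := by simp [edgeSum, mul_sum]

lemma edgeSumLin_clusterVec (Z C : Finset ℕ) :
    edgeSumLin Z (clusterVec C) = (#(C ∩ Z)).choose 2 := by
  rw [← card_offDiag_filter_lt]
  change edgeSum Z (clusterVec C) = _
  simp only [edgeSum, clusterVec, sum_boole, filter_filter]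
  congr 2
  ext e
  simp only [mem_filter, mem_offDiag, mem_inter]
  tauto

lemma edgeSumLin_charVec {n K : ℕ} (Z : Finset ℕ) (π : KPartition n K) :
    edgeSumLin Z (charVec n K π) = ∑ C ∈ π.parts, ((#(C ∩ Z)).choose 2 : ℝ) := by
  rw [charVec_eq_sum, map_sum]
  exact sum_congr rfl fun C _ => edgeSumLin_clusterVec Z C

lemma cast_choose_two (m : ℕ) : ((m.choose 2 : ℕ) : ℝ) = m * (m - 1) / 2 := by
  exact_mod_cast Nat.cast_choose_two ℝ m

lemma KPartition.sum_card_inter {n K : ℕ} {Z : Finset ℕ} (hZ : Z ⊆ Icc 1 n)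
    (π : KPartition n K) : ∑ C ∈ π.parts, (#(C ∩ Z) : ℝ) = #Z := by
  have := π.sum_sum_eq fun v => if v ∈ Z then 1 else 0
  simpa [sum_boole, filter_mem_eq_inter, inter_eq_right.2 hZ] using this

/-- The defect of a partition in the clique inequality, as a sum of nonnegative terms. -/
lemma edgeSumLin_charVec_sub {n K q r : ℕ} {Z : Finset ℕ} (hZ : Z ⊆ Icc 1 n)
    (hr : r ≤ K) (hqr : #Z = q * K + r) (π : KPartition n K) :
    edgeSumLin Z (charVec n K π) -
      ((Nat.choose (q + 1) 2 * r + Nat.choose q 2 * (K - r) : ℕ) : ℝ) =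
    ∑ C ∈ π.parts, ((#(C ∩ Z) : ℝ) - q) * (#(C ∩ Z) - (q + 1)) / 2 := by
  have h1 := π.sum_card_inter hZ
  have h2 : ∑ C ∈ π.parts, ((#(C ∩ Z) : ℝ) - q) * (#(C ∩ Z) - (q + 1)) / 2 =
      ∑ C ∈ π.parts, ((#(C ∩ Z)).choose 2 : ℝ) - q * ∑ C ∈ π.parts, (#(C ∩ Z) : ℝ)
        + ∑ C ∈ π.parts, (q * (q + 1) / 2 : ℝ) := by
    rw [mul_sum, ← sum_sub_distrib, ← sum_add_distrib]
    refine sum_congr rfl fun C _ => ?_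
    rw [cast_choose_two]
    ring
  rw [h2, h1, hqr, edgeSumLin_charVec, sum_const, π.card_parts, nsmul_eq_mul]
  push_cast [Nat.cast_sub hr, cast_choose_two]
  ring

lemma sub_mul_sub_add_one_div_two_nonneg (m q : ℕ) : 0 ≤ ((m : ℝ) - q) * (m - (q + 1)) / 2 := by
  rcases le_or_gt m q with h | h
  · have : (m : ℝ) ≤ q := by exact_mod_cast h
    nlinarith
  · have : (q : ℝ) + 1 ≤ m := by exact_mod_cast h
    nlinarith

lemma le_edgeSumLin_charVec {n K q r : ℕ} {Z : Finset ℕ} (hZ : Z ⊆ Icc 1 n)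
    (hr : r ≤ K) (hqr : #Z = q * K + r) (π : KPartition n K) :
    ((Nat.choose (q + 1) 2 * r + Nat.choose q 2 * (K - r) : ℕ) : ℝ) ≤
      edgeSumLin Z (charVec n K π) := by
  rw [← sub_nonneg, edgeSumLin_charVec_sub hZ hr hqr]
  exact sum_nonneg fun C _ => sub_mul_sub_add_one_div_two_nonneg _ _

lemma edgeSumLin_charVec_eq {n K q r : ℕ} {Z : Finset ℕ} (hZ : Z ⊆ Icc 1 n)
    (hr : r ≤ K) (hqr : #Z = q * K + r) (π : KPartition n K)
    (h : ∀ C ∈ π.parts, #(C ∩ Z) = q ∨ #(C ∩ Z) = q + 1) :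
    edgeSumLin Z (charVec n K π) =
      ((Nat.choose (q + 1) 2 * r + Nat.choose q 2 * (K - r) : ℕ) : ℝ) := by
  rw [← sub_eq_zero, edgeSumLin_charVec_sub hZ hr hqr]
  refine sum_eq_zero fun C hC => ?_
  rcases h C hC with h | h <;> rw [h] <;> push_cast <;> ring

/-- A cluster whose trace on `Z` has neither `q` nor `q + 1` elements costs at least one. -/
lemma one_le_edgeSumLin_charVec_sub {n K q r : ℕ} {Z : Finset ℕ} (hZ : Z ⊆ Icc 1 n)
    (hr : r ≤ K) (hqr : #Z = q * K + r) (π : KPartition n K) {C : Finset ℕ}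
    (hC : C ∈ π.parts) (h : #(C ∩ Z) < q ∨ q + 1 < #(C ∩ Z)) :
    1 ≤ edgeSumLin Z (charVec n K π) -
      ((Nat.choose (q + 1) 2 * r + Nat.choose q 2 * (K - r) : ℕ) : ℝ) := by
  rw [edgeSumLin_charVec_sub hZ hr hqr]
  refine le_trans ?_ (single_le_sum
    (fun D _ => sub_mul_sub_add_one_div_two_nonneg (#(D ∩ Z)) q) hC)
  rcases h with h | h
  · have : (#(C ∩ Z) : ℝ) + 1 ≤ q := by exact_mod_cast h
    nlinarith
  · have : (q : ℝ) + 1 + 1 ≤ #(C ∩ Z) := by exact_mod_cast h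
    nlinarith

lemma sum_sum_eq_of_symm_weights {V Z C : Finset ℕ} {A : ℕ → ℕ → ℝ} {α : ℝ} (hC : C ⊆ V)
    (hA : ∀ p ∈ V, ∀ q ∈ V, p ≠ q → A p q + A q p = if p ∈ Z ∧ q ∈ Z then α else 0) :
    ∑ p ∈ C, ∑ q ∈ C, A p q = ∑ p ∈ C, A p p + α * ((#(C ∩ Z)).choose 2 : ℝ) := by
  have h1 : ∑ p ∈ C, ∑ q ∈ C, A p q + ∑ p ∈ C, ∑ q ∈ C, A q p =
      ∑ p ∈ C, ∑ q ∈ C, ((if p = q then 2 * A p p - α * (if p ∈ Z then 1 else 0) else 0) +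
        α * ((if p ∈ Z then 1 else 0) * (if q ∈ Z then 1 else 0))) := by
    simp only [← sum_add_distrib]
    refine sum_congr rfl fun p hp => sum_congr rfl fun q hq => ?_
    by_cases hpq : p = q
    · subst hpq
      by_cases hpZ : p ∈ Z <;> simp [hpZ] <;> ring
    · rw [hA p (hC hp) q (hC hq) hpq]
      by_cases hpZ : p ∈ Z <;> by_cases hqZ : q ∈ Z <;> simp [hpZ, hqZ, hpq]
  have h2 : ∑ p ∈ C, (if p ∈ Z then (1 : ℝ) else 0) = #(C ∩ Z) := by
    rw [sum_boole, filter_mem_eq_inter]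
  rw [sum_comm (f := fun p q => A q p)] at h1
  simp only [sum_add_distrib, ← mul_sum, ← sum_mul, h2, Finset.sum_ite_eq] at h1
  have h3 : ∑ p ∈ C, (if p ∈ C then 2 * A p p - α * (if p ∈ Z then 1 else 0) else 0) =
      2 * ∑ p ∈ C, A p p - α * #(C ∩ Z) := by
    rw [← h2, mul_sum, mul_sum, ← sum_sub_distrib]
    exact sum_congr rfl fun p hp => if_pos hp
  rw [h3] at h1
  rw [cast_choose_two]
  linarith

/-- The linear system satisfied by weights that are constant on the tight partitions
forces them to be a multiple of the clique weights. -/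
lemma weights_of_exchange {n : ℕ} {U Z : Finset ℕ} {a : ℕ → ℕ → ℝ} {β : ℕ → ℝ}
    (hsymm : ∀ p q, a p q = a q p) (hβ : ∀ v, v ≤ 3 → β v = 0)
    (hUZ : Disjoint U Z) (hcover : U ∪ Z = Icc 1 n) (hnZ : n ∈ Z) (hZ4 : 4 ≤ #Z)
    (hU : ∃ u ∈ U, u ≤ 3)
    (e1 : ∀ w ∈ U, ∀ x ∈ Z, ∀ y ∈ Z, ∀ z ∈ Z, x ≠ y → x ≠ z → y ≠ z →
      a w x + β (min w x) - β x = a w y + a w z + β (min w (min y z)) - β (min y z))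
    (e2 : ∀ w ∈ U, ∀ t ∈ U, w ≠ t → ∀ x ∈ Z, ∀ y ∈ Z, ∀ z ∈ Z, x ≠ y → x ≠ z → y ≠ z →
      a w x + a w t + β (min w (min x t)) - β (min x t) =
        a w y + a w z + β (min w (min y z)) - β (min y z))
    (e3 : ∀ w ∈ U, ∀ t ∈ U, ∀ s ∈ U, w ≠ t → w ≠ s → t ≠ s →
      ∀ x ∈ Z, ∀ y ∈ Z, ∀ z ∈ Z, x ≠ y → x ≠ z → y ≠ z →
      a w x + a w t + a w s + β (min w (min x (min t s))) - β (min x (min t s)) =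
        a w y + a w z + β (min w (min y z)) - β (min y z))
    (e4 : ∀ w ∈ U, ∀ t ∈ U, w ≠ t → ∀ x ∈ Z, ∀ y ∈ Z, ∀ z ∈ Z, x ≠ y → x ≠ z → y ≠ z →
      a w x + β (min w x) - β x =
        a w y + a w z + a w t + β (min w (min y (min z t))) - β (min y (min z t)))
    (e5 : ∀ x ∈ Z, ∀ y ∈ Z, ∀ z ∈ Z, x ≠ y → x ≠ z → y ≠ z →
      a z x + β (min z x) - β x = a z y + β (min z y) - β y) :
    (∀ v ∈ Icc 1 n, β v = 0) ∧
    ∃ α : ℝ, ∀ p ∈ Icc 1 n, ∀ q ∈ Icc 1 n, p ≠ q →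
      a p q = if p ∈ Z ∧ q ∈ Z then α else 0 := by
  have hdisj : ∀ u ∈ U, ∀ z ∈ Z, u ≠ z := fun u hu z hz h => disjoint_left.1 hUZ hu (h ▸ hz)
  have hmem : ∀ v, 1 ≤ v → v ≤ n → v ∈ U ∨ v ∈ Z := fun v h1 h2 =>
    mem_union.1 (hcover ▸ mem_Icc.2 ⟨h1, h2⟩)
  have hle : ∀ v, v ∈ U ∨ v ∈ Z → 1 ≤ v ∧ v ≤ n := fun v hv =>
    mem_Icc.1 (hcover ▸ mem_union.2 hv)
  have hβmin : ∀ v t, v ≤ 3 ∨ t ≤ 3 → β (min v t) = 0 := fun v t h => hβ _ (by omega)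
  -- elements of `Z` avoiding up to three given ones
  have havoid : ∀ x y z : ℕ, ∃ t ∈ Z, t ≠ x ∧ t ≠ y ∧ t ≠ z := by
    intro x y z
    obtain ⟨t, ht, htn⟩ := exists_mem_notMem_of_card_lt_card
      (s := {x, y, z}) (t := Z) (by have := card_le_three (a := x) (b := y) (c := z); omega)
    simp only [mem_insert, mem_singleton, not_or] at htn
    exact ⟨t, ht, htn⟩
  -- the insertion cost `η w` does not depend on the receiving cluster
  have hη : ∀ w ∈ U, ∃ η : ℝ, (∀ z ∈ Z, a w z + β (min w z) - β z = η) ∧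
      ∀ y ∈ Z, ∀ z ∈ Z, y ≠ z →
        a w y + a w z + β (min w (min y z)) - β (min y z) = η := by
    intro w hw
    have hsingle : ∀ z ∈ Z, a w z + β (min w z) - β z = a w n + β (min w n) - β n := by
      intro z hz
      obtain ⟨y₁, hy₁, h1, h2, -⟩ := havoid z n n
      obtain ⟨y₂, hy₂, h3, h4, h5⟩ := havoid z n y₁
      rw [e1 w hw z hz y₁ hy₁ y₂ hy₂ h1.symm h3.symm h5.symm,
        e1 w hw n hnZ y₁ hy₁ y₂ hy₂ h2.symm h4.symm h5.symm]
    refine ⟨_, hsingle, fun y hy z hz hyz => ?_⟩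
    obtain ⟨x, hx, h1, h2, -⟩ := havoid y z z
    rw [← e1 w hw x hx y hy z hz h1 h2 hyz, hsingle x hx]
  choose! η hη1 hη2 using hη
  -- a further nonroot vertex `t` in the receiving cluster
  have hη3 : ∀ w ∈ U, ∀ t ∈ U, w ≠ t → ∀ x ∈ Z,
      a w x + a w t + β (min w (min x t)) - β (min x t) = η w := by
    intro w hw t ht hwt x hx
    obtain ⟨y, hy, h1, -, -⟩ := havoid x x x
    obtain ⟨z, hz, h2, h3, -⟩ := havoid x y y
    rw [e2 w hw t ht hwt x hx y hy z hz h1.symm h2.symm h3.symm, hη2 w hw y hy z hz h3.symm]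
  have hη4 : ∀ w ∈ U, ∀ t ∈ U, w ≠ t → ∀ y ∈ Z, ∀ z ∈ Z, y ≠ z →
      a w y + a w z + a w t + β (min w (min y (min z t))) - β (min y (min z t)) = η w := by
    intro w hw t ht hwt y hy z hz hyz
    obtain ⟨x, hx, h1, h2, -⟩ := havoid y z z
    rw [← e4 w hw t ht hwt x hx y hy z hz h1 h2 hyz, hη1 w hw x hx]
  have hη5 : ∀ w ∈ U, ∀ t ∈ U, ∀ s ∈ U, w ≠ t → w ≠ s → t ≠ s → ∀ x ∈ Z,
      a w x + a w t + a w s + β (min w (min x (min t s))) - β (min x (min t s)) = η w := by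
    intro w hw t ht s hs hwt hws hts x hx
    obtain ⟨y, hy, h1, -, -⟩ := havoid x x x
    obtain ⟨z, hz, h2, h3, -⟩ := havoid x y y
    rw [e3 w hw t ht s hs hwt hws hts x hx y hy z hz h1.symm h2.symm h3.symm,
      hη2 w hw y hy z hz h3.symm]
  -- the smallest nonclique vertex
  obtain ⟨u, huU, hu3, humin⟩ : ∃ u ∈ U, u ≤ 3 ∧ ∀ v ∈ U, u ≤ v := by
    obtain ⟨u', hu', hu'3⟩ := hU
    refine ⟨U.min' ⟨u', hu'⟩, min'_mem _ _, (min'_le _ _ hu').trans hu'3, fun v hv => min'_le _ _ hv⟩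
  obtain ⟨z₀, hz₀, hz₀min⟩ : ∃ z ∈ Z, ∀ v ∈ Z, z ≤ v :=
    ⟨Z.min' ⟨n, hnZ⟩, min'_mem _ _, fun v hv => min'_le _ _ hv⟩
  have hauz : ∀ z ∈ Z, a u z = η u + β z := fun z hz => by
    have := hη1 u huU z hz
    rw [hβmin u z (.inl hu3)] at this
    linarith
  have hβz : ∀ z ∈ Z, z ≠ z₀ → β z = - η u := by
    intro z hz hne
    have h := hη2 u huU z₀ hz₀ z hz hne.symm
    rw [hβmin u _ (.inl hu3), hauz z₀ hz₀, hauz z hz, min_eq_left (hz₀min z hz)] at h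
    linarith
  have hz₀n : z₀ ≠ n := by
    obtain ⟨t, ht, htn, -⟩ := havoid n n n
    have := hz₀min t ht
    have := (hle t (.inr ht)).2
    omega
  have hβn : β n = - η u := hβz n hnZ hz₀n.symm
  have hun : ∀ w ∈ U, w < n := fun w hw =>
    lt_of_le_of_ne (hle w (.inl hw)).2 (hdisj w hw n hnZ)
  -- the other nonclique vertices
  have hawz : ∀ w ∈ U, w ≠ u → ∀ z ∈ Z, a w z = 0 := by
    have hsum : ∀ w ∈ U, w ≠ u → ∀ z ∈ Z, a w z + a w u = η w := fun w hw hwu z hz => by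
      have h := hη3 w hw u huU hwu z hz
      rw [hβ (min w (min z u)) (by omega), hβ (min z u) (by omega)] at h
      linarith
    intro w hw hwu y hy
    obtain ⟨z, hz, hzy, -, -⟩ := havoid y y y
    have h := hη4 w hw u huU hwu y hy z hz hzy.symm
    rw [hβ (min w (min y (min z u))) (by omega), hβ (min y (min z u)) (by omega)] at h
    linarith [hsum w hw hwu z hz]
  have hawu : ∀ w ∈ U, w ≠ u → a w u = η w := fun w hw hwu => by
    have h := hη3 w hw u huU hwu n hnZ
    rw [hβ (min w (min n u)) (by omega), hβ (min n u) (by omega), hawz w hw hwu n hnZ] at h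
    linarith
  have haww : ∀ w ∈ U, w ≠ u → ∀ t ∈ U, t ≠ u → w ≠ t → a w t = 0 := by
    intro w hw hwu t ht htu hwt
    have h := hη5 w hw u huU t ht hwu hwt htu.symm n hnZ
    rw [hβ (min w (min n (min u t))) (by omega), hβ (min n (min u t)) (by omega),
      hawz w hw hwu n hnZ, hawu w hw hwu] at h
    linarith
  have hηw : ∀ w ∈ U, w ≠ u → ∀ z ∈ Z, β (min w z) - β z = η w := fun w hw hwu z hz => by
    have := hη1 w hw z hz
    rw [hawz w hw hwu z hz] at this
    linarith
  have hηwt : ∀ w ∈ U, w ≠ u → ∀ t ∈ U, t ≠ u → w ≠ t → ∀ z ∈ Z,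
      β (min w (min z t)) - β (min z t) = η w := fun w hw hwu t ht htu hwt z hz => by
    have := hη3 w hw t ht hwt z hz
    rw [hawz w hw hwu z hz, haww w hw hwu t ht htu hwt] at this
    linarith
  have hηβ : ∀ w ∈ U, w ≠ u → β w + η u = η w := fun w hw hwu => by
    have := hηw w hw hwu n hnZ
    rw [min_eq_left (hun w hw).le, hβn] at this
    linarith
  have hn4 : 4 ≤ n := by
    have := card_le_card (subset_union_right (s₁ := U) (s₂ := Z))
    rw [hcover, Nat.card_Icc] at this
    omega
  -- the root has cost zero
  have hηu : η u = 0 := by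
    by_cases h : ∃ z ∈ Z, z ≠ z₀ ∧ z ≤ 3
    · obtain ⟨z, hz, hne, hz3⟩ := h
      have := hβz z hz hne
      rw [hβ z hz3] at this
      linarith
    · push Not at h
      have hsmall : ∀ v, 1 ≤ v → v ≤ 3 → v ≠ z₀ → v ∈ U := fun v h1 h3 hne =>
        (hmem v h1 (by omega)).resolve_right fun hv => by have := h v hv hne; omega
      by_cases hz₀3 : z₀ ≤ 3
      · obtain ⟨w, hw1, hw3, hwz, hwu⟩ : ∃ w, 1 ≤ w ∧ w ≤ 3 ∧ w ≠ z₀ ∧ w ≠ u := by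
          by_cases h1 : 1 ≠ z₀ ∧ 1 ≠ u
          · exact ⟨1, by omega⟩
          by_cases h2 : 2 ≠ z₀ ∧ 2 ≠ u
          · exact ⟨2, by omega⟩
          · exact ⟨3, by omega⟩
        have hw := hsmall w hw1 hw3 hwz
        have h1 := hηw w hw hwu z₀ hz₀
        rw [hβ (min w z₀) (by omega), hβ z₀ hz₀3] at h1
        have h2 := hηβ w hw hwu
        rw [hβ w hw3] at h2
        linarith
      · have h1U := hsmall 1 le_rfl (by omega) (by omega)
        have h2U := hsmall 2 (by omega) (by omega) (by omega)
        have h3U := hsmall 3 (by omega) (by omega) (by omega)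
        have := humin 1 h1U
        have hu1 := (hle u (.inl huU)).1
        have h1 := hηwt 2 h2U (by omega) 3 h3U (by omega) (by omega) n hnZ
        rw [hβ (min 2 (min n 3)) (by omega), hβ (min n 3) (by omega)] at h1
        have h2 := hηβ 2 h2U (by omega)
        rw [hβ 2 (by omega)] at h2
        linarith
  have hβw : ∀ w ∈ U, w ≠ u → β w = 0 := by
    intro w hw hwu
    by_cases hwz : z₀ < w
    · have h1 := hηw w hw hwu z₀ hz₀
      rw [min_eq_right hwz.le] at h1
      linarith [hηβ w hw hwu]
    by_cases hw3 : w ≤ 3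
    · exact hβ w hw3
    have hsmall : ∀ v, 1 ≤ v → v ≤ 3 → v ∈ U := fun v h1 h3 =>
      (hmem v h1 (by omega)).resolve_right fun hv => by have := hz₀min v hv; omega
    have h2U := hsmall 2 (by omega) (by omega)
    have := humin 1 (hsmall 1 le_rfl (by omega))
    have h1 := hηwt w hw hwu 2 h2U (by omega) (by omega) n hnZ
    rw [hβ (min w (min n 2)) (by omega), hβ (min n 2) (by omega)] at h1
    linarith [hηβ w hw hwu]
  have hβZ : ∀ z ∈ Z, β z = 0 := by
    intro z hz
    by_cases hne : z ≠ z₀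
    · rw [hβz z hz hne, hηu, neg_zero]
    have hz : z = z₀ := not_not.1 hne
    subst hz
    by_cases hz3 : z ≤ 3
    · exact hβ z hz3
    have hsmall : ∀ v, 1 ≤ v → v ≤ 3 → v ∈ U := fun v h1 h3 =>
      (hmem v h1 (by omega)).resolve_right fun hv => by have := hz₀min v hv; omega
    have h2U := hsmall 2 (by omega) (by omega)
    have := humin 1 (hsmall 1 le_rfl (by omega))
    have h1 := hηw 2 h2U (by omega) z hz₀
    have h2 := hηβ 2 h2U (by omega)
    rw [hβ 2 (by omega)] at h2
    rw [hβ (min 2 z) (by omega)] at h1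
    linarith
  have hβU : ∀ w ∈ U, β w = 0 := fun w hw => by
    by_cases hwu : w = u
    · exact hwu ▸ hβ u hu3
    · exact hβw w hw hwu
  have hβV : ∀ v, v ∈ U ∨ v ∈ Z → β v = 0 := fun v hv => hv.elim (hβU v) (hβZ v)
  have hUZ0 : ∀ w ∈ U, ∀ z ∈ Z, a w z = 0 := fun w hw z hz => by
    by_cases hwu : w = u
    · rw [hwu, hauz z hz, hβZ z hz, hηu, add_zero]
    · exact hawz w hw hwu z hz
  have hwu0 : ∀ w ∈ U, w ≠ u → a w u = 0 := fun w hw hwu => by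
    rw [hawu w hw hwu, ← hηβ w hw hwu, hβU w hw, hηu, add_zero]
  have hUU0 : ∀ w ∈ U, ∀ t ∈ U, w ≠ t → a w t = 0 := fun w hw t ht hwt => by
    by_cases hwu : w = u
    · rw [hsymm, hwu]
      exact hwu0 t ht (hwu ▸ hwt.symm)
    by_cases htu : t = u
    · rw [htu]
      exact hwu0 w hw hwu
    · exact haww w hw hwu t ht htu hwt
  -- all clique edges have the same weight
  have hstep : ∀ x ∈ Z, ∀ y ∈ Z, ∀ z ∈ Z, x ≠ z → y ≠ z → a z x = a z y := by
    intro x hx y hy z hz hxz hyz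
    by_cases hxy : x = y
    · rw [hxy]
    have h := e5 x hx y hy z hz hxy hxz hyz
    have hmin : ∀ t ∈ Z, β (min z t) = 0 := fun t ht => by
      rcases min_choice z t with h | h <;> rw [h]
      exacts [hβZ z hz, hβZ t ht]
    rw [hmin x hx, hmin y hy, hβZ x hx, hβZ y hy] at h
    linarith
  refine ⟨fun v hv => hβV v (mem_union.1 (hcover ▸ hv)), a z₀ n, fun p hp q hq hpq => ?_⟩
  rw [← hcover, mem_union] at hp hq
  split_ifs with hZZ
  · obtain ⟨hpZ, hqZ⟩ := hZZ
    obtain ⟨t, ht, htp, htn, htz⟩ := havoid p n z₀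
    rw [hstep q hqZ t ht p hpZ hpq.symm htp, hsymm p t,
      hstep p hpZ n hnZ t ht htp.symm htn.symm, hsymm t n,
      hstep t ht z₀ hz₀ n hnZ htn hz₀n, hsymm n z₀]
  · rcases hp with hp | hp <;> rcases hq with hq | hq
    · exact hUU0 p hp q hq hpq
    · exact hUZ0 p hp q hq
    · rw [hsymm]
      exact hUZ0 q hq p hp
    · exact absurd ⟨hp, hq⟩ hZZ

lemma exists_finpartition_card_inter (Z T : Finset ℕ) {k : ℕ} (hk : 1 ≤ k)
    (h1 : k ≤ #(T ∩ Z)) (h2 : #(T ∩ Z) ≤ 2 * k) :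
    ∃ P : Finpartition T, #P.parts = k ∧ ∀ C ∈ P.parts, #(C ∩ Z) = 1 ∨ #(C ∩ Z) = 2 := by
  induction k, hk using Nat.le_induction generalizing T with
  | base =>
    have hT : T ≠ ⊥ := by
      rintro rfl
      simp at h1
    refine ⟨Finpartition.indiscrete hT, by simp, fun C hC => ?_⟩
    have hC : C = T := by simpa using hC
    subst hC
    omega
  | succ k hk ih =>
    obtain ⟨D, hD, hDc, hDk⟩ : ∃ D ⊆ T ∩ Z, (#D = 1 ∨ #D = 2) ∧
        k ≤ #(T ∩ Z) - #D ∧ #(T ∩ Z) - #D ≤ 2 * k := by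
      by_cases h : #(T ∩ Z) ≤ 2 * k + 1
      · obtain ⟨D, hD, hc⟩ := exists_subset_card_eq (s := T ∩ Z) (n := 1) (by omega)
        exact ⟨D, hD, by omega⟩
      · obtain ⟨D, hD, hc⟩ := exists_subset_card_eq (s := T ∩ Z) (n := 2) (by omega)
        exact ⟨D, hD, by omega⟩
    have hDT : D ⊆ T := hD.trans inter_subset_left
    have hDZ : D ∩ Z = D := inter_eq_left.2 (hD.trans inter_subset_right)
    have hcard : #((T \ D) ∩ Z) = #(T ∩ Z) - #D := by
      have : (T \ D) ∩ Z = (T ∩ Z) \ D := by grind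
      rw [this, card_sdiff_of_subset hD]
    obtain ⟨P, hP, hPC⟩ := ih (T \ D) (by omega) (by omega)
    have hD0 : D ≠ ⊥ := by
      rintro rfl
      simp at hDc
    refine ⟨P.extend hD0 sdiff_disjoint (sdiff_union_of_subset hDT), ?_, fun C hC => ?_⟩
    · rw [Finpartition.card_extend, hP]
    · rcases mem_insert.1 hC with rfl | hC
      · rwa [hDZ]
      · exact hPC C hC

lemma exists_kPartition_extend {n K : ℕ} {T C D : Finset ℕ} (P : Finpartition T)
    (hP : #P.parts + 2 = K) (hC : C.Nonempty) (hD : D.Nonempty) (hTD : Disjoint T D)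
    (hTC : Disjoint T C) (hDC : Disjoint D C) (hcover : T ∪ D ∪ C = Icc 1 n) :
    ∃ π : KPartition n K, π.parts = insert C (insert D P.parts) ∧
      ∀ f : Finset ℕ → ℝ, ∑ X ∈ π.parts, f X = f C + f D + ∑ X ∈ P.parts, f X := by
  have hD' : D ∉ P.parts := fun h =>
    hD.ne_empty (disjoint_self.1 (hTD.mono_left (P.le h)))
  have hC' : C ∉ insert D P.parts := by
    rw [mem_insert, not_or]
    refine ⟨fun h => ?_, fun h => hC.ne_empty (disjoint_self.1 (hTC.mono_left (P.le h)))⟩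
    subst h
    exact hC.ne_empty (disjoint_self.1 hDC)
  let Q := P.extend (b := D) (c := T ∪ D) hD.ne_empty hTD rfl
  let R := Q.extend (b := C) (c := Icc 1 n) hC.ne_empty (disjoint_union_left.2 ⟨hTC, hDC⟩) hcover
  refine ⟨KPartition.ofFinpartition R ?_, rfl, fun f => ?_⟩
  · rw [Finpartition.card_extend, Finpartition.card_extend, ← hP]
  · change ∑ X ∈ insert C (insert D P.parts), f X = _
    rw [sum_insert hC', sum_insert hD', add_assoc]

/-- The partition with singletons `S`, one cluster `A`, and one cluster with the rest. -/
lemma exists_kPartition_singletons {n K : ℕ} {S A : Finset ℕ} (hS : S ⊆ Icc 1 n)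
    (hA : A ⊆ Icc 1 n) (hSA : Disjoint S A) (hAne : A.Nonempty)
    (hR : (Icc 1 n \ (S ∪ A)).Nonempty) (hSK : #S + 2 = K) :
    ∃ π : KPartition n K,
      (A ∈ π.parts ∧ Icc 1 n \ (S ∪ A) ∈ π.parts ∧ ∀ s ∈ S, {s} ∈ π.parts) ∧
      ∀ f : Finset ℕ → ℝ, ∑ X ∈ π.parts, f X =
        f A + f (Icc 1 n \ (S ∪ A)) + ∑ X ∈ (⊥ : Finpartition S).parts, f X := by
  obtain ⟨π, hπ, hf⟩ := exists_kPartition_extend (n := n) (K := K) (C := A)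
    (D := Icc 1 n \ (S ∪ A)) (⊥ : Finpartition S) (by rw [Finpartition.card_bot, hSK]) hAne hR
    (disjoint_sdiff.mono_left subset_union_left) hSA
    (sdiff_disjoint.mono_right subset_union_right) (by
      rw [union_right_comm, union_sdiff_of_subset (union_subset hS hA)])
  refine ⟨π, ?_, hf⟩
  rw [hπ]
  refine ⟨by simp, by simp, fun s hs => ?_⟩
  exact mem_insert_of_mem (mem_insert_of_mem (Finpartition.mem_bot_iff.2 ⟨s, hs, rfl⟩))

/-- Two partitions with common singletons on which `edgeSum` differs. -/
lemma exists_kPartition_edgeSumLin_ne {n K : ℕ} {S Z : Finset ℕ} {a t b₁ b₂ : ℕ}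
    (hZ : Z ⊆ Icc 1 n) (hS : S ⊆ Icc 1 n) (hSK : #S + 2 = K)
    (ha : a ∈ Z) (ht : t ∈ Z) (hb₁ : b₁ ∈ Z) (hb₂ : b₂ ∈ Z)
    (haS : a ∉ S) (htS : t ∉ S) (hb₁S : b₁ ∉ S) (hb₂S : b₂ ∉ S)
    (hat : a ≠ t) (hb₁a : b₁ ≠ a) (hb₁t : b₁ ≠ t) (hb₂a : b₂ ≠ a) (hb₂t : b₂ ≠ t)
    (hb : b₁ ≠ b₂) :
    ∃ π₁ π₂ : KPartition n K, edgeSumLin Z (charVec n K π₁) ≠ edgeSumLin Z (charVec n K π₂) ∧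
      ({a} ∈ π₁.parts ∧ ∀ s ∈ S, {s} ∈ π₁.parts) ∧
      ({a, t} ∈ π₂.parts ∧ ∀ s ∈ S, {s} ∈ π₂.parts) := by
  obtain ⟨π₁, ⟨h1, -, h1S⟩, hf1⟩ := exists_kPartition_singletons (n := n) (A := {a}) hS
    (by simpa using hZ ha) (by simpa using haS) (by simp)
    ⟨b₁, by simp [mem_Icc.1 (hZ hb₁), hb₁S, hb₁a]⟩ hSK
  obtain ⟨π₂, ⟨h2, -, h2S⟩, hf2⟩ := exists_kPartition_singletons (n := n) (A := {a, t}) hS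
    (by simpa [insert_subset_iff] using ⟨mem_Icc.1 (hZ ha), mem_Icc.1 (hZ ht)⟩)
    (by simp [haS, htS]) (by simp)
    ⟨b₁, by simp [mem_Icc.1 (hZ hb₁), hb₁S, hb₁a, hb₁t]⟩ hSK
  refine ⟨π₁, π₂, ?_, ⟨h1, h1S⟩, ⟨h2, h2S⟩⟩
  rw [edgeSumLin_charVec, edgeSumLin_charVec, hf1, hf2]
  set B := Icc 1 n \ (S ∪ {a, t}) with hB
  have hB1 : Icc 1 n \ (S ∪ {a}) = insert t B := by
    ext v
    simp only [hB, mem_insert, mem_sdiff, mem_union, mem_singleton]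
    have := hZ ht
    grind
  have htB : t ∉ B ∩ Z := by simp [hB]
  have hm : 2 ≤ #(B ∩ Z) := by
    rw [← card_pair hb]
    refine card_le_card ?_
    simp [insert_subset_iff, hB, mem_Icc.1 (hZ hb₁), mem_Icc.1 (hZ hb₂), hb₁, hb₂, hb₁S, hb₂S,
      hb₁a, hb₁t, hb₂a, hb₂t]
  rw [hB1, insert_inter_of_mem ht, card_insert_of_notMem htB, singleton_inter_of_mem ha,
    insert_inter_of_mem ha, singleton_inter_of_mem ht, card_pair hat, card_singleton]
  intro h
  have h' := add_right_cancel h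
  simp only [cast_choose_two] at h'
  push_cast at h'
  have hm' : (2 : ℝ) ≤ #(B ∩ Z) := by exact_mod_cast hm
  linarith

section Necessity

variable {n K q r : ℕ} {Z : Finset ℕ}

lemma not_isFacetGe_of_isolated_last (hn : 5 ≤ n) (hK1 : 3 ≤ K) (hK2 : K ≤ n - 2)
    (hZ : Z ⊆ Icc 1 n) (hZK : K + 1 ≤ #Z) (hq : 1 ≤ q) (hr : r ≤ K - 1) (hqr : #Z = q * K + r)
    (h : n ∉ Z ∨ 2 * K ≤ #Z) :
    ¬ IsFacetGe n K (edgeSumLin Z)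
        ((Nat.choose (q + 1) 2 * r + Nat.choose q 2 * (K - r) : ℕ) : ℝ) := by
  intro hfac
  have hrK : r ≤ K := by omega
  let g : GPoint →ₗ[ℝ] ℝ := (LinearMap.proj n).comp (LinearMap.snd ℝ _ _)
  have hg1 : ∀ π : KPartition n K, {n} ∈ π.parts → g (charVec n K π) = 1 := fun π hπ => by
    refine if_pos ⟨by omega, {n}, hπ, by simp, by simp⟩
  have hg0 : ∀ π : KPartition n K, {n} ∉ π.parts → g (charVec n K π) = 0 := fun π hπ => by
    refine if_neg ?_
    rintro ⟨-, C, hC, hnC, hle⟩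
    refine hπ ?_
    rwa [← eq_singleton_iff_unique_mem.2 ⟨hnC, fun w hw =>
      le_antisymm (mem_Icc.1 (π.subset_Icc hC hw)).2 (hle w hw)⟩]
  have h0 : ∀ π : KPartition n K, 0 ≤ g (charVec n K π) := fun π => by
    by_cases hπ : {n} ∈ π.parts
    · rw [hg1 π hπ]; exact zero_le_one
    · rw [hg0 π hπ]
  have h1 : ∀ π : KPartition n K, g (charVec n K π) - 0 ≤ edgeSumLin Z (charVec n K π) -
      ((Nat.choose (q + 1) 2 * r + Nat.choose q 2 * (K - r) : ℕ) : ℝ) := fun π => by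
    by_cases hπ : {n} ∈ π.parts
    · rw [hg1 π hπ, sub_zero]
      refine one_le_edgeSumLin_charVec_sub hZ hrK hqr π hπ (.inl ?_)
      by_cases hnZ : n ∈ Z
      · rw [singleton_inter_of_mem hnZ, card_singleton]
        have h2 := h.resolve_left (not_not.2 hnZ)
        by_contra hq2
        have : q = 1 := by omega
        subst this
        omega
      · rw [singleton_inter_of_notMem hnZ, card_empty]
        omega
    · rw [hg0 π hπ, sub_zero, sub_nonneg]
      exact le_edgeSumLin_charVec hZ hrK hqr π
  have hcard : 4 ≤ #(Z.erase n) := by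
    by_cases hnZ : n ∈ Z
    · have h2 := h.resolve_left (not_not.2 hnZ)
      rw [card_erase_of_mem hnZ]
      omega
    · rw [erase_eq_of_notMem hnZ]
      omega
  obtain ⟨T, hT, hTc⟩ := exists_subset_card_eq hcard
  have hnT : n ∉ T := fun h => by simpa using hT h
  have hTZ : T ⊆ Z := hT.trans (erase_subset _ _)
  have hnV : n ∈ Icc 1 n := by simp; omega
  obtain ⟨S, hnS, hS, hSc⟩ := exists_subsuperset_card_eq (n := K - 2)
    (s := {n}) (t := Icc 1 n \ T) (by simpa using ⟨by omega, hnT⟩)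
    (by rw [card_singleton]; omega)
    (by
      rw [card_sdiff_of_subset (hTZ.trans hZ), Nat.card_Icc, hTc]
      omega)
  have hTS : ∀ v ∈ T, v ∉ S := fun v hv hvS => (mem_sdiff.1 (hS hvS)).2 hv
  obtain ⟨a, t, b₁, b₂, hat, hab₁, hab₂, htb₁, htb₂, hb, rfl⟩ := card_eq_four.1 hTc
  obtain ⟨π₁, π₂, hne, ⟨-, h1S⟩, ⟨-, h2S⟩⟩ := exists_kPartition_edgeSumLin_ne (K := K) (S := S) hZ
    (hS.trans sdiff_subset) (by omega) (a := a) (t := t) (b₁ := b₁) (b₂ := b₂)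
    (hTZ (by simp)) (hTZ (by simp)) (hTZ (by simp)) (hTZ (by simp))
    (hTS _ (by simp)) (hTS _ (by simp)) (hTS _ (by simp)) (hTS _ (by simp))
    hat hab₁.symm htb₁.symm hab₂.symm htb₂.symm hb
  obtain ⟨π₃, ⟨-, h3, -⟩, -⟩ := exists_kPartition_singletons (n := n) (K := K)
    (S := Icc 1 (K - 2)) (A := {K - 1})
    (Icc_subset_Icc le_rfl (by omega)) (by simp; omega) (by simp; omega) (by simp)
    ⟨n, by simp; omega⟩ (by rw [Nat.card_Icc]; omega)
  have hn3 : {n} ∉ π₃.parts := fun hn => by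
    have h := π₃.eq_of_mem hn h3 (v := n) (by simp) (by simp; omega)
    have hK : K ∈ ({n} : Finset ℕ) := by
      rw [h]
      simp
      omega
    rw [mem_singleton] at hK
    omega
  have key := mul_sub_eq_mul_sub_of_facet hfac h0 h1 π₁ π₂ π₁ π₃
  rw [hg1 π₁ (h1S n (hnS (by simp))), hg1 π₂ (h2S n (hnS (by simp))), hg0 π₃ hn3] at key
  simp only [sub_self, mul_zero, sub_zero, mul_one] at key
  exact hne (sub_eq_zero.1 key)

lemma not_isFacetGe_of_three_mem (hn : 5 ≤ n) (hK1 : 3 ≤ K) (hK2 : K ≤ n - 2)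
    (hZ : Z ⊆ Icc 1 n) (hr : r ≤ K - 1) (hqr : #Z = q * K + r)
    (hq : q = 1) (hnZ : n ∈ Z) (h123 : 1 ∈ Z ∧ 2 ∈ Z ∧ 3 ∈ Z) :
    ¬ IsFacetGe n K (edgeSumLin Z)
        ((Nat.choose (q + 1) 2 * r + Nat.choose q 2 * (K - r) : ℕ) : ℝ) := by
  intro hfac
  have hrK : r ≤ K := by omega
  let e : ℕ × ℕ → GPoint →ₗ[ℝ] ℝ := fun p => (LinearMap.proj p).comp (LinearMap.fst ℝ _ _)
  let s : ℕ → GPoint →ₗ[ℝ] ℝ := fun v => (LinearMap.proj v).comp (LinearMap.snd ℝ _ _)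
  let g : GPoint →ₗ[ℝ] ℝ := e (1, 2) + e (1, 3) + e (2, 3) - ∑ v ∈ Icc 1 n, s v
  have hgC : ∀ C : Finset ℕ, C ⊆ Icc 1 n → C.Nonempty → g (clusterVec C) =
      (if 1 ∈ C then 1 else 0) + (if 2 ∈ C then 1 else 0) + (if 3 ∈ C then 1 else 0) - 1 +
        (if 1 ∈ C ∧ 2 ∈ C ∧ 3 ∈ C then 1 else 0) := by
    intro C hC hCne
    obtain ⟨m, hm, hmin⟩ : ∃ m ∈ C, ∀ w ∈ C, m ≤ w :=
      ⟨C.min' hCne, min'_mem _ _, fun w hw => min'_le _ _ hw⟩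
    have hs : ∑ v ∈ Icc 1 n, s v (clusterVec C) = if 4 ≤ m then 1 else 0 := by
      have hrep : ∀ v, (4 ≤ v ∧ v ∈ C ∧ ∀ w ∈ C, v ≤ w) ↔ v = m ∧ 4 ≤ m := by
        intro v
        constructor
        · rintro ⟨h4, hv, hle⟩
          have := le_antisymm (hle m hm) (hmin v hv)
          omega
        · rintro ⟨rfl, h4⟩
          exact ⟨h4, hm, hmin⟩
      simp only [s, LinearMap.comp_apply, LinearMap.snd_apply, LinearMap.proj_apply, clusterVec,
        hrep, ite_and, Finset.sum_ite_eq', hC hm, if_true]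
    have hm4 : 4 ≤ m ↔ 1 ∉ C ∧ 2 ∉ C ∧ 3 ∉ C := by
      constructor
      · intro h
        refine ⟨fun h' => ?_, fun h' => ?_, fun h' => ?_⟩ <;>
          · have := hmin _ h'
            omega
      · rintro ⟨h1, h2, h3⟩
        by_contra h
        obtain ⟨hm1, -⟩ := mem_Icc.1 (hC hm)
        interval_cases m <;> contradiction
    have hg : g (clusterVec C) = (if 1 ∈ C ∧ 2 ∈ C then 1 else 0) +
        (if 1 ∈ C ∧ 3 ∈ C then 1 else 0) + (if 2 ∈ C ∧ 3 ∈ C then 1 else 0) -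
        if 4 ≤ m then 1 else 0 := by
      rw [← hs]
      simp only [g, LinearMap.sub_apply, LinearMap.add_apply, LinearMap.sum_apply]
      rfl
    rw [hg]
    simp only [hm4]
    by_cases h1 : 1 ∈ C <;> by_cases h2 : 2 ∈ C <;> by_cases h3 : 3 ∈ C <;>
      simp [h1, h2, h3]
  have hmemV : ∀ v ∈ Z, ∀ π : KPartition n K,
      ∑ C ∈ π.parts, (if v ∈ C then (1 : ℝ) else 0) = 1 := fun v hv π => by
    rw [π.sum_ite_eq (fun C => v ∈ C) (v := v) fun _ _ h => h,
      if_pos (π.exists_mem_parts (hZ hv))]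
  have hg : ∀ π : KPartition n K, g (charVec n K π) = 3 - (K : ℝ) +
      ∑ C ∈ π.parts, (if 1 ∈ C ∧ 2 ∈ C ∧ 3 ∈ C then (1 : ℝ) else 0) := fun π => by
    rw [charVec_eq_sum, map_sum,
      sum_congr rfl fun C hC => hgC C (π.subset_Icc hC) (π.parts_nonempty C hC)]
    simp only [sum_add_distrib, sum_sub_distrib, hmemV 1 h123.1, hmemV 2 h123.2.1,
      hmemV 3 h123.2.2, sum_const, π.card_parts, nsmul_eq_mul]
    ring
  have hg1 : ∀ π : KPartition n K, (∃ C ∈ π.parts, 1 ∈ C ∧ 2 ∈ C ∧ 3 ∈ C) →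
      g (charVec n K π) = 3 - (K : ℝ) + 1 := fun π hπ => by
    rw [hg, π.sum_ite_eq (fun C => 1 ∈ C ∧ 2 ∈ C ∧ 3 ∈ C) (v := 1) fun _ _ h => h.1, if_pos hπ]
  have hg0 : ∀ π : KPartition n K, (¬ ∃ C ∈ π.parts, 1 ∈ C ∧ 2 ∈ C ∧ 3 ∈ C) →
      g (charVec n K π) = 3 - (K : ℝ) := fun π hπ => by
    rw [hg, π.sum_ite_eq (fun C => 1 ∈ C ∧ 2 ∈ C ∧ 3 ∈ C) (v := 1) fun _ _ h => h.1, if_neg hπ,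
      add_zero]
  have h0 : ∀ π : KPartition n K, 3 - (K : ℝ) ≤ g (charVec n K π) := fun π => by
    rw [hg]
    exact le_add_of_nonneg_right (sum_nonneg fun C _ => by split_ifs <;> norm_num)
  have h1 : ∀ π : KPartition n K, g (charVec n K π) - (3 - (K : ℝ)) ≤
      edgeSumLin Z (charVec n K π) -
      ((Nat.choose (q + 1) 2 * r + Nat.choose q 2 * (K - r) : ℕ) : ℝ) := fun π => by
    by_cases hπ : ∃ C ∈ π.parts, 1 ∈ C ∧ 2 ∈ C ∧ 3 ∈ C
    · rw [hg1 π hπ, add_sub_cancel_left]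
      obtain ⟨C, hC, h1C, h2C, h3C⟩ := hπ
      refine one_le_edgeSumLin_charVec_sub hZ hrK hqr π hC (.inr ?_)
      have : #({1, 2, 3} : Finset ℕ) ≤ #(C ∩ Z) := card_le_card (by
        simp [insert_subset_iff, h1C, h2C, h3C, h123])
      have h3 : #({1, 2, 3} : Finset ℕ) = 3 := rfl
      omega
    · rw [hg0 π hπ, sub_self, sub_nonneg]
      exact le_edgeSumLin_charVec hZ hrK hqr π
  have hsub : ({1, 2, 3, n} : Finset ℕ) ⊆ Icc 1 n := by
    simp [insert_subset_iff]
    omega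
  obtain ⟨S, hS, hSc⟩ := exists_subset_card_eq (s := Icc 1 n \ {1, 2, 3, n}) (n := K - 2) (by
    rw [card_sdiff_of_subset hsub, Nat.card_Icc]
    have := card_le_four (a := 1) (b := 2) (c := 3) (d := n)
    omega)
  have hnotS : ∀ v ∈ ({1, 2, 3, n} : Finset ℕ), v ∉ S := fun v hv hvS =>
    (mem_sdiff.1 (hS hvS)).2 hv
  have hSV : S ⊆ Icc 1 n := hS.trans sdiff_subset
  obtain ⟨π₁, π₂, hne, ⟨hp1, -⟩, ⟨hp2, -⟩⟩ := exists_kPartition_edgeSumLin_ne (K := K) hZ hSV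
    (by omega) h123.2.2 hnZ h123.1 h123.2.1
    (hnotS _ (by simp)) (hnotS _ (by simp)) (hnotS _ (by simp)) (hnotS _ (by simp))
    (by omega) (by omega) (by omega) (by omega) (by omega) (by omega)
  have hR : ∀ v, 1 ≤ v → v ≤ 3 → v ∈ Icc 1 n \ (S ∪ {n}) := fun v h1 h3 => by
    have := hnotS v (by simp; omega)
    simp only [mem_sdiff, mem_Icc, mem_union, mem_singleton, not_or]
    exact ⟨by omega, this, by omega⟩
  obtain ⟨π₃, ⟨-, hp3, -⟩, -⟩ := exists_kPartition_singletons (n := n) (K := K)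
    (S := S) (A := {n}) hSV (by simp; omega) (by simpa using hnotS n (by simp)) (by simp)
    ⟨1, hR 1 le_rfl (by omega)⟩ (by omega)
  have h10 : ¬ ∃ C ∈ π₁.parts, 1 ∈ C ∧ 2 ∈ C ∧ 3 ∈ C := by
    rintro ⟨C, hC, h1, -, h3⟩
    rw [π₁.eq_of_mem hC hp1 h3 (by simp)] at h1
    simp at h1
  have h20 : ¬ ∃ C ∈ π₂.parts, 1 ∈ C ∧ 2 ∈ C ∧ 3 ∈ C := by
    rintro ⟨C, hC, h1, -, h3⟩
    rw [π₂.eq_of_mem hC hp2 h3 (by simp)] at h1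
    simp at h1
    omega
  have key := mul_sub_eq_mul_sub_of_facet hfac h0 h1 π₁ π₂ π₁ π₃
  rw [hg0 π₁ h10, hg0 π₂ h20, hg1 π₃ ⟨_, hp3, hR 1 le_rfl (by omega), hR 2 (by omega) (by omega),
    hR 3 (by omega) le_rfl⟩] at key
  simp only [sub_self, mul_zero] at key
  have := (mul_eq_zero.1 key).resolve_right (by linarith)
  exact hne (sub_eq_zero.1 this)

end Necessity

lemma clusterWeight_insert {A : ℕ → ℕ → ℝ} {β : ℕ → ℝ} {w : ℕ} {C : Finset ℕ} (hw : w ∉ C)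
    (hC : C.Nonempty) :
    clusterWeight A β (insert w C) = clusterWeight A β C + A w w +
      (∑ c ∈ C, (A w c + A c w) + β (min w (sInf (C : Set ℕ))) - β (sInf (C : Set ℕ))) := by
  simp only [clusterWeight]
  rw [coe_insert, csInf_insert (OrderBot.bddBelow _) (coe_nonempty.2 hC), sum_insert hw,
    sum_insert hw]
  simp only [sum_insert hw, sum_add_distrib]
  change _ + β (min w (sInf (C : Set ℕ))) = _
  ring

lemma sInf_coe_insert (a : ℕ) {C : Finset ℕ} (hC : C.Nonempty) :
    sInf ((insert a C : Finset ℕ) : Set ℕ) = min a (sInf (C : Set ℕ)) := by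
  rw [coe_insert, csInf_insert (OrderBot.bddBelow _) (coe_nonempty.2 hC)]

section Sufficiency

variable {n K q r : ℕ} {Z : Finset ℕ}

/-- Inserting a vertex into either of two clusters of a tight partition costs the same. -/
lemma insertion_cost_eq (hK1 : 3 ≤ K) (hZ : Z ⊆ Icc 1 n) (hZK : K + 1 ≤ #Z)
    (hZK' : #Z ≤ 2 * K - 1) {φ : GPoint →ₗ[ℝ] ℝ}
    (hφ : ∀ π ρ : KPartition n K, (∀ C ∈ π.parts, #(C ∩ Z) = 1 ∨ #(C ∩ Z) = 2) →
      (∀ C ∈ ρ.parts, #(C ∩ Z) = 1 ∨ #(C ∩ Z) = 2) →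
      φ (charVec n K π) = φ (charVec n K ρ))
    {A : ℕ → ℕ → ℝ} {β : ℕ → ℝ}
    (hA : ∀ C : Finset ℕ, C.Nonempty → φ (clusterVec C) = clusterWeight A β C)
    {w : ℕ} {C D : Finset ℕ} (hw : w ∈ Icc 1 n) (hCV : C ⊆ Icc 1 n) (hDV : D ⊆ Icc 1 n)
    (hwC : w ∉ C) (hwD : w ∉ D) (hCD : Disjoint C D)
    (hC : #(C ∩ Z) = 1 ∨ #(C ∩ Z) = 2) (hD : #(D ∩ Z) = 1 ∨ #(D ∩ Z) = 2)
    (hC' : #(insert w C ∩ Z) = 1 ∨ #(insert w C ∩ Z) = 2)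
    (hD' : #(insert w D ∩ Z) = 1 ∨ #(insert w D ∩ Z) = 2)
    (h3 : #(insert w (C ∪ D) ∩ Z) = 3) :
    ∑ c ∈ C, (A w c + A c w) + β (min w (sInf (C : Set ℕ))) - β (sInf (C : Set ℕ)) =
      ∑ c ∈ D, (A w c + A c w) + β (min w (sInf (D : Set ℕ))) - β (sInf (D : Set ℕ)) := by
  have hne : ∀ X : Finset ℕ, #(X ∩ Z) = 1 ∨ #(X ∩ Z) = 2 → X.Nonempty := by
    rintro X hX
    rw [nonempty_iff_ne_empty]
    rintro rfl
    simp at hX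
  have hT : #((Icc 1 n \ insert w (C ∪ D)) ∩ Z) = #Z - 3 := by
    have h : (Icc 1 n \ insert w (C ∪ D)) ∩ Z = Z \ (insert w (C ∪ D) ∩ Z) := by
      ext v
      have := @hZ v
      simp only [mem_inter, mem_sdiff]
      tauto
    rw [h, card_sdiff_of_subset inter_subset_right, h3]
  obtain ⟨P, hP, hPt⟩ := exists_finpartition_card_inter Z (Icc 1 n \ insert w (C ∪ D))
    (k := K - 2) (by omega) (by omega) (by omega)
  have hext : ∀ X Y : Finset ℕ, Disjoint X Y → X ∪ Y = insert w (C ∪ D) →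
      (#(X ∩ Z) = 1 ∨ #(X ∩ Z) = 2) → (#(Y ∩ Z) = 1 ∨ #(Y ∩ Z) = 2) →
      ∃ π : KPartition n K, (∀ B ∈ π.parts, #(B ∩ Z) = 1 ∨ #(B ∩ Z) = 2) ∧
        φ (charVec n K π) = clusterWeight A β X + clusterWeight A β Y +
          ∑ B ∈ P.parts, φ (clusterVec B) := by
    intro X Y hXY hu hX hY
    have hXu : X ⊆ insert w (C ∪ D) := hu ▸ subset_union_left
    have hYu : Y ⊆ insert w (C ∪ D) := hu ▸ subset_union_right
    obtain ⟨π, hπ, hf⟩ := exists_kPartition_extend (n := n) (K := K) (C := X) (D := Y) P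
      (by omega) (hne X hX) (hne Y hY) (sdiff_disjoint.mono_right hYu)
      (sdiff_disjoint.mono_right hXu) hXY.symm (by
        rw [union_assoc, union_comm Y, hu, sdiff_union_of_subset]
        exact insert_subset hw (union_subset hCV hDV))
    refine ⟨π, fun B hB => ?_, ?_⟩
    · rw [hπ, mem_insert, mem_insert] at hB
      rcases hB with rfl | rfl | hB
      exacts [hX, hY, hPt B hB]
    · rw [charVec_eq_sum, map_sum, hf fun B => φ (clusterVec B), hA X (hne X hX), hA Y (hne Y hY)]
  obtain ⟨π, hπ, hπφ⟩ := hext (insert w C) D (disjoint_insert_left.2 ⟨hwD, hCD⟩)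
    (insert_union w C D) hC' hD
  obtain ⟨ρ, hρ, hρφ⟩ := hext C (insert w D) (disjoint_insert_right.2 ⟨hwC, hCD⟩)
    (union_insert w C D) hC hD'
  have h := hφ π ρ hπ hρ
  rw [hπφ, hρφ, clusterWeight_insert hwC (hne C hC), clusterWeight_insert hwD (hne D hD)] at h
  linarith

lemma isFacetGe_edgeSumLin (hK1 : 3 ≤ K) (hK2 : K ≤ n - 2)
    (hZ : Z ⊆ Icc 1 n) (hZK : K + 1 ≤ #Z) (hr : r ≤ K - 1) (hqr : #Z = q * K + r) (hq : q = 1)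
    (hZK' : #Z ≤ 2 * K - 1) (hnZ : n ∈ Z) (hU : ∃ u ∈ Icc 1 n \ Z, u ≤ 3) :
    IsFacetGe n K (edgeSumLin Z)
        ((Nat.choose (q + 1) 2 * r + Nat.choose q 2 * (K - r) : ℕ) : ℝ) := by
  have hrK : r ≤ K := by omega
  -- two partitions on which the functional differs
  obtain ⟨T, hT, hTc⟩ := exists_subset_card_eq (s := Z) (n := 4) (by omega)
  obtain ⟨S, hS, hSc⟩ := exists_subset_card_eq (s := Icc 1 n \ T) (n := K - 2) (by
    rw [card_sdiff_of_subset (hT.trans hZ), Nat.card_Icc]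
    omega)
  have hTS : ∀ v ∈ T, v ∉ S := fun v hv hvS => (mem_sdiff.1 (hS hvS)).2 hv
  obtain ⟨a, t, b₁, b₂, hat, hab₁, hab₂, htb₁, htb₂, hb, rfl⟩ := card_eq_four.1 hTc
  obtain ⟨π₁, π₂, hne, -, -⟩ := exists_kPartition_edgeSumLin_ne (K := K) (S := S) hZ
    (hS.trans sdiff_subset) (by omega) (a := a) (t := t) (b₁ := b₁) (b₂ := b₂)
    (hT (by simp)) (hT (by simp)) (hT (by simp)) (hT (by simp))
    (hTS _ (by simp)) (hTS _ (by simp)) (hTS _ (by simp)) (hTS _ (by simp))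
    hat hab₁.symm htb₁.symm hab₂.symm htb₂.symm hb
  refine isFacetGe_of_forall_dual (fun π => le_edgeSumLin_charVec hZ hrK hqr π) hne fun φ hφ => ?_
  have htight : ∀ π ρ : KPartition n K, (∀ C ∈ π.parts, #(C ∩ Z) = 1 ∨ #(C ∩ Z) = 2) →
      (∀ C ∈ ρ.parts, #(C ∩ Z) = 1 ∨ #(C ∩ Z) = 2) →
      φ (charVec n K π) = φ (charVec n K ρ) := by
    subst hq
    exact fun π ρ hπ hρ => hφ π ρ (edgeSumLin_charVec_eq hZ hrK hqr π hπ)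
      (edgeSumLin_charVec_eq hZ hrK hqr ρ hρ)
  obtain ⟨A, β, hβ, hA⟩ : ∃ (A : ℕ → ℕ → ℝ) (β : ℕ → ℝ), (∀ v, v ≤ 3 → β v = 0) ∧
      ∀ C : Finset ℕ, C.Nonempty → φ (clusterVec C) = clusterWeight A β C :=
    ⟨_, _, fun v hv => if_neg (by omega), fun C hC => apply_clusterVec φ hC⟩
  have hcost := fun w C D => insertion_cost_eq hK1 hZ hZK hZK' htight hA (w := w) (C := C) (D := D)
  have hdisj : ∀ u ∈ Icc 1 n \ Z, ∀ z ∈ Z, u ≠ z := fun u hu z hz h =>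
    (mem_sdiff.1 hu).2 (h ▸ hz)
  have hUn : ∀ u ∈ Icc 1 n \ Z, u ∉ Z := fun u hu => (mem_sdiff.1 hu).2
  have hUV : ∀ u ∈ Icc 1 n \ Z, u ∈ Icc 1 n := fun u hu => (mem_sdiff.1 hu).1
  obtain ⟨hβ0, α, hα⟩ := weights_of_exchange (n := n) (U := Icc 1 n \ Z) (Z := Z)
    (a := fun p q => A p q + A q p) (β := β) (fun p q => add_comm _ _) hβ sdiff_disjoint
    (sdiff_union_of_subset hZ) hnZ (by omega) hU
    (by
      intro w hw x hx y hy z hz hxy hxz hyz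
      have h := hcost w {x} {y, z} (hUV w hw)
        (by simpa [insert_subset_iff] using hZ hx)
        (insert_subset (hZ hy) (singleton_subset_iff.2 (hZ hz)))
        (by simpa using hdisj w hw x hx)
        (by simpa using ⟨hdisj w hw y hy, hdisj w hw z hz⟩)
        (by simp [hxy, hxz])
        (by simp [hx])
        (by simp [insert_inter_of_mem, hy, hz, hyz])
        (by simp [insert_inter_of_notMem, hx, hUn w hw])
        (by simp [insert_inter_of_notMem, insert_inter_of_mem, hy, hz, hyz, hUn w hw])
        (by simp [insert_inter_of_notMem, insert_inter_of_mem, hx, hy, hz, hxy.symm, hxz, hyz,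
          hUn w hw])
      simp only [sInf_coe_insert, singleton_nonempty, coe_singleton, csInf_singleton,
        sum_pair hyz, sum_singleton] at h
      linarith)
    (by
      intro w hw t ht hwt x hx y hy z hz hxy hxz hyz
      have hxt := (hdisj t ht x hx).symm
      have h := hcost w {x, t} {y, z} (hUV w hw)
        (insert_subset (hZ hx) (singleton_subset_iff.2 (hUV t ht)))
        (insert_subset (hZ hy) (singleton_subset_iff.2 (hZ hz)))
        (by simpa using ⟨hdisj w hw x hx, hwt⟩)
        (by simpa using ⟨hdisj w hw y hy, hdisj w hw z hz⟩)
        (by simp [hxy.symm, hxz.symm, (hdisj t ht y hy).symm, (hdisj t ht z hz).symm])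
        (by simp [insert_inter_of_mem, hx, hUn t ht])
        (by simp [insert_inter_of_mem, hy, hz, hyz])
        (by simp [insert_inter_of_notMem, insert_inter_of_mem, hx, hUn w hw, hUn t ht])
        (by simp [insert_inter_of_notMem, insert_inter_of_mem, hy, hz, hyz, hUn w hw])
        (by simp [insert_inter_of_notMem, insert_inter_of_mem, hx, hy, hz, hxy.symm, hxz, hyz,
          hUn w hw, hUn t ht])
      simp only [sInf_coe_insert, singleton_nonempty, coe_singleton, csInf_singleton,
        sum_pair hyz, sum_pair hxt] at h
      linarith)
    (by
      intro w hw t ht s hs hwt hws hts x hx y hy z hz hxy hxz hyz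
      have hxt := (hdisj t ht x hx).symm
      have hxs := (hdisj s hs x hx).symm
      have h := hcost w {x, t, s} {y, z} (hUV w hw)
        (insert_subset (hZ hx) (insert_subset (hUV t ht) (singleton_subset_iff.2 (hUV s hs))))
        (insert_subset (hZ hy) (singleton_subset_iff.2 (hZ hz)))
        (by simpa using ⟨hdisj w hw x hx, hwt, hws⟩)
        (by simpa using ⟨hdisj w hw y hy, hdisj w hw z hz⟩)
        (by simp [hxy.symm, hxz.symm, (hdisj t ht y hy).symm, (hdisj t ht z hz).symm,
          (hdisj s hs y hy).symm, (hdisj s hs z hz).symm])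
        (by simp [insert_inter_of_notMem, insert_inter_of_mem, hx, hUn t ht, hUn s hs])
        (by simp [insert_inter_of_mem, hy, hz, hyz])
        (by simp [insert_inter_of_notMem, insert_inter_of_mem, hx, hUn w hw, hUn t ht, hUn s hs])
        (by simp [insert_inter_of_notMem, insert_inter_of_mem, hy, hz, hyz, hUn w hw])
        (by simp [insert_inter_of_notMem, insert_inter_of_mem, hx, hy, hz, hxy.symm, hxz, hyz,
          hUn w hw, hUn t ht, hUn s hs])
      rw [sum_insert (by simp [hxt, hxs])] at h
      simp only [sInf_coe_insert, singleton_nonempty, insert_nonempty, coe_singleton,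
        csInf_singleton, sum_pair hyz, sum_pair hts] at h
      linarith)
    (by
      intro w hw t ht hwt x hx y hy z hz hxy hxz hyz
      have hyt := (hdisj t ht y hy).symm
      have hzt := (hdisj t ht z hz).symm
      have h := hcost w {x} {y, z, t} (hUV w hw)
        (singleton_subset_iff.2 (hZ hx))
        (insert_subset (hZ hy) (insert_subset (hZ hz) (singleton_subset_iff.2 (hUV t ht))))
        (by simpa using hdisj w hw x hx)
        (by simpa using ⟨hdisj w hw y hy, hdisj w hw z hz, hwt⟩)
        (by simp [hxy, hxz, (hdisj t ht x hx).symm])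
        (by simp [hx])
        (by simp [insert_inter_of_mem, hy, hz, hyz, hUn t ht])
        (by simp [insert_inter_of_notMem, hx, hUn w hw])
        (by simp [insert_inter_of_notMem, insert_inter_of_mem, hy, hz, hyz, hUn w hw, hUn t ht])
        (by simp [insert_inter_of_notMem, insert_inter_of_mem, hx, hy, hz, hxy.symm, hxz.symm, hyz,
          hUn w hw, hUn t ht])
      rw [sum_insert (s := {z, t}) (by simp [hyz, hyt])] at h
      simp only [sInf_coe_insert, singleton_nonempty, insert_nonempty, coe_singleton,
        csInf_singleton, sum_pair hzt, sum_singleton] at h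
      linarith)
    (by
      intro x hx y hy z hz hxy hxz hyz
      have h := hcost z {x} {y} (hZ hz)
        (singleton_subset_iff.2 (hZ hx)) (singleton_subset_iff.2 (hZ hy))
        (by simpa using hxz.symm) (by simpa using hyz.symm) (by simpa using hxy)
        (by simp [hx]) (by simp [hy])
        (by simp [insert_inter_of_mem, hx, hz, hxz.symm])
        (by simp [insert_inter_of_mem, hy, hz, hyz.symm])
        (by simp [insert_inter_of_mem, hx, hy, hz, hxz.symm, hyz.symm, hxy])
      simp only [coe_singleton, csInf_singleton, sum_singleton] at h
      linarith)
  refine ⟨α, ∑ v ∈ Icc 1 n, A v v, fun π => ?_⟩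
  rw [edgeSumLin_charVec, ← π.sum_sum_eq, mul_sum, ← sum_add_distrib, charVec_eq_sum, map_sum]
  refine sum_congr rfl fun C hC => ?_
  have hCne := π.parts_nonempty C hC
  have hmin : sInf (C : Set ℕ) ∈ C := mem_coe.1 (Nat.sInf_mem (coe_nonempty.2 hCne))
  rw [hA C hCne, clusterWeight, hβ0 _ (π.subset_Icc hC hmin),
    sum_sum_eq_of_symm_weights (π.subset_Icc hC) hα]
  ring

end Sufficiency

end

/-- For `n ≥ 5`, `3 ≤ K ≤ n-2` and `Z ⊆ V` with `|Z| = qK + r ≥ K+1` (`q ≥ 1`,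
`0 ≤ r ≤ K-1`), the general clique inequality
`x(E(Z)) ≥ C(q+1,2)·r + C(q,2)·(K-r)` is valid for `P_{n,K}`, and it is facet-defining
iff (i) `U = V ∖ Z` is nonempty with `min U ≤ 3`, (ii) `n ∈ Z`, and
(iii) `K+1 ≤ |Z| ≤ 2K-1`. -/
theorem general_clique_facet (n K q r : ℕ) (Z : Finset ℕ) (hn : 5 ≤ n) (hK1 : 3 ≤ K)
    (hK2 : K ≤ n - 2) (hZ : Z ⊆ Finset.Icc 1 n) (hZK : K + 1 ≤ Z.card)
    (hq : 1 ≤ q) (hr : r ≤ K - 1) (hqr : Z.card = q * K + r) :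
    (∀ x ∈ PolyP n K,
      ((Nat.choose (q + 1) 2 * r + Nat.choose q 2 * (K - r) : ℕ) : ℝ) ≤ edgeSum Z x) ∧
    (IsFacetGe n K (fun x => edgeSum Z x)
        ((Nat.choose (q + 1) 2 * r + Nat.choose q 2 * (K - r) : ℕ) : ℝ) ↔
      ((∃ u ∈ Finset.Icc 1 n \ Z, u ≤ 3) ∧ n ∈ Z ∧
        (K + 1 ≤ Z.card ∧ Z.card ≤ 2 * K - 1))) := by
  have hrK : r ≤ K := by omega
  refine ⟨fun x hx => le_apply_of_mem_PolyP (g := edgeSumLin Z)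
    (le_edgeSumLin_charVec hZ hrK hqr) hx, fun hfac => ?_, fun ⟨hU, hnZ, _, hZK'⟩ => ?_⟩
  · replace hfac : IsFacetGe n K (edgeSumLin Z) _ := hfac
    have hlast : ¬ (n ∉ Z ∨ 2 * K ≤ Z.card) := fun h =>
      not_isFacetGe_of_isolated_last hn hK1 hK2 hZ hZK hq hr hqr h hfac
    simp only [not_or, not_not, not_le] at hlast
    obtain ⟨hnZ, hZK'⟩ := hlast
    refine ⟨?_, hnZ, hZK, by omega⟩
    by_contra! hU
    have hsmall : ∀ v, 1 ≤ v → v ≤ 3 → v ∈ Z := fun v h1 h3 => by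
      by_contra hv
      have := hU v (Finset.mem_sdiff.2 ⟨Finset.mem_Icc.2 ⟨h1, by omega⟩, hv⟩)
      omega
    refine not_isFacetGe_of_three_mem hn hK1 hK2 hZ hr hqr ?_ hnZ
      ⟨hsmall 1 (by omega) (by omega), hsmall 2 (by omega) (by omega),
        hsmall 3 (by omega) (by omega)⟩ hfac
    by_contra hq1
    have : 2 * K ≤ q * K := Nat.mul_le_mul_right K (by omega)
    omega
  · refine isFacetGe_edgeSumLin hK1 hK2 hZ hZK hr hqr ?_ hZK' hnZ hU
    by_contra hq1
    have : 2 * K ≤ q * K := Nat.mul_le_mul_right K (by omega)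
    omega
end
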